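/- Non-degeneracy (boundary density) estimate: let B be a ball centered on Γ and let u ∈ W_r(4B) be a nonnegative supersolution of Lu = 0 in 4B ∖ Γ such that Tu = 1 σ-almost everywhere on Γ ∩ 4B. Then ess inf_{B∖Γ} u ≥ C⁻¹, where C > 0 depends only on n, d, C₀, and C₁. -/

import Mathlib

open MeasureTheory Metric Set Filter
open scoped ENNReal NNReal Topology

noncomputable section

/-- Euclidean space `ℝⁿ`. -/
abbrev Euc (n : ℕ) := EuclideanSpace ℝ (Fin n)

/-- `Γ ⊆ ℝⁿ` is `d`-Ahlfors regular with constant `C₀`. -/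
def AhlforsRegular (n : ℕ) (d C₀ : ℝ) (Γ : Set (Euc n)) : Prop :=
  ∀ x ∈ Γ, ∀ r : ℝ, 0 < r →
    ENNReal.ofReal (C₀⁻¹ * r ^ d) ≤ μH[d] (Γ ∩ ball x r) ∧
      μH[d] (Γ ∩ ball x r) ≤ ENNReal.ofReal (C₀ * r ^ d)

/-- The weight `w(x) = dist(x, Γ) ^ (d + 1 - n)`. -/
def weightW (n : ℕ) (d : ℝ) (Γ : Set (Euc n)) (x : Euc n) : ℝ :=
  infDist x Γ ^ (d + 1 - (n : ℝ))

/-- The measure `m` with density `w` with respect to Lebesgue measure. -/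
def measW (n : ℕ) (d : ℝ) (Γ : Set (Euc n)) : Measure (Euc n) :=
  volume.withDensity fun x => ENNReal.ofReal (weightW n d Γ x)

/-- `v` is a distributional gradient of `u` on the open set `E`: for every smooth
compactly supported test function `φ` with support in `E`, `∫_E u ∇φ = -∫_E φ v`. -/
def IsDistribGradOn {n : ℕ} (u : Euc n → ℝ) (v : Euc n → Euc n) (E : Set (Euc n)) : Prop :=
  ∀ φ : Euc n → ℝ, ContDiff ℝ (⊤ : ℕ∞) φ → HasCompactSupport φ → tsupport φ ⊆ E →
    ∫ x in E, u x • gradient φ x = -∫ x in E, φ x • v x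

/-- The averages of `u` over small balls centered at `x` converge to `t`. -/
def HasTraceAt {n : ℕ} (u : Euc n → ℝ) (x : Euc n) (t : ℝ) : Prop :=
  Tendsto (fun ρ : ℝ => ⨍ y in ball x ρ, u y) (𝓝[>] (0 : ℝ)) (𝓝 t)

/-- `u` belongs to the weighted Sobolev space `W = Ẇ^{1,2}_w(Ω)`, `Ω = Γᶜ`, with
distributional gradient `v` on `Ω` lying in `L²(Ω, m)`. -/
structure MemW (n : ℕ) (d : ℝ) (Γ : Set (Euc n)) (u : Euc n → ℝ) (v : Euc n → Euc n) :
    Prop where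
  locInt : LocallyIntegrableOn u Γᶜ volume
  gradLocInt : LocallyIntegrableOn v Γᶜ volume
  isGrad : IsDistribGradOn u v Γᶜ
  l2 : ∫⁻ x in Γᶜ, ENNReal.ofReal (‖v x‖ ^ 2) ∂(measW n d Γ) < ⊤

/-- `u` belongs to the local space `W_r(E)`: `u ∈ L¹_loc(E)` and `φ u` (extended by `0`)
belongs to `W` for every smooth compactly supported `φ` with support in `E`. -/
def MemWrOn (n : ℕ) (d : ℝ) (Γ : Set (Euc n)) (E : Set (Euc n)) (u : Euc n → ℝ) : Prop :=
  LocallyIntegrableOn u E volume ∧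
    ∀ φ : Euc n → ℝ, ContDiff ℝ (⊤ : ℕ∞) φ → HasCompactSupport φ → tsupport φ ⊆ E →
      ∃ vφ : Euc n → Euc n, MemW n d Γ (fun x => φ x * u x) vφ

/-- Degenerate ellipticity and boundedness conditions for the matrix `A`. -/
def EllipticOn (n : ℕ) (d : ℝ) (Γ : Set (Euc n)) (A : Euc n → Euc n →L[ℝ] Euc n)
    (C₁ : ℝ) : Prop :=
  ∀ x, x ∉ Γ →
    (∀ ξ ζ : Euc n, |∑ i, A x ξ i * ζ i| ≤ C₁ * weightW n d Γ x * ‖ξ‖ * ‖ζ‖) ∧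
      ∀ ξ : Euc n, C₁⁻¹ * weightW n d Γ x * ‖ξ‖ ^ 2 ≤ ∑ i, A x ξ i * ξ i

/-- `u`, with gradient `v`, is a weak subsolution of `- div A ∇u = 0` on `U ⊆ Ω = Γᶜ`. -/
def SubsolOn {n : ℕ} (Γ : Set (Euc n)) (A : Euc n → Euc n →L[ℝ] Euc n)
    (v : Euc n → Euc n) (U : Set (Euc n)) : Prop :=
  ∀ φ : Euc n → ℝ, ContDiff ℝ (⊤ : ℕ∞) φ → HasCompactSupport φ → tsupport φ ⊆ U →
    (∀ x, 0 ≤ φ x) → ∫ x in Γᶜ, ∑ i, A x (v x) i * gradient φ x i ≤ 0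

/-- `u`, with gradient `v`, is a weak supersolution of `- div A ∇u = 0` on `U ⊆ Ω = Γᶜ`. -/
def SupersolOn {n : ℕ} (Γ : Set (Euc n)) (A : Euc n → Euc n →L[ℝ] Euc n)
    (v : Euc n → Euc n) (U : Set (Euc n)) : Prop :=
  ∀ φ : Euc n → ℝ, ContDiff ℝ (⊤ : ℕ∞) φ → HasCompactSupport φ → tsupport φ ⊆ U →
    (∀ x, 0 ≤ φ x) → 0 ≤ ∫ x in Γᶜ, ∑ i, A x (v x) i * gradient φ x i

/-- `u`, with gradient `v`, is a weak solution of `- div A ∇u = 0` on `U ⊆ Ω = Γᶜ`. -/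
def SolOn {n : ℕ} (Γ : Set (Euc n)) (A : Euc n → Euc n →L[ℝ] Euc n)
    (v : Euc n → Euc n) (U : Set (Euc n)) : Prop :=
  ∀ φ : Euc n → ℝ, ContDiff ℝ (⊤ : ℕ∞) φ → HasCompactSupport φ → tsupport φ ⊆ U →
    ∫ x in Γᶜ, ∑ i, A x (v x) i * gradient φ x i = 0

set_option linter.all false
set_option linter.deprecated false
open ENNReal (mul_lt_top ofReal ofReal_add ofReal_coe_nnreal ofReal_eq_zero ofReal_le_iff_le_toReal ofReal_le_ofReal ofReal_lt_top ofReal_mul ofReal_ne_top ofReal_ofNat ofReal_one ofReal_pow ofReal_rpow_of_nonneg ofReal_toReal ofReal_tsum_of_nonneg ofReal_zero)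

lemma lcR {α : Type*} [MeasurableSpace α] {μ : Measure α} (f : α → ℝ≥0∞) (p : ℝ) :
    ∫⁻ x, ofReal p * f x ∂μ = ofReal p * ∫⁻ x, f x ∂μ := lintegral_const_mul' _ _ ofReal_ne_top

lemma sqz {α β : Type*} [TopologicalSpace α] [Preorder α] [OrderTopology α] {f h : β → α} {b : Filter β} {a : α}
    (hh : Tendsto h b (𝓝 a)) (h1 : ∀ᶠ x in b, a ≤ f x) (h2 : ∀ᶠ x in b, f x ≤ h x) : Tendsto f b (𝓝 a) :=
  tendsto_of_tendsto_of_tendsto_of_le_of_le' tendsto_const_nhds hh h1 h2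

variable {n : ℕ} {d C₀ C₁ : ℝ} {Γ : Set (Euc n)} {x0 x y : Euc n} {r a b ε s M τ R : ℝ} {u f φ ψ : Euc n → ℝ}
  {V B v g : Euc n → Euc n} {U : Set (Euc n)} {Q Q1 : ℝ → ℝ}

lemma grad_mul {f g : Euc n → ℝ} (hf : DifferentiableAt ℝ f x)
    (hg : DifferentiableAt ℝ g x) :
    gradient (fun y => f y * g y) x = f x • gradient g x + g x • gradient f x := by
  apply HasGradientAt.gradient
  rw [hasGradientAt_iff_hasFDerivAt]
  have h := hf.hasFDerivAt.mul hg.hasFDerivAt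
  simp only [map_add, map_smul, toDual_gradient]
  exact h

lemma grad_comp {G : ℝ → ℝ} {a : ℝ}
    (hG : HasDerivAt G a (f x)) (hf : DifferentiableAt ℝ f x) :
    gradient (fun y => G (f y)) x = a • gradient f x := by
  apply HasGradientAt.gradient
  rw [hasGradientAt_iff_hasFDerivAt]
  have h := hG.comp_hasFDerivAt x hf.hasFDerivAt
  simp only [map_smul, toDual_gradient]
  exact h

lemma norm_grad : ‖gradient f x‖ = ‖fderiv ℝ f x‖ := by
  rw [← toDual_gradient, LinearIsometryEquiv.norm_map]

lemma grad_inner (f : Euc n → ℝ) (x y : Euc n) :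
    inner ℝ (gradient f x) y = fderiv ℝ f x y := by
  rw [inner_gradient_left]

lemma continuous_grad (hf : ContDiff ℝ 1 f) : Continuous (gradient f) := by
  have := hf.continuous_fderiv (by norm_num)
  unfold gradient
  exact (LinearIsometryEquiv.continuous _).comp this

lemma gz0 (hx : x ∉ tsupport f) :
    gradient f x = 0 := by
  unfold gradient
  rw [fderiv_of_notMem_tsupport (𝕜 := ℝ) hx]; simp

lemma sum_mul_inner (a b : Euc n) : ∑ i, a i * b i = inner ℝ a b := by
  simp [PiLp.inner_apply, mul_comm]

lemma hcs_grad (hf : HasCompactSupport f) :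
    HasCompactSupport (gradient f) := by
  refine HasCompactSupport.intro hf (fun x hx => gz0 hx)

def cut {n : ℕ} (x0 : Euc n) (a b : ℝ) (x : Euc n) : ℝ :=
  Real.smoothTransition ((b ^ 2 - ‖x - x0‖ ^ 2) / (b ^ 2 - a ^ 2))

lemma cut_contDiff (x0 : Euc n) (a b : ℝ) : ContDiff ℝ (⊤ : ℕ∞) (cut x0 a b) := by
  unfold cut
  apply Real.smoothTransition.contDiff.comp
  apply ContDiff.div_const
  exact contDiff_const.sub ((contDiff_id.sub contDiff_const).norm_sq ℝ)

lemma cut_nonneg (x0 : Euc n) (a b : ℝ) (x : Euc n) : 0 ≤ cut x0 a b x :=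
  Real.smoothTransition.nonneg _
lemma cut_le_one (x0 : Euc n) (a b : ℝ) (x : Euc n) : cut x0 a b x ≤ 1 :=
  Real.smoothTransition.le_one _

lemma cut_eq_one (ha : 0 < a) (hab : a < b) {x : Euc n}
    (hx : dist x x0 ≤ a) : cut x0 a b x = 1 := by
  apply Real.smoothTransition.one_of_one_le
  rw [dist_eq_norm] at hx
  rw [le_div_iff₀ (by nlinarith)]
  nlinarith [norm_nonneg (x - x0)]

lemma cut_eq_zero (ha : 0 < a) (hab : a < b) {x : Euc n}
    (hx : b ≤ dist x x0) : cut x0 a b x = 0 := by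
  apply Real.smoothTransition.zero_of_nonpos
  rw [dist_eq_norm] at hx
  apply div_nonpos_of_nonpos_of_nonneg <;> nlinarith [norm_nonneg (x - x0)]

lemma cut_tsupport (ha : 0 < a) (hab : a < b) :
    tsupport (cut x0 a b) ⊆ closedBall x0 b := by
  apply closure_minimal _ isClosed_closedBall
  intro x hx
  by_contra h
  rw [mem_closedBall, not_le] at h
  exact hx (cut_eq_zero ha hab h.le)

lemma cut_hcs (ha : 0 < a) (hab : a < b) :
    HasCompactSupport (cut x0 a b) :=
  (isCompact_closedBall x0 b).of_isClosed_subset (isClosed_tsupport _) (cut_tsupport ha hab)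

lemma grad_cut (x0 : Euc n) (a b : ℝ) (x : Euc n) :
    gradient (cut x0 a b) x =
      (deriv Real.smoothTransition ((b ^ 2 - ‖x - x0‖ ^ 2) / (b ^ 2 - a ^ 2))
        * (-2 / (b ^ 2 - a ^ 2))) • (x - x0) := by
  apply HasGradientAt.gradient
  rw [hasGradientAt_iff_hasFDerivAt]
  have h1 : HasFDerivAt (fun x : Euc n => ‖x - x0‖ ^ 2) (2 • innerSL ℝ (x - x0)) x := by
    have := ((hasFDerivAt_id (𝕜 := ℝ) x).sub_const x0).norm_sq
    exact this.congr_fderiv (by ext v; simp)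
  have h2 : HasFDerivAt (fun x : Euc n => (b ^ 2 - ‖x - x0‖ ^ 2) / (b ^ 2 - a ^ 2))
      ((-2 / (b ^ 2 - a ^ 2)) • innerSL ℝ (x - x0)) x := by
    have := (h1.const_sub (b ^ 2)).mul_const ((b ^ 2 - a ^ 2)⁻¹)
    refine (this.congr_fderiv ?_)
    ext v; simp [div_eq_mul_inv]; ring
  have h3 := ((Real.smoothTransition.contDiff (n := 1)).differentiable (by norm_num)
    ((b ^ 2 - ‖x - x0‖ ^ 2) / (b ^ 2 - a ^ 2))).hasDerivAt.comp_hasFDerivAt x h2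
  refine h3.congr_fderiv ?_
  ext v; simp [mul_assoc]

lemma st_deriv_nonneg (t : ℝ) : 0 ≤ deriv Real.smoothTransition t :=
  Real.smoothTransition.monotone.deriv_nonneg

lemma st_deriv_bdd : ∃ L : ℝ, 0 < L ∧ ∀ t, |deriv Real.smoothTransition t| ≤ L := by
  have hc : Continuous (deriv Real.smoothTransition) :=
    (Real.smoothTransition.contDiff (n := 1)).continuous_deriv (by norm_num)
  obtain ⟨L, hL⟩ := (isCompact_Icc (a := (0 : ℝ)) (b := 1)).exists_bound_of_continuousOn
    hc.continuousOn
  refine ⟨max L 1, by positivity, fun t => ?_⟩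
  by_cases ht : t ∈ Icc (0 : ℝ) 1
  · exact (hL t ht).trans (le_max_left _ _)
  · have : deriv Real.smoothTransition t = 0 := by
      simp only [mem_Icc, not_and_or, not_le] at ht
      rcases ht with ht | ht
      · have : Real.smoothTransition =ᶠ[𝓝 t] fun _ => 0 := by
          filter_upwards [Iio_mem_nhds ht] with s hs
          exact Real.smoothTransition.zero_of_nonpos (le_of_lt hs)
        rw [this.deriv_eq]; simp
      · have : Real.smoothTransition =ᶠ[𝓝 t] fun _ => 1 := by
          filter_upwards [Ioi_mem_nhds ht] with s hs
          exact Real.smoothTransition.one_of_one_le (le_of_lt hs)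
        rw [this.deriv_eq]; simp
    rw [this]; simp

lemma grad_cut_zero (ha : 0 < a) (hab : a < b) {x : Euc n}
    (hx : dist x x0 < a) : gradient (cut x0 a b) x = 0 := by
  have : cut x0 a b =ᶠ[𝓝 x] fun _ => 1 := by
    filter_upwards [isOpen_ball.mem_nhds (mem_ball.2 hx)] with y hy
    exact cut_eq_one ha hab (le_of_lt hy)
  rw [this.gradient_eq]; simp

lemma grad_cut_bound : ∃ L : ℝ, 0 < L ∧ ∀ (n : ℕ) (x0 : Euc n) (a b : ℝ), 0 < a → a < b →
    ∀ x, ‖gradient (cut x0 a b) x‖ ≤ L / (b - a) := by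
  obtain ⟨L, hL, h⟩ := st_deriv_bdd
  refine ⟨2 * L, by positivity, fun n x0 a b ha hab x => ?_⟩
  have hp : 0 < b ^ 2 - a ^ 2 := by nlinarith
  by_cases hx : x ∈ tsupport (cut x0 a b)
  · have hx := cut_tsupport ha hab hx
    rw [mem_closedBall, dist_eq_norm] at hx
    rw [grad_cut, norm_smul, norm_mul, Real.norm_eq_abs, Real.norm_eq_abs, abs_div, abs_of_pos hp]
    simp only [abs_neg, Nat.abs_ofNat]
    calc _ ≤ L * (2 / (b ^ 2 - a ^ 2)) * b := by
          gcongr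
          exact h _
      _ ≤ _ := by
          rw [le_div_iff₀ (by linarith)]
          have : L * (2 / (b ^ 2 - a ^ 2)) * b * (b - a) = 2 * L * (b / (b + a)) := by
            have : b ^ 2 - a ^ 2 = (b - a) * (b + a) := by ring
            have h1 : b - a ≠ 0 := by linarith
            have h2 : b + a ≠ 0 := by linarith
            rw [this]; field_simp
          rw [this]
          have : b / (b + a) ≤ 1 := by rw [div_le_one (by linarith)]; linarith
          nlinarith
  · rw [gz0 hx, norm_zero]
    have : 0 < b - a := by linarith
    positivity

lemma grad_cut_inner (ha : 0 < a) (hab : a < b) {x y : Euc n}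
    (hy : dist y x0 ≤ a) : inner ℝ (gradient (cut x0 a b) x) (x - y) ≤ 0 := by
  by_cases hx : dist x x0 < a
  · rw [grad_cut_zero ha hab hx]; simp
  · rw [not_lt, dist_eq_norm] at hx
    rw [dist_eq_norm] at hy
    rw [grad_cut, inner_smul_left]
    have hp : 0 < b ^ 2 - a ^ 2 := by nlinarith
    have h1 : 0 ≤ inner ℝ (x - x0) (x - y) := by
      have : x - y = (x - x0) - (y - x0) := by abel
      rw [this, inner_sub_right, real_inner_self_eq_norm_sq]
      have := real_inner_le_norm (x - x0) (y - x0)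
      nlinarith [norm_nonneg (x - x0)]
    apply mul_nonpos_of_nonpos_of_nonneg _ h1
    simp only [conj_trivial]
    apply mul_nonpos_of_nonneg_of_nonpos (st_deriv_nonneg _)
    apply div_nonpos_of_nonpos_of_nonneg <;> linarith

structure Geo (n : ℕ) (d C₀ : ℝ) (Γ : Set (Euc n)) : Prop where
  hn : 2 ≤ n
  hd0 : 0 < d
  hdn : d < (n : ℝ) - 1
  hC0 : 1 ≤ C₀
  ne : Γ.Nonempty
  cl : IsClosed Γ
  ar : AhlforsRegular n d C₀ Γ

lemma tsum_geo {c q : ℝ} (hc : 0 ≤ c) (hq : 0 ≤ q) (hq1 : q < 1) :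
    ∑' k : ℕ, ofReal (c * q ^ k) = ofReal (c / (1 - q)) := by
  rw [← ofReal_tsum_of_nonneg (fun k => by positivity)
    ((summable_geometric_of_lt_one hq hq1).mul_left c), tsum_mul_left,
    tsum_geometric_of_lt_one hq hq1, div_eq_mul_inv]

lemma kernel_shell {X : Type*} [PseudoMetricSpace X] [MeasurableSpace X] [OpensMeasurableSpace X]
    (μ : Measure X) (z : X) {K a α s t : ℝ} (hα : 0 ≤ α) (hs : 0 < s) (hst : 0 < t)
    (h : μ (ball z t) ≤ ofReal (K * t ^ a)) :
    ∫⁻ y in {y | s ≤ dist y z ∧ dist y z < t}, ofReal (dist y z ^ (-α)) ∂μ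
      ≤ ofReal (s ^ (-α) * (K * t ^ a)) := by
  have hm : MeasurableSet {y | s ≤ dist y z ∧ dist y z < t} := by measurability
  calc _ ≤ ∫⁻ y in {y | s ≤ dist y z ∧ dist y z < t}, ofReal (s ^ (-α)) ∂μ := by
        apply setLIntegral_mono' hm
        intro y hy
        apply ofReal_le_ofReal
        exact Real.rpow_le_rpow_of_nonpos hs hy.1 (by linarith)
    _ = ofReal (s ^ (-α)) * μ {y | s ≤ dist y z ∧ dist y z < t} := by simp
    _ ≤ ofReal (s ^ (-α)) * ofReal (K * t ^ a) := by
        gcongr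
        refine (measure_mono ?_).trans h
        intro y hy; exact hy.2
    _ = _ := by rw [← ofReal_mul (by positivity : 0 ≤ s ^ (-α))]

lemma kernel_far {X : Type*} [PseudoMetricSpace X] [MeasurableSpace X] [OpensMeasurableSpace X]
    (μ : Measure X) (z : X) {K a α s : ℝ} (hK : 0 ≤ K) (hα : 0 ≤ α) (ha : a < α) (hs : 0 < s)
    (h : ∀ ρ > 0, μ (ball z ρ) ≤ ofReal (K * ρ ^ a)) :
    ∫⁻ y in {y | s ≤ dist y z}, ofReal (dist y z ^ (-α)) ∂μ
      ≤ ofReal (K * 2 ^ a * s ^ (a - α) / (1 - 2 ^ (a - α))) := by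
  have hq : (2 : ℝ) ^ (a - α) < 1 := Real.rpow_lt_one_of_one_lt_of_neg (by norm_num) (by linarith)
  calc _ ≤ ∫⁻ y in ⋃ k : ℕ, {y | 2 ^ k * s ≤ dist y z ∧ dist y z < 2 * (2 ^ k * s)},
          ofReal (dist y z ^ (-α)) ∂μ := by
        apply lintegral_mono_set
        intro y (hy : s ≤ dist y z)
        obtain ⟨k, h1, h2⟩ := exists_nat_pow_near (x := dist y z / s) (y := 2)
          (by rwa [le_div_iff₀ hs, one_mul]) (by norm_num)
        rw [le_div_iff₀ hs] at h1
        rw [div_lt_iff₀ hs] at h2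
        exact mem_iUnion.2 ⟨k, h1, by rw [pow_succ] at h2; linarith⟩
    _ ≤ ∑' k : ℕ, ∫⁻ y in {y | 2 ^ k * s ≤ dist y z ∧ dist y z < 2 * (2 ^ k * s)},
          ofReal (dist y z ^ (-α)) ∂μ := lintegral_iUnion_le _ _
    _ ≤ ∑' k : ℕ, ofReal ((K * 2 ^ a * s ^ (a - α)) * (2 ^ (a - α)) ^ k) := by
        apply ENNReal.tsum_le_tsum
        intro k
        refine (kernel_shell μ z hα (by positivity) (by positivity) (h _ (by positivity))).trans_eq ?_
        congr 1
        rw [Real.mul_rpow (x := 2) (y := 2 ^ k * s) (by norm_num) (by positivity),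
          ← Real.rpow_mul_natCast (by norm_num)]
        have : ((2 : ℝ) ^ k * s) ^ (-α) * (K * (2 ^ a * (2 ^ k * s) ^ a))
          = K * 2 ^ a * ((2 ^ k * s) ^ (a - α)) := by
          rw [sub_eq_neg_add a α, Real.rpow_add (by positivity)]; ring
        rw [this, Real.mul_rpow (by positivity) hs.le, ← Real.rpow_natCast, ← Real.rpow_mul
          (by norm_num)]
        ring_nf
    _ = _ := tsum_geo (by positivity) (by positivity) hq

lemma kernel_near {X : Type*} [PseudoMetricSpace X] [MeasurableSpace X] [OpensMeasurableSpace X]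
    (μ : Measure X) (z : X) {K a α s : ℝ} (hK : 0 ≤ K) (hα : 0 < α) (ha : α < a) (hs : 0 < s)
    (h : ∀ ρ > 0, μ (ball z ρ) ≤ ofReal (K * ρ ^ a)) :
    ∫⁻ y in ball z s, ofReal (dist y z ^ (-α)) ∂μ
      ≤ ofReal (K * 2 ^ α * s ^ (a - α) / (1 - 2 ^ (α - a))) := by
  have hq : (2 : ℝ) ^ (α - a) < 1 := Real.rpow_lt_one_of_one_lt_of_neg (by norm_num) (by linarith)
  have h0 : ∫⁻ y in {y | dist y z = 0}, ofReal (dist y z ^ (-α)) ∂μ = 0 := by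
    rw [setLIntegral_congr_fun (g := fun _ => 0) (by measurability)]
    · simp
    · intro y (hy : dist y z = 0)
      simp only [hy]
      rw [Real.zero_rpow (by linarith)]; simp
  calc _ ≤ ∫⁻ y in {y | dist y z = 0} ∪ ⋃ k : ℕ, {y | (1/2) ^ (k+1) * s ≤ dist y z ∧
          dist y z < (1/2) ^ k * s},
          ofReal (dist y z ^ (-α)) ∂μ := by
        apply lintegral_mono_set
        intro y (hy : dist y z < s)
        rcases eq_or_lt_of_le (dist_nonneg (x := y) (y := z)) with h0 | h0
        · left; exact h0.symm
        right
        obtain ⟨k, h1, h2⟩ := exists_nat_pow_near_of_lt_one (x := dist y z / s) (y := 1/2)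
          (by positivity) (by rw [div_le_one hs]; exact hy.le) (by norm_num) (by norm_num)
        rw [div_le_iff₀ hs] at h2
        rw [lt_div_iff₀ hs] at h1
        rcases eq_or_lt_of_le h2 with h2 | h2
        · rcases k with _ | k
          · simp at h2; linarith
          · refine mem_iUnion.2 ⟨k, h2.ge, h2.le.trans_lt ?_⟩
            rw [pow_succ]; have : 0 < (1/2 : ℝ) ^ k * s := by positivity
            linarith
        · exact mem_iUnion.2 ⟨k, h1.le, h2⟩
    _ ≤ _ := lintegral_union_le _ _ _
    _ ≤ 0 + ∑' k : ℕ, ∫⁻ y in {y | (1/2) ^ (k+1) * s ≤ dist y z ∧ dist y z < (1/2) ^ k * s},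
          ofReal (dist y z ^ (-α)) ∂μ := by
        rw [h0]; gcongr; exact lintegral_iUnion_le _ _
    _ ≤ ∑' k : ℕ, ofReal ((K * 2 ^ α * s ^ (a - α)) * (2 ^ (α - a)) ^ k) := by
        rw [zero_add]
        apply ENNReal.tsum_le_tsum
        intro k
        refine (kernel_shell μ z hα.le (by positivity) (by positivity) (h _ (by positivity))).trans_eq ?_
        congr 1
        have e : (1/2 : ℝ) ^ (k+1) * s = ((1/2) ^ k * s) * 2⁻¹ := by rw [pow_succ]; ring
        rw [e, Real.mul_rpow (by positivity) (by norm_num), Real.inv_rpow (by norm_num),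
          ← Real.rpow_neg (by norm_num), neg_neg]
        have : ((1/2 : ℝ) ^ k * s) ^ (-α) * 2 ^ α * (K * ((1/2) ^ k * s) ^ a)
          = K * 2 ^ α * (((1/2) ^ k * s) ^ (a - α)) := by
          rw [sub_eq_neg_add a α, Real.rpow_add (by positivity)]; ring
        rw [this, Real.mul_rpow (by positivity) hs.le]
        have : ((1/2 : ℝ) ^ k) ^ (a - α) = (2 ^ (α - a)) ^ k := by
          rw [one_div, inv_pow, Real.inv_rpow (by positivity), ← Real.rpow_neg (by positivity),
            neg_sub, ← Real.rpow_natCast, ← Real.rpow_mul (by norm_num),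
            ← Real.rpow_natCast, ← Real.rpow_mul (by norm_num), mul_comm]
        rw [this]; ring
    _ = _ := tsum_geo (by positivity) (by positivity) hq

def sg (n : ℕ) (d : ℝ) (Γ : Set (Euc n)) : Measure (Euc n) := (μH[d]).restrict Γ

namespace Geo
variable {n : ℕ} {d C₀ : ℝ} {Γ : Set (Euc n)}

lemma sg_ball (G : Geo n d C₀ Γ) (z : Euc n) (ρ : ℝ) (hρ : 0 < ρ) :
    sg n d Γ (ball z ρ) ≤ ofReal ((C₀ * 2 ^ d) * ρ ^ d) := by
  unfold sg
  rw [Measure.restrict_apply measurableSet_ball]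
  by_cases h : (ball z ρ ∩ Γ).Nonempty
  · obtain ⟨y, hy1, hy2⟩ := h
    calc _ ≤ μH[d] (Γ ∩ ball y (2 * ρ)) := by
          apply measure_mono
          rintro x ⟨hx1, hx2⟩
          refine ⟨hx2, ?_⟩
          rw [mem_ball] at *
          calc dist x y ≤ dist x z + dist y z := dist_triangle_right _ _ _
            _ < _ := by linarith
      _ ≤ _ := (G.ar y hy2 (2 * ρ) (by positivity)).2
      _ = _ := by rw [Real.mul_rpow (by norm_num) hρ.le, mul_assoc]
  · rw [not_nonempty_iff_eq_empty.1 h]; simp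

lemma lf (G : Geo n d C₀ Γ) : IsLocallyFiniteMeasure (sg n d Γ) :=
  ⟨fun x => ⟨ball x 1, ball_mem_nhds _ one_pos,
    (G.sg_ball x 1 one_pos).trans_lt ofReal_lt_top⟩⟩

lemma sg_ae (G : Geo n d C₀ Γ) : ∀ᵐ y ∂(sg n d Γ), y ∈ Γ :=
  ae_restrict_mem G.cl.measurableSet

lemma pos (G : Geo n d C₀ Γ) {x : Euc n} (hx : x ∉ Γ) : 0 < infDist x Γ :=
  (G.cl.notMem_iff_infDist_pos G.ne).1 hx

lemma volG (G : Geo n d C₀ Γ) : volume Γ = 0 := by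
  have h0 : (μH[d] : Measure (Euc n)) Γ ≠ ⊤ ∨ True := Or.inr trivial
  have key : (μH[(n : ℝ)] : Measure (Euc n)) Γ = 0 := by
    obtain ⟨y, hy⟩ := G.ne
    have : Γ = ⋃ k : ℕ, Γ ∩ ball y (k + 1) := by
      rw [← inter_iUnion]
      have : ⋃ k : ℕ, ball y ((k : ℝ) + 1) = univ := by
        rw [eq_univ_iff_forall]; intro x
        obtain ⟨k, hk⟩ := exists_nat_gt (dist x y)
        exact mem_iUnion.2 ⟨k, by rw [mem_ball]; linarith⟩
      rw [this, inter_univ]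
    rw [this, measure_iUnion_null_iff]
    intro k
    have h2 := (G.ar y hy (k + 1) (by positivity)).2
    rcases Measure.hausdorffMeasure_zero_or_top (show d < (n : ℝ) by linarith [G.hdn])
      (Γ ∩ ball y (k + 1)) with h | h
    · exact h
    · rw [h] at h2; simp at h2
  have e : (μH[(n : ℝ)] : Measure (Euc n)).IsAddHaarMeasure := by
    have := isAddHaarMeasure_hausdorffMeasure (E := Euc n)
    simpa using this
  exact (Measure.isAddLeftInvariant_eq_smul (volume : Measure (Euc n)) (μH[(n : ℝ)])).symm ▸ by
    simp [key]

lemma ae_notMem (G : Geo n d C₀ Γ) : ∀ᵐ x ∂(volume : Measure (Euc n)), x ∉ Γ :=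
  measure_eq_zero_iff_ae_notMem.1 G.volG

end Geo

lemma meas_w : Measurable (weightW n d Γ) := by
  unfold weightW
  exact (measurable_infDist).pow_const _

lemma kern_up (n : ℕ) (d C₀ α : ℝ) (hα : d < α) : ∃ C : ℝ, 0 < C ∧ ∀ Γ, Geo n d C₀ Γ →
    ∀ z ∉ Γ, ∫⁻ y, ofReal (dist y z ^ (-α)) ∂(sg n d Γ) ≤
      ofReal (C * infDist z Γ ^ (d - α)) := by
  have hq : (2 : ℝ) ^ (d - α) < 1 := Real.rpow_lt_one_of_one_lt_of_neg (by norm_num) (by linarith)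
  refine ⟨max 1 ((C₀ * 2 ^ d) * 2 ^ d / (1 - 2 ^ (d - α))), by positivity, fun Γ G z hz => ?_⟩
  have hz := G.pos hz
  have hC : 0 ≤ C₀ := by linarith [G.hC0]
  have h := kernel_far (sg n d Γ) z (K := C₀ * 2 ^ d) (a := d) (α := α) (by positivity)
    (by linarith [G.hd0]) hα hz (G.sg_ball z)
  have e : ∀ᵐ y ∂(sg n d Γ), y ∈ {y | infDist z Γ ≤ dist y z} := by
    filter_upwards [G.sg_ae] with y hy
    rw [dist_comm]; exact infDist_le_dist_of_mem hy
  rw [Measure.restrict_eq_self_of_ae_mem e] at h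
  refine h.trans (ofReal_le_ofReal ?_)
  calc _ = ((C₀ * 2 ^ d) * 2 ^ d / (1 - 2 ^ (d - α))) * infDist z Γ ^ (d - α) := by ring
    _ ≤ _ := by gcongr; exact le_max_right _ _

lemma kern_low (n : ℕ) (d C₀ α : ℝ) (hC : 1 ≤ C₀) (hα : 0 ≤ α) : ∃ c : ℝ, 0 < c ∧
    ∀ Γ, Geo n d C₀ Γ → ∀ x ∉ Γ, ∃ y0 ∈ Γ, dist x y0 = infDist x Γ ∧
      ofReal (c * infDist x Γ ^ (d - α)) ≤
        ∫⁻ y in ball y0 (infDist x Γ), ofReal (dist y x ^ (-α)) ∂(sg n d Γ) := by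
  refine ⟨2 ^ (-α) * C₀⁻¹, by positivity, fun Γ G x hx => ?_⟩
  have hδ := G.pos hx
  obtain ⟨y0, hy0, h0⟩ := G.cl.exists_infDist_eq_dist G.ne x
  refine ⟨y0, hy0, h0.symm, ?_⟩
  calc _ = ofReal ((2 * infDist x Γ) ^ (-α)) *
        ofReal (C₀⁻¹ * infDist x Γ ^ d) := by
        rw [← ofReal_mul (by positivity)]
        congr 1
        rw [Real.mul_rpow (by norm_num) hδ.le, sub_eq_neg_add, Real.rpow_add hδ]; ring
    _ ≤ ofReal ((2 * infDist x Γ) ^ (-α)) * sg n d Γ (ball y0 (infDist x Γ)) := by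
        gcongr
        unfold sg
        rw [Measure.restrict_apply measurableSet_ball, inter_comm]
        exact (G.ar y0 hy0 _ hδ).1
    _ = ∫⁻ y in ball y0 (infDist x Γ), ofReal ((2 * infDist x Γ) ^ (-α)) ∂(sg n d Γ) := by
        simp
    _ ≤ _ := by
        apply lintegral_mono_ae
        filter_upwards [ae_restrict_mem measurableSet_ball, ae_restrict_of_ae G.sg_ae] with y hy hy'
        apply ofReal_le_ofReal
        apply Real.rpow_le_rpow_of_nonpos _ _ (by linarith)
        · exact dist_pos.2 (fun h => hx (h ▸ hy'))
        · rw [mem_ball] at hy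
          calc dist y x ≤ dist y y0 + dist x y0 := dist_triangle_right _ _ _
            _ ≤ _ := by linarith

lemma vol_ball_le (n : ℕ) : ∃ C : ℝ, 0 < C ∧ ∀ (z : Euc n) (ρ : ℝ), 0 < ρ →
    volume (ball z ρ) = ofReal (C * ρ ^ (n : ℝ)) := by
  refine ⟨(volume (ball (0 : Euc n) 1)).toReal, ENNReal.toReal_pos
    (measure_ball_pos _ _ one_pos).ne' measure_ball_lt_top.ne, fun z ρ hρ => ?_⟩
  rw [Measure.addHaar_ball_of_pos _ _ hρ, ofReal_mul (by positivity),
    ofReal_toReal measure_ball_lt_top.ne, mul_comm]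
  simp

lemma kern_vol (n : ℕ) (hn : 2 ≤ n) : ∃ C : ℝ, 0 < C ∧ ∀ (z : Euc n) (R : ℝ), 0 < R →
    ∫⁻ x in ball z R, ofReal (dist x z ^ (-((n : ℝ) - 1))) ≤ ofReal (C * R) := by
  obtain ⟨K, hK, h⟩ := vol_ball_le n
  have hn' : (2 : ℝ) ≤ n := by exact_mod_cast hn
  have hq : (2 : ℝ) ^ ((n : ℝ) - 1 - n) < 1 :=
    Real.rpow_lt_one_of_one_lt_of_neg (by norm_num) (by linarith)
  refine ⟨K * 2 ^ ((n : ℝ) - 1) / (1 - 2 ^ ((n : ℝ) - 1 - n)), ?_, fun z R hR => ?_⟩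
  · apply div_pos (by positivity) (by linarith)
  · refine (kernel_near volume z (K := K) (a := n) (α := n - 1) hK.le (by linarith) (by linarith) hR
      (fun ρ hρ => (h z ρ hρ).le)).trans_eq ?_
    congr 1
    rw [show (n : ℝ) - (n - 1) = 1 by ring, Real.rpow_one]; ring

lemma m_strip (n : ℕ) (d C₀ : ℝ) (hC : 1 ≤ C₀) (hn : 2 ≤ n) : ∃ C : ℝ, 0 < C ∧
    ∀ Γ, Geo n d C₀ Γ →
    ∀ x0 ∈ Γ, ∀ ρ ε : ℝ, 0 < ε → ε ≤ ρ →
      measW n d Γ (ball x0 ρ ∩ {x | infDist x Γ < ε}) ≤ ofReal (C * ρ ^ d * ε) := by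
  have hn' : (2 : ℝ) ≤ n := by exact_mod_cast hn
  obtain ⟨c, hc, hlow⟩ := kern_low n d C₀ (n - 1) hC (by linarith)
  obtain ⟨C1, hC1, hvol⟩ := kern_vol n hn
  refine ⟨c⁻¹ * (C1 * 2) * (C₀ * 2 ^ d * 3 ^ d), by positivity, fun Γ G x0 hx0 ρ ε hε hερ => ?_⟩
  have hρ : 0 < ρ := by linarith
  haveI := G.lf
  have hS : MeasurableSet (ball x0 ρ ∩ {x | infDist x Γ < ε}) :=
    measurableSet_ball.inter (measurableSet_lt measurable_infDist measurable_const)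
  unfold measW
  rw [withDensity_apply _ hS]
  let k : Euc n → Euc n → ℝ≥0∞ := fun x y =>
    if dist x y < 2 * ε then ofReal (dist x y ^ (-((n : ℝ) - 1))) else 0
  have hk : Measurable (Function.uncurry k) := by
    apply Measurable.ite
    · exact measurableSet_lt (by fun_prop) measurable_const
    · fun_prop
    · fun_prop
  calc _ ≤ ∫⁻ x in ball x0 ρ ∩ {x | infDist x Γ < ε}, ofReal c⁻¹ *
        ∫⁻ y in ball x0 (3 * ρ), k x y ∂(sg n d Γ) := by
        apply lintegral_mono_ae
        filter_upwards [ae_restrict_mem hS, ae_restrict_of_ae G.ae_notMem] with x hx hxΓ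
        obtain ⟨y0, hy0, h1, h2⟩ := hlow Γ G x hxΓ
        have hδρ : infDist x Γ < ρ := (infDist_le_dist_of_mem hx0).trans_lt hx.1
        calc _ = ofReal c⁻¹ * ofReal (c * infDist x Γ ^ (d - (n - 1))) := by
              rw [← ofReal_mul (by positivity), ← mul_assoc, inv_mul_cancel₀ hc.ne',
                one_mul]
              unfold weightW; congr 2; ring
          _ ≤ _ := by
              gcongr
              refine h2.trans ?_
              calc _ = ∫⁻ y in ball y0 (infDist x Γ), k x y ∂(sg n d Γ) := by
                    apply setLIntegral_congr_fun measurableSet_ball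
                    intro y hy
                    have : dist x y < 2 * ε := by
                      rw [mem_ball] at hy
                      have := hx.2
                      change infDist x Γ < ε at this
                      calc dist x y ≤ dist x y0 + dist y y0 := dist_triangle_right _ _ _
                        _ < _ := by linarith
                    simp only [k, this, if_true, dist_comm]
                _ ≤ _ := by
                    apply lintegral_mono_set
                    intro y hy
                    have h3 := hx.1
                    rw [mem_ball] at *
                    have h4 := dist_triangle4 y y0 x x0
                    rw [dist_comm y0 x] at h4
                    linarith
    _ ≤ ofReal c⁻¹ * ∫⁻ x, ∫⁻ y in ball x0 (3 * ρ), k x y ∂(sg n d Γ) := by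
        rw [lcR _ _]
        gcongr
        exact Measure.restrict_le_self
    _ = ofReal c⁻¹ * ∫⁻ y in ball x0 (3 * ρ), (∫⁻ x, k x y) ∂(sg n d Γ) := by
        rw [lintegral_lintegral_swap hk.aemeasurable]
    _ ≤ ofReal c⁻¹ * ∫⁻ y in ball x0 (3 * ρ), ofReal (C1 * (2 * ε)) ∂(sg n d Γ) := by
        gcongr with y
        refine le_trans (le_of_eq ?_) (hvol y (2 * ε) (by positivity))
        rw [← lintegral_indicator measurableSet_ball]
        apply lintegral_congr
        intro x
        simp [k, indicator]
    _ ≤ ofReal c⁻¹ * (ofReal (C1 * (2 * ε)) *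
          ofReal ((C₀ * 2 ^ d) * (3 * ρ) ^ d)) := by
        rw [lintegral_const, Measure.restrict_apply_univ]
        gcongr
        exact G.sg_ball _ _ (by positivity)
    _ = _ := by
        rw [← ofReal_mul (by positivity), ← ofReal_mul (by positivity)]
        congr 1
        rw [Real.mul_rpow (by norm_num) hρ.le]; ring

lemma euler_ibp {h : Euc n → ℝ} (hh : ContDiff ℝ 1 h) (hc : HasCompactSupport h)
    (y : Euc n) : ∫ x, fderiv ℝ h x (x - y) = -(n * ∫ x, h x) := by
  have hd : Differentiable ℝ h := hh.differentiable (by norm_num)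
  have hcd : Continuous (fderiv ℝ h) := hh.continuous_fderiv (by norm_num)
  have hL : ∀ i : Fin n, ∀ x : Euc n, HasFDerivAt (fun x : Euc n => (x - y) i)
      (EuclideanSpace.proj i : Euc n →L[ℝ] ℝ) x := by
    intro i x
    have := (EuclideanSpace.proj i : Euc n →L[ℝ] ℝ).hasFDerivAt (x := x)
    simpa using this.sub_const (y i)
  have hint0 : Integrable h := hh.continuous.integrable_of_hasCompactSupport hc
  have hint : ∀ i : Fin n, Integrable (fun x => (x - y) i * fderiv ℝ h x (EuclideanSpace.single i 1)) := by
    intro i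
    apply Continuous.integrable_of_hasCompactSupport
    · fun_prop
    · apply HasCompactSupport.mul_left
      exact (hc.fderiv (𝕜 := ℝ)).comp_left (g := fun L : Euc n →L[ℝ] ℝ => L (EuclideanSpace.single i 1)) rfl
  have key : ∀ i : Fin n, ∫ x, (x - y) i * fderiv ℝ h x (EuclideanSpace.single i 1) = -∫ x, h x := by
    intro i
    rw [integral_mul_fderiv_eq_neg_fderiv_mul_of_integrable (f := fun x : Euc n => (x - y) i)
      (g := h) (v := EuclideanSpace.single i 1)]
    · congr 2; ext x
      rw [(hL i x).fderiv]; simp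
    · refine hint0.congr (Eventually.of_forall fun x => ?_)
      simp only
      rw [(hL i x).fderiv]; simp
    · exact hint i
    · apply Continuous.integrable_of_hasCompactSupport
      · have := hh.continuous; fun_prop
      · exact hc.mul_left
    · exact fun x _ => (hL i x).differentiableAt
    · exact fun x _ => hd x
  have : ∀ x, fderiv ℝ h x (x - y) = ∑ i, (x - y) i * fderiv ℝ h x (EuclideanSpace.single i 1) := by
    intro x
    conv_lhs => rw [← (EuclideanSpace.basisFun (Fin n) ℝ).sum_repr (x - y)]
    simp [map_sum]
  simp_rw [this]
  rw [integral_finset_sum _ (fun i _ => hint i)]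
  simp only [key]; simp

lemma hasFDeriv_kern (p : ℝ) {x y : Euc n} (hxy : x ≠ y) :
    HasFDerivAt (fun x : Euc n => dist x y ^ p) ((p * dist x y ^ (p - 2)) • innerSL ℝ (x - y)) x := by
  have hp : 0 < ‖x - y‖ := norm_pos_iff.2 (sub_ne_zero.2 hxy)
  have h1 : HasFDerivAt (fun x : Euc n => ‖x - y‖ ^ 2) (2 • innerSL ℝ (x - y)) x := by
    have := ((hasFDerivAt_id (𝕜 := ℝ) x).sub_const y).norm_sq
    exact this.congr_fderiv (by ext v; simp)
  have h2 := (Real.hasDerivAt_rpow_const (x := ‖x - y‖ ^ 2) (p := p / 2)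
    (Or.inl (by positivity))).comp_hasFDerivAt x h1
  have e : ∀ (q : ℝ) (x : Euc n), (‖x - y‖ ^ 2) ^ q = dist x y ^ (2 * q) := by
    intro q x
    rw [dist_eq_norm, ← Real.rpow_natCast, ← Real.rpow_mul (norm_nonneg _)]; simp
  have h3 : (fun x : Euc n => dist x y ^ p) = (fun s : ℝ => s ^ (p / 2)) ∘ (fun x : Euc n => ‖x - y‖ ^ 2) := by
    ext x; simp only [Function.comp]; rw [e]; ring_nf
  rw [h3]
  refine h2.congr_fderiv ?_
  rw [e]
  ext v
  simp
  ring_nf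

lemma kern_contDiffAt (p : ℝ) {x y : Euc n} (hxy : x ≠ y) :
    ContDiffAt ℝ 1 (fun x : Euc n => dist x y ^ p) x := by
  have : ContDiffAt ℝ 1 (fun x : Euc n => dist x y) x :=
    contDiffAt_id.dist ℝ contDiffAt_const hxy
  exact this.rpow_const_of_ne (dist_ne_zero.2 hxy)

lemma contDiff_of_ts {F : Type*} [NormedAddCommGroup F] [NormedSpace ℝ F] {f : Euc n → F}
    (h : ∀ x ∈ tsupport f, ContDiffAt ℝ 1 f x) : ContDiff ℝ 1 f := by
  rw [contDiff_iff_contDiffAt]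
  intro x
  by_cases hx : x ∈ tsupport f
  · exact h x hx
  · exact contDiffAt_const.congr_of_eventuallyEq (notMem_tsupport_iff_eventuallyEq.1 hx)

lemma hardy_point {g : Euc n → ℝ} (hg : ContDiff ℝ 1 g) (hc : HasCompactSupport g)
    {y : Euc n} (hy : y ∉ tsupport g) :
    ∫ x, fderiv ℝ g x (x - y) * dist x y ^ (-((n : ℝ) + 1)) =
      ∫ x, g x * dist x y ^ (-((n : ℝ) + 1)) := by
  set K : Euc n → ℝ := fun x => dist x y ^ (-((n : ℝ) + 1)) with hK
  have hne : ∀ x ∈ tsupport g, x ≠ y := fun x hx h => hy (h ▸ hx)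
  have hcd : ContDiff ℝ 1 (fun x => g x * K x) := by
    apply contDiff_of_ts
    intro x hx
    exact hg.contDiffAt.mul (kern_contDiffAt _ (hne x (tsupport_mul_subset_left hx)))
  have hcs : HasCompactSupport (fun x => g x * K x) := hc.mul_right
  have h1 := euler_ibp hcd hcs y
  have h2 : ∀ x, fderiv ℝ (fun x => g x * K x) x (x - y) =
      fderiv ℝ g x (x - y) * K x - (n + 1) * (g x * K x) := by
    intro x
    by_cases hx : x ∈ tsupport g
    · have hxy := hne x hx
      have := (hg.differentiable (by norm_num) x).hasFDerivAt.mul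
        (hasFDeriv_kern (-((n : ℝ) + 1)) hxy)
      have e : dist x y ^ (-((n : ℝ) + 1)) = dist x y ^ (-((n : ℝ) + 1) - 2) * ‖x - y‖ ^ 2 := by
        rw [← dist_eq_norm, ← Real.rpow_natCast, ← Real.rpow_add (dist_pos.2 hxy)]
        congr 1; simp
      rw [show fderiv ℝ (fun x => g x * K x) x = _ from this.fderiv]
      simp only [ContinuousLinearMap.add_apply, ContinuousLinearMap.smul_apply, innerSL_apply_apply,
        real_inner_self_eq_norm_sq, smul_eq_mul, hK]
      rw [e]; ring
    · have hx' : x ∉ tsupport (fun x => g x * K x) := fun h => hx (tsupport_mul_subset_left h)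
      rw [fderiv_of_notMem_tsupport (𝕜 := ℝ) hx, fderiv_of_notMem_tsupport (𝕜 := ℝ) hx', image_eq_zero_of_notMem_tsupport hx]
      simp
  have hi : Integrable (fun x => g x * K x) := hcd.continuous.integrable_of_hasCompactSupport hcs
  have hi2 : Integrable (fun x => fderiv ℝ (fun x => g x * K x) x (x - y)) := by
    apply Continuous.integrable_of_hasCompactSupport
    · have := hcd.continuous_fderiv (by norm_num); fun_prop
    · refine HasCompactSupport.intro hcs (fun x hx => ?_)
      rw [fderiv_of_notMem_tsupport (𝕜 := ℝ) hx]; simp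
  have h3 : ∀ x, fderiv ℝ g x (x - y) * K x =
      fderiv ℝ (fun x => g x * K x) x (x - y) + (n + 1) * (g x * K x) := by
    intro x; rw [h2]; ring
  change ∫ x, fderiv ℝ g x (x - y) * K x = ∫ x, g x * K x
  simp_rw [h3]
  rw [integral_add hi2 (hi.const_mul _), integral_const_mul, h1]
  ring

lemma hardy_y {f φ : Euc n → ℝ} (hf : ContDiff ℝ 1 f) (hφ : ContDiff ℝ 1 φ)
    (hφc : HasCompactSupport φ) (hφ0 : ∀ x, 0 ≤ φ x) {y : Euc n} (hy : y ∉ tsupport f)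
    (hr : ∀ x, inner ℝ (gradient φ x) (x - y) ≤ 0) :
    ∫⁻ x, ofReal (φ x * f x ^ 2 * dist x y ^ (-((n : ℝ) + 1))) ≤
      4 * ∫⁻ x, ofReal (φ x * ‖gradient f x‖ ^ 2 * dist x y ^ (-((n : ℝ) - 1))) := by
  have hts : tsupport (fun x => φ x * f x ^ 2) ⊆ tsupport f := by
    apply closure_mono; intro x hx hx'; apply hx; simp [hx']
  have hg : ContDiff ℝ 1 (fun x => φ x * f x ^ 2) := hφ.mul (hf.pow 2)
  have hgc : HasCompactSupport (fun x => φ x * f x ^ 2) := hφc.mul_right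
  have hmain := hardy_point hg hgc (fun h => hy (hts h))
  have hts2 : tsupport (fun x => φ x * ‖gradient f x‖ ^ 2) ⊆ tsupport f := by
    apply closure_minimal _ (isClosed_tsupport f)
    intro x hx; by_contra hx'; apply hx
    simp only; rw [gz0 hx']; simp
  have cont : ∀ (p : ℝ) (a : Euc n → ℝ), Continuous a → y ∉ tsupport a →
      Continuous (fun x => a x * dist x y ^ p) := by
    intro p a ha hya
    apply continuous_of_tsupport
    intro x hx
    have hxy : x ≠ y := fun h => hya (h ▸ tsupport_mul_subset_left hx)
    exact ha.continuousAt.mul (kern_contDiffAt p hxy).continuousAt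
  have c1 := cont (-((n : ℝ) + 1)) _ hg.continuous (fun h => hy (hts h))
  have hcg : Continuous (fun x => φ x * ‖gradient f x‖ ^ 2) :=
    hφ.continuous.mul ((continuous_grad hf).norm.pow 2)
  have c2 := cont (-((n : ℝ) - 1)) _ hcg (fun h => hy (hts2 h))
  have i1 : Integrable (fun x => φ x * f x ^ 2 * dist x y ^ (-((n : ℝ) + 1))) :=
    c1.integrable_of_hasCompactSupport hgc.mul_right
  have i2 : Integrable (fun x => φ x * ‖gradient f x‖ ^ 2 * dist x y ^ (-((n : ℝ) - 1))) :=
    c2.integrable_of_hasCompactSupport hφc.mul_right.mul_right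
  have hpt : ∀ x, fderiv ℝ (fun x => φ x * f x ^ 2) x (x - y) * dist x y ^ (-((n : ℝ) + 1)) ≤
      (1/2) * (φ x * f x ^ 2 * dist x y ^ (-((n : ℝ) + 1))) +
      2 * (φ x * ‖gradient f x‖ ^ 2 * dist x y ^ (-((n : ℝ) - 1))) := by
    intro x
    have hdf := hf.differentiable (by norm_num) x
    have hdφ := hφ.differentiable (by norm_num) x
    have h2 : fderiv ℝ (fun x => φ x * f x ^ 2) x (x - y) =
        φ x * (2 * f x * inner ℝ (gradient f x) (x - y)) + f x ^ 2 * inner ℝ (gradient φ x) (x - y) := by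
      have := hdφ.hasFDerivAt.mul (hdf.hasFDerivAt.pow 2)
      rw [show fderiv ℝ (fun x => φ x * f x ^ 2) x = _ from this.fderiv, grad_inner, grad_inner]
      simp
    by_cases hxy : x = y
    · subst hxy
      rw [h2, image_eq_zero_of_notMem_tsupport hy, gz0 hy]; simp
    have hk : 0 < dist x y := dist_pos.2 hxy
    have e : dist x y ^ (-((n : ℝ) - 1)) = dist x y ^ (-((n : ℝ) + 1)) * ‖x - y‖ ^ 2 := by
      rw [← dist_eq_norm, ← Real.rpow_natCast (dist x y), ← Real.rpow_add hk]
      congr 1; push_cast; ring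
    have hK : 0 < dist x y ^ (-((n : ℝ) + 1)) := by positivity
    set K := dist x y ^ (-((n : ℝ) + 1))
    rw [h2, e]
    have h3 := hr x
    have h4 := real_inner_le_norm (gradient f x) (x - y)
    have h5 := abs_real_inner_le_norm (gradient f x) (x - y)
    set I := inner ℝ (gradient f x) (x - y)
    have h6 : I ^ 2 ≤ ‖gradient f x‖ ^ 2 * ‖x - y‖ ^ 2 := by
      rw [← mul_pow, ← sq_abs I]; gcongr
    have h7 : 2 * f x * I ≤ (1/2) * f x ^ 2 + 2 * (‖gradient f x‖ ^ 2 * ‖x - y‖ ^ 2) := by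
      nlinarith [sq_nonneg (f x - 2 * I)]
    have h8 : f x ^ 2 * inner ℝ (gradient φ x) (x - y) ≤ 0 :=
      mul_nonpos_of_nonneg_of_nonpos (sq_nonneg _) h3
    have h9 := mul_le_mul_of_nonneg_left h7 (hφ0 x)
    calc _ ≤ (φ x * ((1/2) * f x ^ 2 + 2 * (‖gradient f x‖ ^ 2 * ‖x - y‖ ^ 2))) * K := by
          gcongr; linarith
      _ = _ := by ring
  have hle : ∫ x, φ x * f x ^ 2 * dist x y ^ (-((n : ℝ) + 1)) ≤
      4 * ∫ x, φ x * ‖gradient f x‖ ^ 2 * dist x y ^ (-((n : ℝ) - 1)) := by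
    have i3 : Integrable (fun x => fderiv ℝ (fun x => φ x * f x ^ 2) x (x - y) *
        dist x y ^ (-((n : ℝ) + 1))) := by
      have hts3 : tsupport (fun x => fderiv ℝ (fun x => φ x * f x ^ 2) x (x - y)) ⊆
          tsupport (fun x => φ x * f x ^ 2) := by
        apply closure_minimal _ (isClosed_tsupport _)
        intro x hx; by_contra hx'; apply hx
        simp only; rw [fderiv_of_notMem_tsupport (𝕜 := ℝ) hx']; simp
      apply Continuous.integrable_of_hasCompactSupport
      · apply cont
        · have := hg.continuous_fderiv (by norm_num); fun_prop
        · exact fun h => hy (hts (hts3 h))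
      · apply HasCompactSupport.mul_right
        exact hgc.of_isClosed_subset (isClosed_tsupport _) hts3
    have := integral_mono i3 ((i1.const_mul (1/2)).add (i2.const_mul 2)) hpt
    simp only [Pi.add_apply] at this
    rw [integral_add (i1.const_mul _) (i2.const_mul _), integral_const_mul, integral_const_mul,
      hmain] at this
    linarith
  rw [← ofReal_integral_eq_lintegral_ofReal i1 (Eventually.of_forall fun x => by
      have := hφ0 x; positivity),
    ← ofReal_integral_eq_lintegral_ofReal i2 (Eventually.of_forall fun x => by
      have := hφ0 x; positivity),
    show (4 : ℝ≥0∞) = ofReal 4 by simp, ← ofReal_mul (by norm_num)]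
  exact ofReal_le_ofReal hle

lemma hardy_loc (n : ℕ) (d C₀ : ℝ) (hC : 1 ≤ C₀) (hd : d < (n : ℝ) - 1) : ∃ C : ℝ, 0 < C ∧
    ∀ Γ, Geo n d C₀ Γ → ∀ x0 ∈ Γ, ∀ ρ ρ' : ℝ, 0 < ρ → ρ < ρ' → ∀ f : Euc n → ℝ, ContDiff ℝ 1 f →
      (∀ y ∈ Γ, y ∉ tsupport f) →
      ∫⁻ x in ball x0 (ρ / 3), ofReal (f x ^ 2 * infDist x Γ ^ (d - 1 - n)) ≤
        ofReal C * ∫⁻ x in closedBall x0 ρ',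
          ofReal (‖gradient f x‖ ^ 2 * weightW n d Γ x) := by
  obtain ⟨c, hc, hlow⟩ := kern_low n d C₀ (n + 1) hC (by positivity)
  obtain ⟨C1, hC1, hup⟩ := kern_up n d C₀ (n - 1) hd
  refine ⟨c⁻¹ * 4 * C1, by positivity, fun Γ G x0 hx0 ρ ρ' hρ hρ' f hf hfΓ => ?_⟩
  haveI := G.lf
  set φ := cut x0 ρ ρ' with hφ
  have hφ1 : ContDiff ℝ 1 φ := (cut_contDiff _ _ _).of_le (by exact_mod_cast le_top)
  have hφ0 : ∀ x, 0 ≤ φ x := cut_nonneg _ _ _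
  have mf : Measurable f := hf.continuous.measurable
  have mφ : Measurable φ := hφ1.continuous.measurable
  have mg : Measurable (gradient f) := (continuous_grad hf).measurable
  have e1 : ofReal (c⁻¹ * 4 * C1) =
      ofReal c⁻¹ * (4 * ofReal C1) := by
    rw [ofReal_mul (by positivity), ofReal_mul (by positivity), mul_assoc]; simp
  calc _ ≤ ∫⁻ x in ball x0 (ρ / 3), ofReal c⁻¹ *
        ∫⁻ y in ball x0 ρ, ofReal (φ x * f x ^ 2 * dist x y ^ (-((n : ℝ) + 1))) ∂(sg n d Γ) := by
        apply lintegral_mono_ae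
        filter_upwards [ae_restrict_mem measurableSet_ball, ae_restrict_of_ae G.ae_notMem] with x hx hxΓ
        obtain ⟨y0, hy0, h1, h2⟩ := hlow Γ G x hxΓ
        have hδ : infDist x Γ < ρ / 3 := (infDist_le_dist_of_mem hx0).trans_lt hx
        have hφx : φ x = 1 := cut_eq_one hρ hρ' (by rw [mem_ball] at hx; linarith)
        rw [hφx, one_mul]
        calc _ = ofReal c⁻¹ * (ofReal (f x ^ 2) *
              ofReal (c * infDist x Γ ^ (d - (n + 1)))) := by
              rw [← ofReal_mul (by positivity), ← ofReal_mul (by positivity)]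
              congr 1
              rw [show d - 1 - (n : ℝ) = d - (n + 1) by ring]
              field_simp
          _ ≤ ofReal c⁻¹ * (ofReal (f x ^ 2) *
              ∫⁻ y in ball x0 ρ, ofReal (dist y x ^ (-((n : ℝ) + 1))) ∂(sg n d Γ)) := by
              gcongr
              refine h2.trans (lintegral_mono_set ?_)
              intro y hy
              rw [mem_ball] at *
              have h4 := dist_triangle4 y y0 x x0
              rw [dist_comm y0 x] at h4
              linarith
          _ = _ := by
              rw [← lcR _ _]
              congr 1
              apply lintegral_congr; intro y
              rw [← ofReal_mul (by positivity), dist_comm]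
    _ ≤ ofReal c⁻¹ * ∫⁻ x,
        ∫⁻ y in ball x0 ρ, ofReal (φ x * f x ^ 2 * dist x y ^ (-((n : ℝ) + 1))) ∂(sg n d Γ) := by
        rw [lcR _ _]
        gcongr
        exact Measure.restrict_le_self
    _ = ofReal c⁻¹ * ∫⁻ y in ball x0 ρ,
        (∫⁻ x, ofReal (φ x * f x ^ 2 * dist x y ^ (-((n : ℝ) + 1)))) ∂(sg n d Γ) := by
        rw [lintegral_lintegral_swap]
        apply Measurable.aemeasurable
        fun_prop
    _ ≤ ofReal c⁻¹ * ∫⁻ y in ball x0 ρ,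
        (4 * ∫⁻ x, ofReal (φ x * ‖gradient f x‖ ^ 2 * dist x y ^ (-((n : ℝ) - 1)))) ∂(sg n d Γ) := by
        gcongr 1
        apply lintegral_mono_ae
        filter_upwards [ae_restrict_mem measurableSet_ball, ae_restrict_of_ae G.sg_ae] with y hy hyΓ
        exact hardy_y hf hφ1 (cut_hcs hρ hρ') hφ0 (hfΓ y hyΓ)
          (fun x => grad_cut_inner hρ hρ' (le_of_lt hy))
    _ ≤ ofReal c⁻¹ * ∫⁻ y,
        (4 * ∫⁻ x, ofReal (φ x * ‖gradient f x‖ ^ 2 * dist x y ^ (-((n : ℝ) - 1)))) ∂(sg n d Γ) := by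
        gcongr
        exact Measure.restrict_le_self
    _ = ofReal c⁻¹ * (4 * ∫⁻ x,
        ∫⁻ y, ofReal (φ x * ‖gradient f x‖ ^ 2 * dist x y ^ (-((n : ℝ) - 1))) ∂(sg n d Γ)) := by
        rw [lintegral_const_mul' _ _ (by simp), lintegral_lintegral_swap]
        apply Measurable.aemeasurable
        fun_prop
    _ ≤ ofReal c⁻¹ * (4 * ∫⁻ x, (closedBall x0 ρ').indicator (fun x => ofReal C1 *
          ofReal (‖gradient f x‖ ^ 2 * weightW n d Γ x)) x) := by
        gcongr 2
        apply lintegral_mono_ae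
        filter_upwards [G.ae_notMem] with x hxΓ
        by_cases hx : x ∈ closedBall x0 ρ'
        · rw [indicator_of_mem hx]
          calc _ = ofReal (φ x * ‖gradient f x‖ ^ 2) *
                ∫⁻ y, ofReal (dist y x ^ (-((n : ℝ) - 1))) ∂(sg n d Γ) := by
                rw [← lcR _ _]
                apply lintegral_congr; intro y
                rw [← ofReal_mul (by have := hφ0 x; positivity), dist_comm]
            _ ≤ ofReal (1 * ‖gradient f x‖ ^ 2) *
                ofReal (C1 * infDist x Γ ^ (d - (n - 1))) := by
                gcongr
                · exact cut_le_one _ _ _ _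
                · exact hup Γ G x hxΓ
            _ = _ := by
                rw [← ofReal_mul (by positivity), ← ofReal_mul (by positivity)]
                unfold weightW
                rw [show d - ((n : ℝ) - 1) = d + 1 - n by ring]
                congr 1; ring
        · rw [indicator_of_notMem hx]
          have : φ x = 0 := cut_eq_zero hρ hρ' (by rw [mem_closedBall, not_le] at hx; exact hx.le)
          simp [this]
    _ = _ := by
        rw [lintegral_indicator measurableSet_closedBall,
          lcR _ _, e1]
        ring

def Rf (n : ℕ) (d : ℝ) (Γ : Set (Euc n)) (x0 : Euc n) (s : ℝ) (x : Euc n) : ℝ :=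
  ∫ y in ball x0 s, dist x y ^ (-((n : ℝ) - 1)) ∂(sg n d Γ)

def Rk (n : ℕ) (x y : Euc n) : Euc n →L[ℝ] ℝ :=
  (-((n : ℝ) - 1) * dist x y ^ (-((n : ℝ) - 1) - 2)) • innerSL ℝ (x - y)

lemma Rk_norm (hn : 2 ≤ n) {x y : Euc n} (h : x ≠ y) :
    ‖Rk n x y‖ = ((n : ℝ) - 1) * dist x y ^ (-(n : ℝ)) := by
  have hn' : (2 : ℝ) ≤ n := by exact_mod_cast hn
  have hp := dist_pos.2 h
  unfold Rk
  rw [norm_smul, innerSL_apply_norm, ← dist_eq_norm, norm_mul, norm_neg, Real.norm_eq_abs,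
    Real.norm_eq_abs, abs_of_nonneg (by linarith), abs_of_nonneg (by positivity), mul_assoc]
  congr 1
  nth_rewrite 2 [← Real.rpow_one (dist x y)]
  rw [← Real.rpow_add hp]; congr 1; ring

lemma Rk_meas (x : Euc n) : Measurable (fun y => Rk n x y) := by
  unfold Rk
  apply Measurable.fun_smul
  · fun_prop
  · exact (((innerSL ℝ).continuous).comp (continuous_const.sub continuous_id)).measurable

lemma R_deriv (G : Geo n d C₀ Γ) (x0 : Euc n) {s : ℝ}
    (hs : 0 < s) :
    (∀ x ∉ Γ, HasFDerivAt (Rf n d Γ x0 s) (∫ y in ball x0 s, Rk n x y ∂(sg n d Γ)) x) ∧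
    (∀ x ∉ Γ, ContDiffAt ℝ 1 (Rf n d Γ x0 s) x) := by
  have hn' : (2 : ℝ) ≤ n := by exact_mod_cast G.hn
  have hfin : IsFiniteMeasure ((sg n d Γ).restrict (ball x0 s)) := ⟨by
    rw [Measure.restrict_apply_univ]
    exact (G.sg_ball x0 s hs).trans_lt ofReal_lt_top⟩
  have hfar : ∀ x ∉ Γ, ∀ y ∈ Γ, ∀ z ∈ ball x (infDist x Γ / 2), infDist x Γ / 2 ≤ dist z y := by
    intro x hx y hy z hz
    rw [mem_ball] at hz
    have h1 := infDist_le_dist_of_mem (x := x) hy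
    have h2 := dist_triangle_left x y z
    linarith
  have hae : ∀ᵐ y ∂((sg n d Γ).restrict (ball x0 s)), y ∈ Γ := ae_restrict_of_ae G.sg_ae
  have hbd : ∀ x ∉ Γ, ∀ y ∈ Γ, ∀ z ∈ ball x (infDist x Γ / 2),
      ‖Rk n z y‖ ≤ ((n : ℝ) - 1) * (infDist x Γ / 2) ^ (-(n : ℝ)) := by
    intro x hx y hy z hz
    have hp := G.pos hx
    have h := hfar x hx y hy z hz
    have hzy : 0 < dist z y := by linarith
    rw [Rk_norm G.hn (dist_pos.1 hzy)]
    apply mul_le_mul_of_nonneg_left _ (by linarith)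
    exact Real.rpow_le_rpow_of_nonpos (by linarith) h (by linarith)
  have hD : ∀ x ∉ Γ, HasFDerivAt (Rf n d Γ x0 s) (∫ y in ball x0 s, Rk n x y ∂(sg n d Γ)) x := by
    intro x hx
    have hp := G.pos hx
    apply hasFDerivAt_integral_of_dominated_of_fderiv_le (𝕜 := ℝ)
      (s := ball x (infDist x Γ / 2))
      (bound := fun _ => ((n : ℝ) - 1) * (infDist x Γ / 2) ^ (-(n : ℝ)))
      (F' := fun z y => Rk n z y)
    · exact ball_mem_nhds _ (by linarith)
    · exact Eventually.of_forall fun z => Measurable.aestronglyMeasurable (by fun_prop)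
    · refine Integrable.of_bound (C := (infDist x Γ) ^ (-((n : ℝ) - 1)))
        (Measurable.aestronglyMeasurable (by fun_prop)) ?_
      filter_upwards [hae] with y hy
      rw [Real.norm_of_nonneg (by positivity)]
      exact Real.rpow_le_rpow_of_nonpos hp (infDist_le_dist_of_mem hy) (by linarith)
    · exact (Rk_meas x).aestronglyMeasurable
    · filter_upwards [hae] with y hy z hz
      exact hbd x hx y hy z hz
    · exact integrable_const _
    · filter_upwards [hae] with y hy z hz
      have h := hfar x hx y hy z hz
      have hzy : 0 < dist z y := by linarith
      exact hasFDeriv_kern _ (dist_pos.1 hzy)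
  refine ⟨hD, fun x hx => ?_⟩
  rw [contDiffAt_one_iff]
  refine ⟨fun x => ∫ y in ball x0 s, Rk n x y ∂(sg n d Γ), Γᶜ, G.cl.isOpen_compl.mem_nhds hx, ?_,
    fun z hz => hD z hz⟩
  intro x hx
  have hp := G.pos hx
  apply ContinuousAt.continuousWithinAt
  apply continuousAt_of_dominated (bound := fun _ => ((n : ℝ) - 1) * (infDist x Γ / 2) ^ (-(n : ℝ)))
  · exact Eventually.of_forall fun z => (Rk_meas z).aestronglyMeasurable
  · filter_upwards [ball_mem_nhds x (show 0 < infDist x Γ / 2 by linarith)] with z hz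
    filter_upwards [hae] with y hy
    exact hbd x hx y hy z hz
  · exact integrable_const _
  · filter_upwards [hae] with y hy
    have hxy : x ≠ y := fun h => hx (h ▸ hy)
    unfold Rk
    apply ContinuousAt.fun_smul
    · exact continuousAt_const.mul (kern_contDiffAt _ hxy).continuousAt
    · exact ((innerSL ℝ).continuous.comp (continuous_id.sub continuous_const)).continuousAt

lemma R_bounds (n : ℕ) (d C₀ : ℝ) (hC : 1 ≤ C₀) (hd : d < (n : ℝ) - 1) (hn : 2 ≤ n) :
    ∃ c C : ℝ, 0 < c ∧ 0 < C ∧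
    ∀ Γ, Geo n d C₀ Γ → ∀ x0 ∈ Γ, ∀ s : ℝ, 0 < s → ∀ x ∉ Γ,
      (dist x x0 < s / 3 → c * weightW n d Γ x ≤ Rf n d Γ x0 s x) ∧
      Rf n d Γ x0 s x ≤ C * weightW n d Γ x ∧
      ‖gradient (Rf n d Γ x0 s) x‖ ≤ C * infDist x Γ ^ (d - n) := by
  have hn' : (2 : ℝ) ≤ n := by exact_mod_cast hn
  obtain ⟨c, hc, hlow⟩ := kern_low n d C₀ (n - 1) hC (by linarith)
  obtain ⟨C1, hC1, hup⟩ := kern_up n d C₀ (n - 1) hd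
  obtain ⟨C2, hC2, hup2⟩ := kern_up n d C₀ n (by linarith)
  refine ⟨c, max C1 ((n - 1) * C2), hc, by positivity, fun Γ G x0 hx0 s hs x hx => ?_⟩
  have hp := G.pos hx
  have hRe : Rf n d Γ x0 s x =
      (∫⁻ y in ball x0 s, ofReal (dist y x ^ (-((n : ℝ) - 1))) ∂(sg n d Γ)).toReal := by
    unfold Rf
    rw [integral_eq_lintegral_of_nonneg_ae (Eventually.of_forall fun y => by positivity)
      (Measurable.aestronglyMeasurable (by fun_prop))]
    simp_rw [dist_comm]
  have hw : weightW n d Γ x = infDist x Γ ^ (d - (n - 1)) := by unfold weightW; congr 1; ring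
  have hU : ∫⁻ y in ball x0 s, ofReal (dist y x ^ (-((n : ℝ) - 1))) ∂(sg n d Γ) ≤
      ofReal (C1 * weightW n d Γ x) := by
    refine (setLIntegral_le_lintegral _ _).trans ?_
    rw [hw]; exact hup Γ G x hx
  have hw0 : 0 < weightW n d Γ x := by rw [hw]; positivity
  refine ⟨fun hxs => ?_, ?_, ?_⟩
  · rw [hRe]
    apply (ofReal_le_iff_le_toReal (hU.trans_lt ofReal_lt_top).ne).1
    obtain ⟨y0, hy0, h1, h2⟩ := hlow Γ G x hx
    rw [hw]
    refine h2.trans (lintegral_mono_set ?_)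
    intro y hy
    have hδ := infDist_le_dist_of_mem (x := x) hx0
    rw [mem_ball] at *
    have h4 := dist_triangle4 y y0 x x0
    rw [dist_comm y0 x] at h4
    linarith
  · rw [hRe]
    refine (ENNReal.toReal_le_of_le_ofReal (by positivity) hU).trans ?_
    gcongr; exact le_max_left _ _
  · rw [norm_grad, ((R_deriv G x0 hs).1 x hx).fderiv]
    refine (norm_integral_le_lintegral_norm _).trans ?_
    apply ENNReal.toReal_le_of_le_ofReal (by positivity)
    calc _ ≤ ∫⁻ y, ofReal ‖Rk n x y‖ ∂(sg n d Γ) := setLIntegral_le_lintegral _ _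
      _ = ∫⁻ y, ofReal ((n : ℝ) - 1) * ofReal (dist y x ^ (-(n : ℝ))) ∂(sg n d Γ) := by
          apply lintegral_congr_ae
          filter_upwards [G.sg_ae] with y hy
          have hxy : x ≠ y := fun h => hx (h ▸ hy)
          rw [Rk_norm hn hxy, ofReal_mul (by linarith), dist_comm]
      _ ≤ ofReal ((n : ℝ) - 1) * ofReal (C2 * infDist x Γ ^ (d - n)) := by
          rw [lcR _ _]
          gcongr
          exact hup2 Γ G x hx
      _ ≤ _ := by
          rw [← ofReal_mul (by linarith)]
          apply ofReal_le_ofReal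
          rw [← mul_assoc]
          gcongr; exact le_max_right _ _

lemma gns (n : ℕ) (hn : 2 ≤ n) : ∃ C : ℝ, 0 < C ∧ ∀ u : Euc n → ℝ, ContDiff ℝ 1 u →
    HasCompactSupport u → ∀ S : Set (Euc n), MeasurableSet S →
    ∫⁻ x in S, ‖u x‖ₑ ≤ ofReal C * (volume S) ^ (1 / (n : ℝ)) *
      ∫⁻ x, ‖fderiv ℝ u x‖ₑ := by
  have hn' : (2 : ℝ) ≤ n := by exact_mod_cast hn
  have hp : Real.HolderConjugate (n : ℝ) (Real.conjExponent n) :=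
    Real.HolderConjugate.conjExponent (by linarith)
  set p := Real.conjExponent (n : ℝ) with hpdef
  have hp0 : 0 < p := hp.symm.pos
  set C := lintegralPowLePowLIntegralFDerivConst (volume : Measure (Euc n)) p
  refine ⟨max 1 ((C : ℝ) ^ (1 / p)), by positivity, fun u hu hc S hS => ?_⟩
  have h1 := lintegral_pow_le_pow_lintegral_fderiv (volume : Measure (Euc n)) hu hc (p := p)
    (by simpa using hp)
  have h2 := ENNReal.lintegral_mul_le_Lp_mul_Lq volume hp.symm (f := fun x => ‖u x‖ₑ)
    (g := S.indicator 1) (hu.continuous.measurable.enorm.aemeasurable)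
    ((measurable_one.indicator hS).aemeasurable)
  have e2 : ∫⁻ x, (S.indicator (1 : Euc n → ℝ≥0∞) x) ^ (n : ℝ) = volume S := by
    rw [← lintegral_indicator_one hS]
    apply lintegral_congr; intro x
    by_cases hx : x ∈ S
    · simp [hx]
    · simp only [hx, not_false_eq_true, indicator_of_notMem]
      rw [ENNReal.zero_rpow_of_pos (by linarith)]
  rw [e2] at h2
  calc ∫⁻ x in S, ‖u x‖ₑ = ∫⁻ x, ((fun x : Euc n => ‖u x‖ₑ) * (S.indicator 1 : Euc n → ℝ≥0∞)) x := by
        rw [← lintegral_indicator hS]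
        apply lintegral_congr; intro x
        by_cases hx : x ∈ S <;> simp [hx]
    _ ≤ _ := h2
    _ ≤ (C * (∫⁻ x, ‖fderiv ℝ u x‖ₑ) ^ p) ^ (1 / p) * volume S ^ (1 / (n : ℝ)) := by gcongr
    _ = (C : ℝ≥0∞) ^ (1 / p) * (∫⁻ x, ‖fderiv ℝ u x‖ₑ) * volume S ^ (1 / (n : ℝ)) := by
        rw [ENNReal.mul_rpow_of_nonneg _ _ (by positivity), ← ENNReal.rpow_mul,
          mul_one_div_cancel hp0.ne', ENNReal.rpow_one]
    _ ≤ ofReal (max 1 ((C : ℝ) ^ (1 / p))) * (∫⁻ x, ‖fderiv ℝ u x‖ₑ) *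
          volume S ^ (1 / (n : ℝ)) := by
        gcongr
        rw [← ofReal_coe_nnreal, ofReal_rpow_of_nonneg (by positivity) (by positivity)]
        exact ofReal_le_ofReal (le_max_right _ _)
    _ = _ := by ring

lemma fk (n : ℕ) (d C₀ : ℝ) (hC : 1 ≤ C₀) (hd : d < (n : ℝ) - 1) (hn : 2 ≤ n) : ∃ C : ℝ, 0 < C ∧
    ∀ Γ, Geo n d C₀ Γ → ∀ x0 ∈ Γ, ∀ r : ℝ, 0 < r → ∀ F : Euc n → ℝ, ContDiff ℝ 1 F →
      HasCompactSupport F → tsupport F ⊆ ball x0 (2 * r) → (∀ y ∈ Γ, y ∉ tsupport F) →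
      ∀ S, MeasurableSet S →
      ∫⁻ x in S, ofReal (F x ^ 2 * weightW n d Γ x) ≤
        ofReal (C * r) * (volume S) ^ (1 / (n : ℝ)) *
        ∫⁻ x, ofReal (‖gradient F x‖ ^ 2 * weightW n d Γ x) := by
  obtain ⟨c, C1, hc, hC1, hR⟩ := R_bounds n d C₀ hC hd hn
  obtain ⟨C2, hC2, hgns⟩ := gns n hn
  obtain ⟨C3, hC3, hhardy⟩ := hardy_loc n d C₀ hC hd
  refine ⟨c⁻¹ * C2 * (C1 * (6 * C3 + 1)), by positivity,
    fun Γ G x0 hx0 r hr F hF hFc hFs hFΓ S hS => ?_⟩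
  set R := Rf n d Γ x0 (6 * r) with hRdef
  have hts : tsupport (fun x => F x ^ 2 * R x) ⊆ tsupport F := by
    apply closure_mono; intro x hx hx'; apply hx; simp [hx']
  have hu : ContDiff ℝ 1 (fun x => F x ^ 2 * R x) := by
    apply contDiff_of_ts
    intro x hx
    exact (hF.pow 2).contDiffAt.mul ((R_deriv G x0 (by positivity)).2 x
      (fun h => hFΓ x h (hts hx)))
  have huc : HasCompactSupport (fun x => F x ^ 2 * R x) :=
    hFc.of_isClosed_subset (isClosed_tsupport _) hts
  have hδ : ∀ x ∈ tsupport F, infDist x Γ < 2 * r := fun x hx =>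
    (infDist_le_dist_of_mem hx0).trans_lt (hFs hx)
  have hder : ∀ x, x ∉ Γ → ‖fderiv ℝ (fun x => F x ^ 2 * R x) x‖ₑ ≤
      ofReal (C1 * r) * (6 * (ball x0 (2 * r)).indicator (fun x =>
        ofReal (F x ^ 2 * infDist x Γ ^ (d - 1 - n))) x
       + ofReal (‖gradient F x‖ ^ 2 * weightW n d Γ x)) := by
    intro x hx
    by_cases hxs : x ∈ tsupport F
    · rw [indicator_of_mem (hFs hxs)]
      have hp := G.pos hx
      have hdx := hδ x hxs
      obtain ⟨-, b1, b2⟩ := hR Γ G x0 hx0 (6 * r) (by positivity) x hx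
      have hdF : DifferentiableAt ℝ F x := hF.differentiable (by norm_num) x
      have hdR : DifferentiableAt ℝ R x :=
        ((R_deriv G x0 (by positivity)).2 x hx).differentiableAt (by norm_num)
      have hg : gradient (fun x => F x ^ 2 * R x) x =
          (F x ^ 2) • gradient R x + R x • ((2 * F x) • gradient F x) := by
        rw [grad_mul (f := fun x => F x ^ 2) (g := R) (hdF.pow 2) hdR]
        congr 2
        rw [grad_comp (G := fun s => s ^ 2) (a := 2 * F x) (by
          simpa using hasDerivAt_pow 2 (F x)) hdF]
      rw [← enorm_norm, ← norm_grad, enorm_norm, ← ofReal_norm_eq_enorm]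
      set δ := infDist x Γ
      set a := ‖gradient F x‖
      have e1 : δ ^ (d - n) = δ ^ (d - 1 - n) * δ := by
        nth_rewrite 3 [← Real.rpow_one δ]
        rw [← Real.rpow_add hp]; congr 1; ring
      have e2 : weightW n d Γ x = δ ^ (d - 1 - n) * δ ^ 2 := by
        rw [← Real.rpow_natCast δ, ← Real.rpow_add hp]; unfold weightW
        congr 1; push_cast; ring
      have hk : 0 < δ ^ (d - 1 - n) := by positivity
      set k := δ ^ (d - 1 - n)
      have hR0 : 0 ≤ R x := integral_nonneg fun y => by positivity
      have hb : ‖gradient (fun x => F x ^ 2 * R x) x‖ ≤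
          (C1 * r) * (6 * (F x ^ 2 * k) + a ^ 2 * weightW n d Γ x) := by
        rw [hg]
        calc _ ≤ F x ^ 2 * (C1 * (k * δ)) + (C1 * (k * δ ^ 2)) * (2 * |F x| * a) := by
              refine (norm_add_le _ _).trans ?_
              rw [norm_smul, norm_smul, norm_smul, Real.norm_of_nonneg hR0,
                Real.norm_of_nonneg (sq_nonneg _), norm_mul, Real.norm_ofNat, Real.norm_eq_abs]
              gcongr
              · rw [← e1]; exact b2
              · rw [← e2]; exact b1
          _ ≤ F x ^ 2 * (C1 * (k * (2 * r))) + C1 * k * (δ ^ 2 * (r⁻¹ * F x ^ 2 + r * a ^ 2)) := by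
              have : 2 * |F x| * a ≤ r⁻¹ * F x ^ 2 + r * a ^ 2 := by
                have h3 : r⁻¹ * F x ^ 2 + r * a ^ 2 - 2 * |F x| * a = r⁻¹ * (|F x| - r * a) ^ 2 := by
                  rw [← sq_abs (F x)]; field_simp; ring
                have : 0 ≤ r⁻¹ * (|F x| - r * a) ^ 2 := by positivity
                linarith
              calc _ ≤ F x ^ 2 * (C1 * (k * (2 * r))) + (C1 * (k * δ ^ 2)) * (r⁻¹ * F x ^ 2 + r * a ^ 2) := by
                    gcongr
                _ = _ := by ring
          _ ≤ F x ^ 2 * (C1 * (k * (2 * r))) + C1 * k * ((2 * r) ^ 2 * (r⁻¹ * F x ^ 2) + δ ^ 2 * (r * a ^ 2)) := by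
              rw [mul_add (δ ^ 2)]
              gcongr
          _ = _ := by rw [e2]; field_simp; ring
      refine (ofReal_le_ofReal hb).trans_eq ?_
      have hw : 0 ≤ weightW n d Γ x := by rw [e2]; positivity
      rw [ofReal_mul (by positivity), ofReal_add (by positivity) (by positivity),
        ofReal_mul (p := 6) (by norm_num), ofReal_ofNat]
    · rw [fderiv_of_notMem_tsupport (𝕜 := ℝ) (fun h => hxs (hts h))]; exact (le_of_eq (by simp [← ofReal_norm_eq_enorm] : _ = (0 : ℝ≥0∞))).trans zero_le
  have hH : ∫⁻ x in ball x0 (2 * r), ofReal (F x ^ 2 * infDist x Γ ^ (d - 1 - n)) ≤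
      ofReal C3 * ∫⁻ x, ofReal (‖gradient F x‖ ^ 2 * weightW n d Γ x) := by
    have := hhardy Γ G x0 hx0 (6 * r) (7 * r) (by positivity) (by linarith) F hF hFΓ
    rw [show 6 * r / 3 = 2 * r by ring] at this
    refine this.trans ?_
    gcongr
    exact Measure.restrict_le_self
  set I := ∫⁻ x, ofReal (‖gradient F x‖ ^ 2 * weightW n d Γ x) with hI
  have hgrad : ∫⁻ x, ‖fderiv ℝ (fun x => F x ^ 2 * R x) x‖ₑ ≤
      ofReal (C1 * r) * (ofReal (6 * C3 + 1) * I) := by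
    calc _ ≤ ∫⁻ x, ofReal (C1 * r) * (6 * (ball x0 (2 * r)).indicator (fun x =>
        ofReal (F x ^ 2 * infDist x Γ ^ (d - 1 - n))) x
       + ofReal (‖gradient F x‖ ^ 2 * weightW n d Γ x)) := by
          apply lintegral_mono_ae
          filter_upwards [G.ae_notMem] with x hx using hder x hx
      _ = ofReal (C1 * r) * (6 * (∫⁻ x in ball x0 (2 * r),
        ofReal (F x ^ 2 * infDist x Γ ^ (d - 1 - n))) + I) := by
          rw [lcR _ _, lintegral_add_right,
            lintegral_const_mul' _ _ (by simp), lintegral_indicator measurableSet_ball]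
          have := (continuous_grad hF).measurable
          have := meas_w (n := n) (d := d) (Γ := Γ)
          fun_prop
      _ ≤ ofReal (C1 * r) * (6 * (ofReal C3 * I) + I) := by gcongr
      _ = _ := by
          rw [ofReal_add (by positivity) (by norm_num), ofReal_mul (p := 6) (by norm_num),
            ofReal_ofNat, ofReal_one]
          ring
  calc _ ≤ ∫⁻ x in S, ofReal c⁻¹ * ‖F x ^ 2 * R x‖ₑ := by
        apply lintegral_mono_ae
        filter_upwards [ae_restrict_of_ae G.ae_notMem] with x hx
        have hR0 : 0 ≤ R x := integral_nonneg fun y => by positivity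
        rw [Real.enorm_of_nonneg (by positivity), ← ofReal_mul (by positivity)]
        apply ofReal_le_ofReal
        by_cases hxs : x ∈ tsupport F
        · have := (hR Γ G x0 hx0 (6 * r) (by positivity) x hx).1 (by
            have := hFs hxs; rw [mem_ball] at this; linarith)
          calc _ = c⁻¹ * (F x ^ 2 * (c * weightW n d Γ x)) := by field_simp
            _ ≤ _ := by gcongr
        · rw [image_eq_zero_of_notMem_tsupport hxs]; simp
    _ = ofReal c⁻¹ * ∫⁻ x in S, ‖F x ^ 2 * R x‖ₑ := by
        rw [lcR _ _]
    _ ≤ ofReal c⁻¹ * (ofReal C2 * (volume S) ^ (1 / (n : ℝ)) *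
          (ofReal (C1 * r) * (ofReal (6 * C3 + 1) * I))) := by
        gcongr
        refine (hgns _ hu huc S hS).trans ?_
        gcongr
    _ = _ := by
        rw [show c⁻¹ * C2 * (C1 * (6 * C3 + 1)) * r = c⁻¹ * (C2 * ((C1 * r) * (6 * C3 + 1))) by ring,
          ofReal_mul (p := c⁻¹) (by positivity), ofReal_mul (p := C2) (by positivity),
          ofReal_mul (p := C1 * r) (by positivity)]
        ring

def bmp (n k : ℕ) : ContDiffBump (0 : Euc n) where
  rIn := 1 / (2 * (k + 1))
  rOut := 1 / (k + 1)
  rIn_pos := by positivity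
  rIn_lt_rOut := by
    apply one_div_lt_one_div_of_lt <;> linarith [(Nat.cast_nonneg k : (0:ℝ) ≤ k)]

def mol {n : ℕ} {E : Type*} [NormedAddCommGroup E] [NormedSpace ℝ E] (k : ℕ) (f : Euc n → E) :
    Euc n → E :=
  convolution ((bmp n k).normed volume) f (ContinuousLinearMap.lsmul ℝ ℝ) volume

lemma bmp_tendsto (n : ℕ) : Tendsto (fun k => (bmp n k).rOut) atTop (𝓝 0) :=
  tendsto_one_div_add_atTop_nhds_zero_nat

lemma trans_cont {E : Type*} [NormedAddCommGroup E] {p : ℝ≥0∞} (hp1 : 1 ≤ p) (hp : p ≠ ∞)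
    {f : Euc n → E} (hf : MemLp f p) :
    Tendsto (fun t : Euc n => eLpNorm (fun x => f (x - t) - f x) p) (𝓝 0) (𝓝 0) := by
  haveI : Fact (1 ≤ p) := ⟨hp1⟩
  have hgm : ∀ t : Euc n, MeasurePreserving (fun x : Euc n => x - t) volume volume :=
    fun t => measurePreserving_sub_right volume t
  let g : Euc n → C(Euc n, Euc n) := fun t => ⟨fun x => x - t, by fun_prop⟩
  have hg : Continuous g :=
    ContinuousMap.continuous_of_continuous_uncurry _ (by
      change Continuous (fun q : Euc n × Euc n => q.2 - q.1); fun_prop)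
  have h := (continuous_const (y := hf.toLp f)).compMeasurePreservingLp hg
    (fun t => hgm t) hp |>.tendsto 0
  rw [tendsto_iff_edist_tendsto_0] at h
  refine h.congr fun t => ?_
  rw [Lp.edist_def]
  apply eLpNorm_congr_ae
  have h1 := Lp.coeFn_compMeasurePreserving (hf.toLp f) (hgm t)
  have h0 := Lp.coeFn_compMeasurePreserving (hf.toLp f) (hgm 0)
  have h2 := (hgm t).quasiMeasurePreserving.ae_eq_comp hf.coeFn_toLp
  have h3 := (hgm 0).quasiMeasurePreserving.ae_eq_comp hf.coeFn_toLp
  filter_upwards [h1, h0, h2, h3] with x a b c e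
  simp only [Pi.sub_apply, g]
  erw [a, b, c, e]
  simp

lemma jensen {α E : Type*} [MeasurableSpace α] [NormedAddCommGroup E] [NormedSpace ℝ E]
    (μ : Measure α) [IsProbabilityMeasure μ] {p : ℝ≥0∞} (hp1 : 1 ≤ p) (hp : p ≠ ∞) {h : α → E}
    (hh : AEStronglyMeasurable h μ) :
    ‖∫ x, h x ∂μ‖ₑ ^ p.toReal ≤ ∫⁻ x, ‖h x‖ₑ ^ p.toReal ∂μ := by
  have h0 : p ≠ 0 := (zero_lt_one.trans_le hp1).ne'
  have h0' : 0 < p.toReal := ENNReal.toReal_pos h0 hp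
  calc ‖∫ x, h x ∂μ‖ₑ ^ p.toReal ≤ (eLpNorm h 1 μ) ^ p.toReal := by
        gcongr
        rw [eLpNorm_one_eq_lintegral_enorm]
        exact enorm_integral_le_lintegral_enorm _
    _ ≤ (eLpNorm h p μ) ^ p.toReal := by
        gcongr
        exact eLpNorm_le_eLpNorm_of_exponent_le hp1 hh
    _ = _ := by
        rw [eLpNorm_eq_lintegral_rpow_enorm_toReal h0 hp, ← ENNReal.rpow_mul,
          one_div_mul_cancel h0'.ne', ENNReal.rpow_one]

def bmpM (n k : ℕ) : Measure (Euc n) :=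
  volume.withDensity fun x => ofReal ((bmp n k).normed volume x)

lemma bmpM_prob (n k : ℕ) : IsProbabilityMeasure (bmpM n k) := by
  constructor
  unfold bmpM
  rw [withDensity_apply _ MeasurableSet.univ, Measure.restrict_univ,
    ← ofReal_integral_eq_lintegral_ofReal (bmp n k).integrable_normed
      (ae_of_all _ (bmp n k).nonneg_normed), ContDiffBump.integral_normed]
  simp

lemma mol_eq {E : Type*} [NormedAddCommGroup E] [NormedSpace ℝ E] (k : ℕ) (f : Euc n → E)
    (x : Euc n) : mol k f x = ∫ t, f (x - t) ∂(bmpM n k) := by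
  unfold bmpM
  rw [integral_withDensity_eq_integral_toReal_smul]
  · unfold mol convolution
    congr 1; ext t
    rw [ENNReal.toReal_ofReal ((bmp n k).nonneg_normed t)]; rfl
  · have := ((bmp n k).continuous_normed (μ := volume)).measurable
    fun_prop
  · exact ae_of_all _ fun x => ofReal_lt_top

lemma mol_Lp {E : Type*} [NormedAddCommGroup E] [NormedSpace ℝ E] [CompleteSpace E]
    {p : ℝ≥0∞} (hp1 : 1 ≤ p) (hp : p ≠ ∞)
    {f : Euc n → E} (hf : MemLp f p) (hfi : LocallyIntegrable f) :
    Tendsto (fun k => eLpNorm (fun x => mol k f x - f x) p) atTop (𝓝 0) := by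
  have h0 : p ≠ 0 := (zero_lt_one.trans_le hp1).ne'
  have h0' : 0 < p.toReal := ENNReal.toReal_pos h0 hp
  have key : ∀ k, (eLpNorm (fun x => mol k f x - f x) p) ^ p.toReal ≤
      ∫⁻ t, (eLpNorm (fun x => f (x - t) - f x) p) ^ p.toReal ∂(bmpM n k) := by
    intro k
    haveI := bmpM_prob n k
    have hac : bmpM n k ≪ volume := withDensity_absolutelyContinuous _ _
    have hm2 : AEStronglyMeasurable (fun q : Euc n × Euc n => f (q.1 - q.2))
        (volume.prod volume) := by
      exact hf.aestronglyMeasurable.comp_quasiMeasurePreserving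
        (quasiMeasurePreserving_sub volume volume)
    have hm2' : AEStronglyMeasurable (fun q : Euc n × Euc n => f (q.1 - q.2) - f q.1)
        (volume.prod (bmpM n k)) := by
      refine AEStronglyMeasurable.sub (hm2.mono_ac (Measure.AbsolutelyContinuous.rfl.prod hac)) ?_
      exact hf.aestronglyMeasurable.comp_fst
    have hmx : ∀ x, AEStronglyMeasurable (fun t => f (x - t)) (bmpM n k) := fun x =>
      (hf.aestronglyMeasurable.comp_quasiMeasurePreserving
        (quasiMeasurePreserving_sub_left volume x)).mono_ac hac
    have hint : ∀ x, Integrable (fun t => f (x - t)) (bmpM n k) := by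
      intro x
      unfold bmpM
      rw [integrable_withDensity_iff_integrable_smul' (by
        have := ((bmp n k).continuous_normed (μ := volume)).measurable
        fun_prop) (ae_of_all _ fun x => ofReal_lt_top)]
      have := ((bmp n k).hasCompactSupport_normed (μ := volume)).convolutionExists_left
        (ContinuousLinearMap.lsmul ℝ ℝ) ((bmp n k).continuous_normed (μ := volume)) hfi x
      refine this.congr (ae_of_all _ fun t => ?_)
      simp only [ContinuousLinearMap.lsmul_apply]
      rw [ENNReal.toReal_ofReal ((bmp n k).nonneg_normed t)]
    have e : ∀ g : Euc n → E, (eLpNorm g p) ^ p.toReal = ∫⁻ x, ‖g x‖ₑ ^ p.toReal := by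
      intro g
      rw [eLpNorm_eq_lintegral_rpow_enorm_toReal h0 hp, ← ENNReal.rpow_mul,
          one_div_mul_cancel h0'.ne', ENNReal.rpow_one]
    simp_rw [e]
    calc _ ≤ ∫⁻ x, ∫⁻ t, ‖f (x - t) - f x‖ₑ ^ p.toReal ∂(bmpM n k) := by
          apply lintegral_mono; intro x
          have : mol k f x - f x = ∫ t, (f (x - t) - f x) ∂(bmpM n k) := by
            rw [integral_sub (hint x) (integrable_const _), mol_eq]; simp
          simp only [this]
          exact jensen _ hp1 hp ((hmx x).sub aestronglyMeasurable_const)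
      _ = _ := by
          rw [lintegral_lintegral_swap]
          exact (hm2'.enorm.pow_const _)
  have key2 : Tendsto (fun k => ∫⁻ t, (eLpNorm (fun x => f (x - t) - f x) p) ^ p.toReal ∂(bmpM n k))
      atTop (𝓝 0) := by
    have h1 : Tendsto (fun t : Euc n => (eLpNorm (fun x => f (x - t) - f x) p) ^ p.toReal)
        (𝓝 0) (𝓝 0) := by
      have := (trans_cont hp1 hp hf).ennrpow_const p.toReal
      rwa [ENNReal.zero_rpow_of_pos h0'] at this
    rw [ENNReal.tendsto_nhds_zero] at h1 ⊢
    intro ε hε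
    have h2 := h1 ε hε
    rw [Metric.eventually_nhds_iff] at h2
    obtain ⟨η, hη, h2⟩ := h2
    filter_upwards [(bmp_tendsto n).eventually (gt_mem_nhds hη)] with k hk
    haveI := bmpM_prob n k
    calc _ ≤ ∫⁻ t, ε ∂(bmpM n k) := by
          apply lintegral_mono_ae
          unfold bmpM
          rw [ae_withDensity_iff (by
            have := ((bmp n k).continuous_normed (μ := volume)).measurable
            fun_prop)]
          refine ae_of_all _ fun t ht => h2 ?_
          by_contra hc
          apply ht
          have : t ∉ Function.support ((bmp n k).normed volume) := by
            rw [ContDiffBump.support_normed_eq]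
            intro h; rw [mem_ball] at h; exact hc (h.trans hk)
          rw [Function.notMem_support.1 this]; simp
      _ = ε := by simp
  have key3 := tendsto_of_tendsto_of_tendsto_of_le_of_le tendsto_const_nhds key2
    (fun _ => zero_le) key
  have := key3.ennrpow_const (1 / p.toReal)
  rw [ENNReal.zero_rpow_of_pos (by positivity)] at this
  refine this.congr fun k => ?_
  rw [← ENNReal.rpow_mul, mul_one_div_cancel h0'.ne', ENNReal.rpow_one]
def WG {n : ℕ} (f : Euc n → ℝ) (V : Euc n → Euc n) (U : Set (Euc n)) : Prop :=
  ∀ φ : Euc n → ℝ, ContDiff ℝ (⊤ : ℕ∞) φ → HasCompactSupport φ → tsupport φ ⊆ U →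
    ∫ x, f x • gradient φ x = -∫ x, φ x • V x

lemma mol_contDiff (hf : LocallyIntegrable f) (k : ℕ) :
    ContDiff ℝ (⊤ : ℕ∞) (mol k f) :=
  (bmp n k).hasCompactSupport_normed.contDiff_convolution_left _ (bmp n k).contDiff_normed hf

lemma mol_nonneg (hf : ∀ x, 0 ≤ f x) (k : ℕ) (x : Euc n) :
    0 ≤ mol k f x := by
  rw [mol_eq]; exact integral_nonneg fun t => hf _

lemma mol_ae (hf : LocallyIntegrable f) :
    ∀ᵐ x, Tendsto (fun k => mol k f x) atTop (𝓝 (f x)) := by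
  refine ContDiffBump.ae_convolution_tendsto_right_of_locallyIntegrable (K := 2)
    (bmp_tendsto n) (Eventually.of_forall fun k => ?_) hf
  apply le_of_eq
  simp only [bmp]
  field_simp

lemma mol_grad
    (hf : LocallyIntegrable f) (hV : LocallyIntegrable V) (h : WG f V U) (k : ℕ) {x : Euc n}
    (hx : closedBall x (bmp n k).rOut ⊆ U) : gradient (mol k f) x = mol k V x := by
  set ρ := (bmp n k).normed volume with hρ
  have hρ1 : ContDiff ℝ (⊤ : ℕ∞) ρ := (bmp n k).contDiff_normed
  have hρc : HasCompactSupport ρ := (bmp n k).hasCompactSupport_normed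
  have hd := hρc.hasFDerivAt_convolution_left (ContinuousLinearMap.lsmul ℝ ℝ)
    (hρ1.of_le (by exact_mod_cast le_top)) hf x
  set ψ : Euc n → ℝ := fun y => ρ (x - y) with hψ
  have hψ1 : ContDiff ℝ (⊤ : ℕ∞) ψ := hρ1.comp (contDiff_const.sub contDiff_id)
  have hψs : tsupport ψ ⊆ closedBall x (bmp n k).rOut := by
    apply closure_minimal _ isClosed_closedBall
    intro y hy
    have : x - y ∈ Function.support ρ := hy
    rw [ContDiffBump.support_normed_eq, mem_ball, dist_zero_right] at this
    rw [mem_closedBall, dist_comm, dist_eq_norm]; exact this.le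
  have hψc : HasCompactSupport ψ :=
    (isCompact_closedBall _ _).of_isClosed_subset (isClosed_tsupport _) hψs
  have hψg : ∀ y, gradient ψ y = -gradient ρ (x - y) := by
    intro y
    apply HasGradientAt.gradient
    rw [hasGradientAt_iff_hasFDerivAt]
    have h1 : HasFDerivAt ρ (fderiv ℝ ρ (x - y)) (x - y) :=
      (hρ1.differentiable (by simp) _).hasFDerivAt
    have h2 : HasFDerivAt (fun y : Euc n => x - y) (-ContinuousLinearMap.id ℝ (Euc n)) y := by
      simpa using (hasFDerivAt_id y).const_sub x
    have := h1.comp y h2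
    refine this.congr_fderiv ?_
    ext z
    simp [grad_inner]
  have hw := h ψ hψ1 hψc (hψs.trans hx)
  have hmolV : mol k V x = ∫ y, ψ y • V y := by
    unfold mol; rw [convolution_lsmul_swap]
  rw [hmolV]
  have hw' : ∫ y, f y • gradient ρ (x - y) = ∫ y, ψ y • V y := by
    rw [← neg_neg (∫ y, ψ y • V y), ← hw, ← integral_neg]
    congr 1; ext1 y; rw [hψg]; simp
  rw [← hw']
  apply ext_inner_right ℝ
  intro e
  rw [grad_inner]
  unfold mol
  rw [hd.fderiv]
  rw [convolution_eq_swap]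
  have hgc : Continuous (fun y => gradient ρ (x - y)) :=
    (continuous_grad (hρ1.of_le (by exact_mod_cast le_top))).comp (by fun_prop)
  have hgs : HasCompactSupport (fun y => gradient ρ (x - y)) :=
    (hcs_grad hρc).comp_homeomorph (Homeomorph.subLeft x)
  have i1 : Integrable (fun y => f y • gradient ρ (x - y)) :=
    hf.integrable_smul_right_of_hasCompactSupport hgc hgs
  rw [ContinuousLinearMap.integral_apply]
  · rw [real_inner_comm, ← integral_inner i1]
    congr 1; ext1 y
    rw [inner_smul_right, real_inner_comm, grad_inner]
    simp [ContinuousLinearMap.precompL_apply]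
    ring
  · have := (hρc.fderiv ℝ).convolutionExists_left (μ := volume) ((ContinuousLinearMap.lsmul ℝ ℝ).precompL (Euc n))
      (hρ1.continuous_fderiv (by simp)) hf x
    have := this.integrable_swap
    exact this

lemma mol_conv {U K : Set (Euc n)} (hU : IsOpen U)
    (hK : IsCompact K) (hKU : K ⊆ U)
    (hf : LocallyIntegrable f) (hV : MemLp V 2) (h : WG f V U) :
    Tendsto (fun k => ∫⁻ x in K, ofReal (‖gradient (mol k f) x - V x‖ ^ 2)) atTop (𝓝 0) := by
  have hVl : LocallyIntegrable V := hV.locallyIntegrable (by norm_num)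
  have h1 := (mol_Lp (by norm_num) (by norm_num) hV hVl)
  have h2 := h1.ennrpow_const 2
  rw [ENNReal.zero_rpow_of_pos (by norm_num)] at h2
  obtain ⟨ε, hε, hεU⟩ := hK.exists_cthickening_subset_open hU hKU
  refine sqz h2
    (Eventually.of_forall fun _ => zero_le) ?_
  filter_upwards [(bmp_tendsto n).eventually (gt_mem_nhds hε)] with k hk
  rw [eLpNorm_eq_lintegral_rpow_enorm_toReal (by norm_num) (by norm_num), ← ENNReal.rpow_mul]
  norm_num
  calc _ ≤ ∫⁻ x in K, ‖mol k V x - V x‖ₑ ^ 2 := by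
        apply setLIntegral_mono_ae' hK.measurableSet
        refine ae_of_all _ fun x hx => ?_
        rw [mol_grad hf hVl h k ((closedBall_subset_cthickening hx _).trans
          ((cthickening_mono hk.le _).trans hεU))]
    _ ≤ _ := setLIntegral_le_lintegral _ _

def EN (n : ℕ) (d : ℝ) (Γ : Set (Euc n)) (g : Euc n → Euc n) : ℝ≥0∞ :=
  ∫⁻ x, ofReal (‖g x‖ ^ 2 * weightW n d Γ x)

structure Dat (n : ℕ) (d C₀ : ℝ) (Γ : Set (Euc n)) (x0 : Euc n) (r : ℝ) (u : Euc n → ℝ)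
    (V : Euc n → Euc n) : Prop where
  G : Geo n d C₀ Γ
  hx0 : x0 ∈ Γ
  hr : 0 < r
  u0 : ∀ x, 0 ≤ u x
  um : Measurable u
  ui : Integrable u
  Vm : Measurable V
  V0 : ∀ x, x ∉ ball x0 (3.8 * r) → V x = 0
  VE : EN n d Γ V < ⊤
  wg : WG u V (ball x0 (3.8 * r) \ Γ)

structure Nice (Q Q1 : ℝ → ℝ) (M : ℝ) : Prop where
  hd : ∀ s, 0 ≤ s → HasDerivAt Q (Q1 s) s
  hc : ContinuousOn Q1 (Ici 0)
  hQ : ∀ s, 0 ≤ s → |Q s| ≤ M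
  hQ1 : ∀ s, 0 ≤ s → |Q1 s| ≤ M

lemma w_nonneg (x : Euc n) : 0 ≤ weightW n d Γ x :=
  Real.rpow_nonneg infDist_nonneg _

lemma meas_EN (hg : Measurable g) :
    Measurable (fun x => ofReal (‖g x‖ ^ 2 * weightW n d Γ x)) := by
  have := meas_w (n := n) (d := d) (Γ := Γ)
  fun_prop

lemma EN_add {g h : Euc n → Euc n} (hh : Measurable h) :
    EN n d Γ (fun x => g x + h x) ≤ 2 * EN n d Γ g + 2 * EN n d Γ h := by
  unfold EN
  rw [← lintegral_const_mul' _ _ (by simp), ← lintegral_const_mul' _ _ (by simp),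
    ← lintegral_add_right _ ((meas_EN hh).const_mul _)]
  apply lintegral_mono; intro x
  simp only
  have e2 : ∀ a : ℝ, 2 * ofReal a = ofReal (2 * a) := fun a => by
    rw [ofReal_mul (by norm_num)]; simp
  rw [e2, e2,
    ← ofReal_add (by have := w_nonneg (n := n) (d := d) (Γ := Γ) x; positivity) (by have := w_nonneg (n := n) (d := d) (Γ := Γ) x; positivity)]
  apply ofReal_le_ofReal
  have h1 : ‖g x + h x‖ ^ 2 ≤ 2 * ‖g x‖ ^ 2 + 2 * ‖h x‖ ^ 2 := by
    have := norm_add_le (g x) (h x)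
    nlinarith [norm_nonneg (g x + h x), norm_nonneg (g x), norm_nonneg (h x), sq_nonneg (‖g x‖ - ‖h x‖)]
  calc _ ≤ (2 * ‖g x‖ ^ 2 + 2 * ‖h x‖ ^ 2) * weightW n d Γ x := by
        gcongr; exact w_nonneg x
    _ = _ := by ring

lemma EN_mono {g h : Euc n → Euc n} {c : ℝ} (hc : 0 ≤ c)
    (H : ∀ x, ‖g x‖ ≤ c * ‖h x‖) :
    EN n d Γ g ≤ ofReal (c ^ 2) * EN n d Γ h := by
  unfold EN
  rw [← lintegral_const_mul' _ _ (by simp)]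
  apply lintegral_mono; intro x
  simp only
  rw [← ofReal_mul (by positivity), ← mul_assoc, ← mul_pow]
  apply ofReal_le_ofReal
  have := w_nonneg (n := n) (d := d) (Γ := Γ) x
  have := H x
  gcongr

lemma EN_dom {g : ℕ → Euc n → Euc n} {h : Euc n → Euc n}
    (hg : ∀ j, Measurable (g j)) (H : ∀ j x, ‖g j x‖ ≤ ‖h x‖) (hh : EN n d Γ h < ⊤)
    (hl : ∀ᵐ x, Tendsto (fun j => g j x) atTop (𝓝 0)) :
    Tendsto (fun j => EN n d Γ (g j)) atTop (𝓝 0) := by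
  have := tendsto_lintegral_of_dominated_convergence (μ := volume)
    (F := fun j x => ofReal (‖g j x‖ ^ 2 * weightW n d Γ x)) (f := fun _ => 0)
    (fun x => ofReal (‖h x‖ ^ 2 * weightW n d Γ x)) (fun j => meas_EN (hg j))
    (fun j => ae_of_all _ fun x => by
      have := w_nonneg (n := n) (d := d) (Γ := Γ) x
      have := H j x
      simp only
      gcongr) hh.ne (by
      filter_upwards [hl] with x hx
      have h1 := ((hx.norm.pow 2).mul_const (weightW n d Γ x))
      have h2 := (ENNReal.continuous_ofReal.tendsto _).comp h1
      simp only [norm_zero, ne_eq, OfNat.ofNat_ne_zero, not_false_eq_true, zero_pow, zero_mul,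
        ofReal_zero] at h2
      exact h2)
  simpa [EN] using this

namespace Dat
variable {n : ℕ} {d C₀ : ℝ} {Γ : Set (Euc n)} {x0 : Euc n} {r : ℝ} {u : Euc n → ℝ}
    {V : Euc n → Euc n}

lemma w_low (D : Dat n d C₀ Γ x0 r u V) {x : Euc n} (hx : x ∈ ball x0 (3.8 * r)) (hx' : x ∉ Γ) :
    (3.8 * r) ^ (d + 1 - (n : ℝ)) ≤ weightW n d Γ x := by
  have hp := D.G.pos hx'
  have h1 : infDist x Γ ≤ 3.8 * r := (infDist_le_dist_of_mem D.hx0).trans (mem_ball.1 hx).le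
  exact Real.rpow_le_rpow_of_nonpos hp h1 (by linarith [D.G.hdn])

lemma l2_le (D : Dat n d C₀ Γ x0 r u V) {g : Euc n → Euc n}
    (hg : ∀ x, x ∉ ball x0 (3.8 * r) → g x = 0) :
    ∫⁻ x, ‖g x‖ₑ ^ 2 ≤ ofReal (((3.8 * r) ^ (d + 1 - (n : ℝ)))⁻¹) * EN n d Γ g := by
  have hr := D.hr
  have hc : 0 < (3.8 * r) ^ (d + 1 - (n : ℝ)) := by positivity
  unfold EN
  rw [← lintegral_const_mul' _ _ (by simp)]
  apply lintegral_mono_ae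
  filter_upwards [D.G.ae_notMem] with x hx
  rw [← ofReal_mul (by positivity)]
  by_cases hxD : x ∈ ball x0 (3.8 * r)
  · rw [← ofReal_norm_eq_enorm, ← ofReal_pow (norm_nonneg _)]
    apply ofReal_le_ofReal
    calc ‖g x‖ ^ 2 = ((3.8 * r) ^ (d + 1 - (n : ℝ)))⁻¹ * (‖g x‖ ^ 2 * (3.8 * r) ^ (d + 1 - (n : ℝ))) := by
          field_simp
      _ ≤ _ := by gcongr; exact D.w_low hxD hx
  · rw [hg x hxD]; simp

lemma VL (D : Dat n d C₀ Γ x0 r u V) : MemLp V 2 := by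
  refine ⟨D.Vm.aestronglyMeasurable, ?_⟩
  rw [eLpNorm_lt_top_iff_lintegral_rpow_enorm_lt_top (by norm_num) (by norm_num)]
  have := D.l2_le D.V0
  norm_num
  exact this.trans_lt (mul_lt_top ofReal_lt_top D.VE)

lemma wK (D : Dat n d C₀ Γ x0 r u V) {K : Set (Euc n)} (hK : IsCompact K) (hKΓ : ∀ y ∈ Γ, y ∉ K) :
    ∃ W : ℝ, 0 < W ∧ ∀ x ∈ K, weightW n d Γ x ≤ W := by
  have hc : ContinuousOn (weightW n d Γ) K := by
    intro x hx
    refine ContinuousAt.continuousWithinAt ?_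
    exact (continuous_infDist_pt Γ).continuousAt.rpow_const
      (Or.inl (D.G.pos (fun h => hKΓ x h hx)).ne')
  obtain ⟨W, hW⟩ := hK.exists_bound_of_continuousOn hc
  exact ⟨max W 1, by positivity, fun x hx => (le_abs_self _).trans ((hW x hx).trans (le_max_left _ _))⟩

lemma EN_K {K : Set (Euc n)} (hK : MeasurableSet K) {W : ℝ} (hW0 : 0 < W)
    (hW : ∀ x ∈ K, weightW n d Γ x ≤ W)
    {g : Euc n → Euc n} (hg : ∀ x, x ∉ K → g x = 0) :
    EN n d Γ g ≤ ofReal W * ∫⁻ x in K, ofReal (‖g x‖ ^ 2) := by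
  unfold EN
  rw [← lintegral_const_mul' _ _ (by simp), ← lintegral_indicator hK]
  apply lintegral_mono; intro x
  by_cases hx : x ∈ K
  · simp only [hx, indicator_of_mem]
    rw [← ofReal_mul hW0.le, mul_comm]
    have := hW x hx
    gcongr
  · simp [hg x hx]

end Dat

lemma Nice.mQ (N : Nice Q Q1 M) {X : Type*} [MeasurableSpace X] {u : X → ℝ}
    (u0 : ∀ x, 0 ≤ u x) (um : Measurable u) :
    Measurable (fun x => Q (u x)) ∧ Measurable (fun x => Q1 (u x)) := by
  have key : ∀ P : ℝ → ℝ, ContinuousOn P (Ici 0) → Measurable (fun x => P (u x)) := by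
    intro P hP
    have h1 : Continuous (fun s => P (max s 0)) :=
      hP.comp_continuous (by fun_prop) (fun s => le_max_right s 0)
    have h2 := h1.measurable.comp um
    convert h2 using 2 with x
    simp [u0 x]
  exact ⟨key Q (fun s hs => (N.hd s hs).continuousAt.continuousWithinAt), key Q1 N.hc⟩

lemma Nice.cd (N : Nice Q Q1 M) {v : Euc n → ℝ}
    (hv : ContDiff ℝ 1 v) (v0 : ∀ x, 0 ≤ v x) : ContDiff ℝ 1 (fun x => Q (v x)) := by
  rw [contDiff_one_iff_fderiv]
  have h : ∀ x, HasFDerivAt (fun x => Q (v x)) (Q1 (v x) • fderiv ℝ v x) x := fun x =>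
    (N.hd _ (v0 x)).comp_hasFDerivAt x (hv.differentiable (by norm_num) x).hasFDerivAt
  refine ⟨fun x => (h x).differentiableAt, ?_⟩
  rw [show fderiv ℝ (fun x => Q (v x)) = fun x => Q1 (v x) • fderiv ℝ v x from
    funext fun x => (h x).fderiv]
  exact (N.hc.comp_continuous hv.continuous v0).smul (hv.continuous_fderiv (by norm_num))

lemma step1 (D : Dat n d C₀ Γ x0 r u V) {Q Q1 : ℝ → ℝ} {M : ℝ} (N : Nice Q Q1 M)
    {ψ : Euc n → ℝ} (hψ : ContDiff ℝ 1 ψ) (hψc : HasCompactSupport ψ)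
    (hψD : tsupport ψ ⊆ ball x0 (3.8 * r) \ Γ) :
    ∃ v : ℕ → Euc n → ℝ, (∀ j x, 0 ≤ v j x) ∧ (∀ j, ContDiff ℝ 1 (fun x => ψ x * Q (v j x))) ∧
      (∀ᵐ x, Tendsto (fun j => ψ x * Q (v j x)) atTop (𝓝 (ψ x * Q (u x)))) ∧
      Tendsto (fun j => EN n d Γ (fun x => gradient (fun x => ψ x * Q (v j x)) x -
        (Q (u x) • gradient ψ x + (ψ x * Q1 (u x)) • V x))) atTop (𝓝 0) := by
  set K := tsupport ψ with hKdef
  have hK : IsCompact K := hψc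
  have hKΓ : ∀ y ∈ Γ, y ∉ K := fun y hy hyK => (hψD hyK).2 hy
  obtain ⟨W, hW0, hW⟩ := D.wK hK hKΓ
  have hUo : IsOpen (ball x0 (3.8 * r) \ Γ) := isOpen_ball.sdiff D.G.cl
  have hM : 0 ≤ M := (abs_nonneg _).trans (N.hQ 0 le_rfl)
  have hul : LocallyIntegrable u := D.ui.locallyIntegrable
  have hv1 : ∀ j, ContDiff ℝ 1 (mol j u) := fun j => (mol_contDiff hul j).of_le (by exact_mod_cast le_top)
  have hv0 : ∀ j x, 0 ≤ mol j u x := fun j x => mol_nonneg D.u0 j x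
  have hconv := mol_conv hUo hK hψD hul D.VL D.wg
  have hae := mol_ae hul
  have hcQ : ∀ j, ContDiff ℝ 1 (fun x => Q (mol j u x)) := fun j => N.cd (hv1 j) (hv0 j)
  have hcF : ∀ j, ContDiff ℝ 1 (fun x => ψ x * Q (mol j u x)) := fun j => hψ.mul (hcQ j)
  refine ⟨fun j => mol j u, hv0, hcF, ?_, ?_⟩
  · filter_upwards [hae] with x hx
    exact ((N.hd _ (D.u0 x)).continuousAt.tendsto.comp hx).const_mul _
  obtain ⟨B, hB⟩ := hψ.continuous.bounded_above_of_compact_support hψc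
  have hgr : ∀ j x, gradient (fun x => ψ x * Q (mol j u x)) x =
      Q (mol j u x) • gradient ψ x + (ψ x * Q1 (mol j u x)) • gradient (mol j u) x := by
    intro j x
    rw [grad_mul (f := ψ) (g := fun x => Q (mol j u x)) (hψ.differentiable (by norm_num) x)
      ((hcQ j).differentiable (by norm_num) x), grad_comp (N.hd _ (hv0 j x))
      ((hv1 j).differentiable (by norm_num) x), smul_smul, add_comm]
  have hmψ : Measurable (gradient ψ) := (continuous_grad hψ).measurable
  have hmψ' : Measurable ψ := hψ.continuous.measurable
  obtain ⟨mQ, mQ1⟩ := N.mQ D.u0 D.um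
  have mVm := D.Vm
  have mv : ∀ j, Measurable (mol j u) := fun j => (hv1 j).continuous.measurable
  have mg : ∀ j, Measurable (gradient (mol j u)) := fun j => (continuous_grad (hv1 j)).measurable
  set a : ℕ → Euc n → Euc n := fun j x =>
    (Q (mol j u x) - Q (u x)) • gradient ψ x + (ψ x * (Q1 (mol j u x) - Q1 (u x))) • V x with ha
  set b : ℕ → Euc n → Euc n := fun j x =>
    (ψ x * Q1 (mol j u x)) • (gradient (mol j u) x - V x) with hb
  have hma : ∀ j, Measurable (a j) := by
    intro j
    obtain ⟨m1, m2⟩ := N.mQ (hv0 j) (mv j)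
    exact ((m1.sub mQ).smul hmψ).add ((hmψ'.mul (m2.sub mQ1)).smul mVm)
  have hmb : ∀ j, Measurable (b j) := by
    intro j
    obtain ⟨m1, m2⟩ := N.mQ (hv0 j) (mv j)
    exact (hmψ'.mul m2).smul ((mg j).sub mVm)
  have hsplit : ∀ j, EN n d Γ (fun x => gradient (fun x => ψ x * Q (mol j u x)) x -
        (Q (u x) • gradient ψ x + (ψ x * Q1 (u x)) • V x)) ≤
        2 * EN n d Γ (a j) + 2 * EN n d Γ (b j) := by
    intro j
    rw [show (fun x => gradient (fun x => ψ x * Q (mol j u x)) x -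
        (Q (u x) • gradient ψ x + (ψ x * Q1 (u x)) • V x)) = fun x => a j x + b j x by
      ext1 x
      rw [hgr, ha, hb]; simp only; module]
    exact EN_add (hmb j)
  have hlim_a : Tendsto (fun j => EN n d Γ (a j)) atTop (𝓝 0) := by
    refine EN_dom hma (h := fun x => (2 * M * ‖gradient ψ x‖ + 2 * M * (B * ‖V x‖)) •
      (EuclideanSpace.single ⟨0, by have := D.G.hn; omega⟩ (1 : ℝ))) ?_ ?_ ?_
    · intro j x
      rw [norm_smul, EuclideanSpace.norm_single, norm_one, mul_one, ha]
      have h1 : |Q (mol j u x) - Q (u x)| ≤ 2 * M := by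
        have := abs_sub (Q (mol j u x)) (Q (u x))
        linarith [N.hQ _ (hv0 j x), N.hQ _ (D.u0 x)]
      have h2 : |Q1 (mol j u x) - Q1 (u x)| ≤ 2 * M := by
        have := abs_sub (Q1 (mol j u x)) (Q1 (u x))
        linarith [N.hQ1 _ (hv0 j x), N.hQ1 _ (D.u0 x)]
      have h3 := hB x
      refine (norm_add_le _ _).trans (le_trans ?_ (le_abs_self _))
      rw [norm_smul, norm_smul, norm_mul, Real.norm_eq_abs, Real.norm_eq_abs (Q1 _ - _)]
      calc _ ≤ 2 * M * ‖gradient ψ x‖ + B * (2 * M) * ‖V x‖ := by gcongr; exact (norm_nonneg _).trans h3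
        _ = _ := by ring
    · have hBn : 0 ≤ B := (norm_nonneg _).trans (hB x0)
      have e1 : ∀ x, ((2 * M * ‖gradient ψ x‖ + 2 * M * (B * ‖V x‖)) •
        (EuclideanSpace.single ⟨0, by have := D.G.hn; omega⟩ (1 : ℝ) : Euc n)) =
        (2 * M * ‖gradient ψ x‖) • (EuclideanSpace.single ⟨0, by have := D.G.hn; omega⟩ (1 : ℝ) : Euc n) +
        (2 * M * (B * ‖V x‖)) • (EuclideanSpace.single ⟨0, by have := D.G.hn; omega⟩ (1 : ℝ) : Euc n) :=
        fun x => by rw [add_smul]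
      simp_rw [e1]
      refine (EN_add (by fun_prop)).trans_lt ?_
      refine ENNReal.add_lt_top.2 ⟨mul_lt_top (by simp) ?_, mul_lt_top (by simp) ?_⟩
      · have hKg : ∀ x, x ∉ K → gradient ψ x = 0 := fun x hx => gz0 hx
        have h1 := EN_mono (n := n) (d := d) (Γ := Γ) (c := 2 * M) (by positivity)
          (g := fun x => (2 * M * ‖gradient ψ x‖) • (EuclideanSpace.single ⟨0, by have := D.G.hn; omega⟩ (1 : ℝ) : Euc n))
          (h := gradient ψ) (fun x => by
            rw [norm_smul, EuclideanSpace.norm_single, norm_one, mul_one, Real.norm_of_nonneg (by positivity)])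
        refine h1.trans_lt (mul_lt_top ofReal_lt_top ?_)
        refine (Dat.EN_K hK.measurableSet hW0 hW hKg).trans_lt
          (mul_lt_top ofReal_lt_top ?_)
        have : Integrable (fun x => ‖gradient ψ x‖ ^ 2) := by
          refine Continuous.integrable_of_hasCompactSupport ((continuous_grad hψ).norm.pow 2) ?_
          exact (hcs_grad hψc).norm.comp_left (g := fun s : ℝ => s ^ 2) (by simp)
        exact (setLIntegral_le_lintegral _ _).trans_lt this.lintegral_lt_top
      · have h1 := EN_mono (n := n) (d := d) (Γ := Γ) (c := 2 * M * B) (by positivity)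
          (g := fun x => (2 * M * (B * ‖V x‖)) • (EuclideanSpace.single ⟨0, by have := D.G.hn; omega⟩ (1 : ℝ) : Euc n))
          (h := V) (fun x => by
            rw [norm_smul, EuclideanSpace.norm_single, norm_one, mul_one, Real.norm_of_nonneg (by positivity)]
            apply le_of_eq; ring)
        exact h1.trans_lt (mul_lt_top ofReal_lt_top D.VE)
    · filter_upwards [hae] with x hx
      have t1 : Tendsto (fun j => Q (mol j u x)) atTop (𝓝 (Q (u x))) :=
        (N.hd _ (D.u0 x)).continuousAt.tendsto.comp hx
      have t2 : Tendsto (fun j => Q1 (mol j u x)) atTop (𝓝 (Q1 (u x))) := by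
        refine (N.hc (u x) (D.u0 x)).tendsto.comp (tendsto_nhdsWithin_iff.2
          ⟨hx, Eventually.of_forall fun j => hv0 j x⟩)
      have := ((t1.sub_const (Q (u x))).smul_const (gradient ψ x)).add
        (((t2.sub_const (Q1 (u x))).const_mul (ψ x)).smul_const (V x))
      simpa [ha] using this
  have hlim_b : Tendsto (fun j => EN n d Γ (b j)) atTop (𝓝 0) := by
    have h0 := ENNReal.Tendsto.const_mul (a := ofReal (W * (B * M) ^ 2)) hconv (Or.inr ofReal_ne_top)
    rw [mul_zero] at h0
    refine tendsto_of_tendsto_of_tendsto_of_le_of_le tendsto_const_nhds h0 (fun _ => zero_le) fun j => ?_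
    refine (Dat.EN_K (K := K) hK.measurableSet hW0 hW fun x hx => ?_).trans ?_
    · simp [hb, image_eq_zero_of_notMem_tsupport hx]
    rw [ofReal_mul hW0.le, mul_assoc]
    gcongr
    rw [← lintegral_const_mul' _ _ (by simp)]
    apply lintegral_mono; intro x
    simp only [hb]
    rw [← ofReal_mul (by positivity), norm_smul, norm_mul, mul_pow]
    have h3 := hB x
    have h4 := N.hQ1 _ (hv0 j x)
    rw [← Real.norm_eq_abs] at h4
    have : 0 ≤ B := (norm_nonneg _).trans h3
    gcongr
  have hsum : Tendsto (fun j => 2 * EN n d Γ (a j) + 2 * EN n d Γ (b j)) atTop (𝓝 0) := by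
    have := (ENNReal.Tendsto.const_mul (a := 2) hlim_a (Or.inr (by simp))).add
      (ENNReal.Tendsto.const_mul (a := 2) hlim_b (Or.inr (by simp)))
    simpa using this
  exact tendsto_of_tendsto_of_tendsto_of_le_of_le tendsto_const_nhds hsum (fun _ => zero_le) hsplit

lemma eta_ex (n : ℕ) (d C₀ : ℝ) (hC : 1 ≤ C₀) (hd : d < (n : ℝ) - 1) (hn : 2 ≤ n) (hd0 : 0 < d) :
    ∃ κ C : ℝ, 0 < κ ∧ κ < 1 ∧ 0 < C ∧ ∀ Γ, Geo n d C₀ Γ → ∀ x0 ∈ Γ, ∀ r : ℝ, 0 < r →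
      ∀ ε : ℝ, 0 < ε → ∃ η : Euc n → ℝ, (∀ x, 0 ≤ η x ∧ η x ≤ 1) ∧
      (∀ x ∈ ball x0 (4 * r), ContDiffAt ℝ 1 η x) ∧ (∀ x, ε ≤ infDist x Γ → η x = 1) ∧
      (∀ x ∈ ball x0 (4 * r), infDist x Γ < κ * ε → η x = 0) ∧
      (∀ x ∈ ball x0 (4 * r), ‖gradient η x‖ ≤ C / ε) ∧
      (∀ x ∈ ball x0 (4 * r), (infDist x Γ < κ * ε ∨ ε < infDist x Γ) → gradient η x = 0) := by
  obtain ⟨c, C1, hc, hC1, hR⟩ := R_bounds n d C₀ hC hd hn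
  obtain ⟨L, hL, hLb⟩ := st_deriv_bdd
  set a := (n : ℝ) - 1 - d with ha
  have ha0 : 0 < a := by linarith
  set κ0 := (c / (2 * C1)) ^ (1 / a) with hκ0
  have hκ0p : 0 < κ0 := by positivity
  set κ := min κ0 (1 / 2) with hκ
  have hκp : 0 < κ := by positivity
  refine ⟨κ, L * κ ^ (d - n), hκp, (min_le_right _ _).trans_lt (by norm_num), by positivity,
    fun Γ G x0 hx0 r hr ε hε => ?_⟩
  classical
  set R := Rf n d Γ x0 (12 * r) with hRdef
  set η : Euc n → ℝ := fun x => if x ∈ Γ then 0 else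
    Real.smoothTransition (2 - ε ^ a * R x / C1) with hη
  have heq : ∀ x, x ∉ Γ → η =ᶠ[𝓝 x] fun x => Real.smoothTransition (2 - ε ^ a * R x / C1) := by
    intro x hx
    filter_upwards [G.cl.isOpen_compl.mem_nhds hx] with y hy
    simp only [hη]; rw [if_neg hy]
  have hzero : ∀ x ∈ ball x0 (4 * r), infDist x Γ < κ * ε → η x = 0 := by
    intro x hx hδ
    by_cases hxΓ : x ∈ Γ
    · simp [hη, hxΓ]
    · simp only [hη]; rw [if_neg hxΓ]
      apply Real.smoothTransition.zero_of_nonpos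
      have hp := G.pos hxΓ
      have h1 := (hR Γ G x0 hx0 (12 * r) (by positivity) x hxΓ).1 (by rw [mem_ball] at hx; linarith)
      have h2 : weightW n d Γ x = (infDist x Γ ^ a)⁻¹ := by
        unfold weightW; rw [← Real.rpow_neg hp.le]; congr 1; rw [ha]; ring
      have h3 : infDist x Γ ^ a ≤ (c / (2 * C1)) * ε ^ a := by
        calc infDist x Γ ^ a ≤ (κ0 * ε) ^ a := by
              apply Real.rpow_le_rpow hp.le (hδ.le.trans _) ha0.le
              gcongr; exact min_le_left _ _
          _ = _ := by
              rw [Real.mul_rpow hκ0p.le hε.le, hκ0, ← Real.rpow_mul (by positivity),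
                one_div_mul_cancel ha0.ne', Real.rpow_one]
      have h4 : 0 < infDist x Γ ^ a := by positivity
      rw [h2] at h1
      have h5 : 2 * C1 ≤ ε ^ a * R x := by
        calc 2 * C1 = (2 * C1 / c) * (c * ((infDist x Γ ^ a)⁻¹ * infDist x Γ ^ a)) := by
              field_simp
          _ ≤ (2 * C1 / c) * (c * ((infDist x Γ ^ a)⁻¹ * ((c / (2 * C1)) * ε ^ a))) := by gcongr
          _ = ε ^ a * (c * (infDist x Γ ^ a)⁻¹) := by field_simp
          _ ≤ _ := by gcongr
      rw [sub_nonpos, le_div_iff₀ hC1]; exact h5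
  have hone : ∀ x, ε ≤ infDist x Γ → η x = 1 := by
    intro x hδ
    have hxΓ : x ∉ Γ := fun h => by rw [infDist_zero_of_mem h] at hδ; linarith
    simp only [hη]; rw [if_neg hxΓ]
    apply Real.smoothTransition.one_of_one_le
    have hp := G.pos hxΓ
    have h1 := (hR Γ G x0 hx0 (12 * r) (by positivity) x hxΓ).2.1
    have h2 : weightW n d Γ x = (infDist x Γ ^ a)⁻¹ := by
      unfold weightW; rw [← Real.rpow_neg hp.le]; congr 1; rw [ha]; ring
    have h4 : 0 < infDist x Γ ^ a := by positivity
    have hR0 : 0 ≤ R x := integral_nonneg fun y => by positivity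
    have : ε ^ a * R x / C1 ≤ 1 := by
      rw [div_le_one hC1]
      calc _ ≤ infDist x Γ ^ a * (C1 * (infDist x Γ ^ a)⁻¹) := by
            rw [← h2]; gcongr
        _ = C1 := by field_simp
    linarith
  have hzev : ∀ x ∈ ball x0 (4 * r), infDist x Γ < κ * ε → η =ᶠ[𝓝 x] fun _ => 0 := by
    intro x hx hδ
    filter_upwards [isOpen_ball.mem_nhds hx,
      (isOpen_lt (continuous_infDist_pt Γ) continuous_const).mem_nhds hδ] with y h1 h2
    exact hzero y h1 h2
  have hgz : ∀ x ∈ ball x0 (4 * r), (infDist x Γ < κ * ε ∨ ε < infDist x Γ) → gradient η x = 0 := by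
    rintro x hx (h | h)
    · unfold gradient; rw [(hzev x hx h).fderiv_eq]; simp
    · have : η =ᶠ[𝓝 x] fun _ => 1 := by
        filter_upwards [(isOpen_lt continuous_const (continuous_infDist_pt Γ)).mem_nhds h] with y h2
        exact hone y (le_of_lt h2)
      unfold gradient; rw [this.fderiv_eq]; simp
  have hpos : ∀ x ∈ Γ, infDist x Γ < κ * ε := fun x hx => by
    rw [infDist_zero_of_mem hx]; positivity
  refine ⟨η, ?_, ?_, hone, hzero, ?_, hgz⟩
  · intro x; simp only [hη]; split_ifs
    · simp
    · exact ⟨Real.smoothTransition.nonneg _, Real.smoothTransition.le_one _⟩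
  · intro x hx
    by_cases hxΓ : x ∈ Γ
    · exact contDiffAt_const.congr_of_eventuallyEq (hzev x hx (hpos x hxΓ))
    · refine ContDiffAt.congr_of_eventuallyEq ?_ (heq x hxΓ)
      apply Real.smoothTransition.contDiff.contDiffAt.comp
      have := (R_deriv G x0 (s := 12 * r) (by positivity)).2 x hxΓ
      exact contDiffAt_const.sub ((contDiffAt_const.mul this).div_const _)
  · intro x hx
    by_cases hδ : infDist x Γ < κ * ε
    · rw [hgz x hx (Or.inl hδ), norm_zero]; positivity
    have hxΓ : x ∉ Γ := fun h => hδ (hpos x h)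
    push Not at hδ
    have hp := G.pos hxΓ
    have hRd := ((R_deriv G x0 (s := 12 * r) (by positivity)).2 x hxΓ).differentiableAt (by norm_num)
    have h1 := (hR Γ G x0 hx0 (12 * r) (by positivity) x hxΓ).2.2
    have e1 : gradient η x = (deriv Real.smoothTransition (2 - ε ^ a * R x / C1) * (-(ε ^ a / C1)))
        • gradient R x := by
      have : gradient η x = gradient (fun x => Real.smoothTransition (2 - ε ^ a * R x / C1)) x := by
        unfold gradient; rw [(heq x hxΓ).fderiv_eq]
      rw [this]
      refine grad_comp (G := fun s => Real.smoothTransition (2 - ε ^ a * s / C1)) (f := R) ?_ hRd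
      have h2 : HasDerivAt (fun s : ℝ => 2 - ε ^ a * s / C1) (-(ε ^ a / C1)) (R x) := by
        have := (((hasDerivAt_id (R x)).const_mul (ε ^ a)).div_const C1).const_sub 2
        simpa using this
      exact ((Real.smoothTransition.contDiff (n := 1)).differentiable (by norm_num) _).hasDerivAt.comp _ h2
    rw [e1, norm_smul, norm_mul, norm_neg, Real.norm_eq_abs, Real.norm_of_nonneg (by positivity)]
    calc _ ≤ L * (ε ^ a / C1) * (C1 * infDist x Γ ^ (d - n)) := by gcongr; exact hLb _
      _ = L * ε ^ a * infDist x Γ ^ (d - n) := by field_simp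
      _ ≤ L * ε ^ a * (κ * ε) ^ (d - n) := by
          gcongr L * ε ^ a * ?_
          exact Real.rpow_le_rpow_of_nonpos (by positivity) hδ (by linarith)
      _ = L * κ ^ (d - n) * (ε ^ a * ε ^ (d - n)) := by
          rw [Real.mul_rpow hκp.le hε.le]; ring
      _ = _ := by
          rw [← Real.rpow_add hε, show a + (d - n) = -1 by rw [ha]; ring, Real.rpow_neg_one]
          rw [div_eq_mul_inv]

structure Eta (n : ℕ) (Γ : Set (Euc n)) (x0 : Euc n) (r κ C ε : ℝ) (η : Euc n → ℝ) : Prop where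
  b : ∀ x, 0 ≤ η x ∧ η x ≤ 1
  cd : ∀ x ∈ ball x0 (4 * r), ContDiffAt ℝ 1 η x
  one : ∀ x, ε ≤ infDist x Γ → η x = 1
  zero : ∀ x ∈ ball x0 (4 * r), infDist x Γ < κ * ε → η x = 0
  gb : ∀ x ∈ ball x0 (4 * r), ‖gradient η x‖ ≤ C / ε
  gz : ∀ x ∈ ball x0 (4 * r), (infDist x Γ < κ * ε ∨ ε < infDist x Γ) → gradient η x = 0

lemma int_grad_zero {F : Euc n → ℝ} (hF : ContDiff ℝ 1 F) (hc : HasCompactSupport F) :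
    ∫ x, gradient F x = 0 := by
  have hi : Integrable (gradient F) :=
    (continuous_grad hF).integrable_of_hasCompactSupport (hcs_grad hc)
  refine ext_inner_left ℝ fun e => ?_
  rw [← integral_inner hi, inner_zero_right]
  have h1 : ∀ x, inner ℝ e (gradient F x) = fderiv ℝ F x e := fun x => by
    rw [real_inner_comm, grad_inner]
  simp_rw [h1]
  have := integral_mul_fderiv_eq_neg_fderiv_mul_of_integrable (μ := volume) (f := fun _ : Euc n => (1 : ℝ))
      (g := F) (v := e) (by simp) (by
        simp_rw [one_mul, ← h1]; exact hi.const_inner e) (by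
        simp_rw [one_mul]; exact hF.continuous.integrable_of_hasCompactSupport hc)
      (fun x _ => by fun_prop) (fun x _ => hF.differentiable (by norm_num) x)
  simpa using this

lemma vol_strip (n : ℕ) (d C₀ : ℝ) (hC : 1 ≤ C₀) (hn : 2 ≤ n) : ∃ C : ℝ, 0 < C ∧
    ∀ Γ, Geo n d C₀ Γ →
    ∀ x0 ∈ Γ, ∀ ρ ε : ℝ, 0 < ε → ε ≤ ρ →
      volume (ball x0 ρ ∩ {x | infDist x Γ < ε}) ≤ ofReal (C * ρ ^ d * ε ^ ((n : ℝ) - d)) := by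
  obtain ⟨C, hC0, h⟩ := m_strip n d C₀ hC hn
  refine ⟨C, hC0, fun Γ G x0 hx0 ρ ε hε hερ => ?_⟩
  have h1 := h Γ G x0 hx0 ρ ε hε hερ
  have hρ : 0 < ρ := hε.trans_le hερ
  set S := ball x0 ρ ∩ {x | infDist x Γ < ε} with hS
  have hSm : MeasurableSet S := measurableSet_ball.inter
    (measurableSet_lt (continuous_infDist_pt Γ).measurable measurable_const)
  have h2 : ofReal (ε ^ (d + 1 - (n : ℝ))) * volume S ≤ measW n d Γ S := by
    rw [measW, withDensity_apply _ hSm, ← setLIntegral_const]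
    apply setLIntegral_mono_ae' hSm
    filter_upwards [G.ae_notMem] with x hx hxS
    apply ofReal_le_ofReal
    exact Real.rpow_le_rpow_of_nonpos (G.pos hx) (le_of_lt hxS.2) (by linarith [G.hdn])
  have hp : 0 < ε ^ (d + 1 - (n : ℝ)) := by positivity
  have h3 := (h2.trans h1)
  calc volume S = ofReal ((ε ^ (d + 1 - (n : ℝ)))⁻¹) * (ofReal (ε ^ (d + 1 - (n : ℝ))) * volume S) := by
        rw [← mul_assoc, ← ofReal_mul (by positivity), inv_mul_cancel₀ hp.ne']; simp
    _ ≤ ofReal ((ε ^ (d + 1 - (n : ℝ)))⁻¹) * ofReal (C * ρ ^ d * ε) := by gcongr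
    _ = _ := by
        rw [← ofReal_mul (by positivity)]
        congr 1
        rw [← Real.rpow_neg hε.le, show (n : ℝ) - d = -(d + 1 - n) + 1 by ring, Real.rpow_add hε,
          Real.rpow_one]; ring

lemma psi_eta (G : Geo n d C₀ Γ) {x0 : Euc n} {r κ C ε : ℝ}
    (hr : 0 < r) (hκ : 0 < κ) (hε : 0 < ε)
    {η : Euc n → ℝ} (H : Eta n Γ x0 r κ C ε η) {ψ : Euc n → ℝ} (hψ : ContDiff ℝ 1 ψ)
    (hψc : HasCompactSupport ψ) (hψD : tsupport ψ ⊆ ball x0 (3.8 * r)) :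
    ContDiff ℝ 1 (fun x => ψ x * η x) ∧ HasCompactSupport (fun x => ψ x * η x) ∧
    tsupport (fun x => ψ x * η x) ⊆ tsupport ψ \ Γ ∧
    ∀ x, gradient (fun x => ψ x * η x) x = ψ x • gradient η x + η x • gradient ψ x := by
  have hD : tsupport ψ ⊆ ball x0 (4 * r) := hψD.trans (ball_subset_ball (by linarith))
  have hts : tsupport (fun x => ψ x * η x) ⊆ tsupport ψ := tsupport_mul_subset_left
  refine ⟨contDiff_of_ts fun x hx => hψ.contDiffAt.mul (H.cd x (hD (hts hx))), hψc.mul_right,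
    fun x hx => ⟨hts hx, fun hxΓ => ?_⟩, fun x => ?_⟩
  · have hxD := hD (hts hx)
    revert hx
    rw [imp_false, notMem_tsupport_iff_eventuallyEq]
    have h0 : infDist x Γ < κ * ε := by rw [infDist_zero_of_mem hxΓ]; positivity
    filter_upwards [isOpen_ball.mem_nhds hxD,
      (isOpen_lt (continuous_infDist_pt Γ) continuous_const).mem_nhds h0] with y h1 h2
    simp [H.zero y h1 h2]
  · by_cases hx : x ∈ tsupport ψ
    · exact grad_mul (f := ψ) (g := η) (hψ.differentiable (by norm_num) x)
        ((H.cd x (hD hx)).differentiableAt (by norm_num))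
    · rw [gz0 (fun h => hx (hts h)), gz0 hx,
        image_eq_zero_of_notMem_tsupport hx]; simp

lemma Dat.EN_int (D : Dat n d C₀ Γ x0 r u V) {g : ℕ → Euc n → Euc n}
    (hm : ∀ j, Measurable (g j)) (hg : ∀ j x, x ∉ ball x0 (3.8 * r) → g j x = 0)
    (hl : Tendsto (fun j => EN n d Γ (g j)) atTop (𝓝 0)) :
    Tendsto (fun j => ∫⁻ x, ‖g j x‖ₑ) atTop (𝓝 0) := by
  set c := ofReal (((3.8 * r) ^ (d + 1 - (n : ℝ)))⁻¹) with hc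
  have h1 : ∀ j, ∫⁻ x, ‖g j x‖ₑ ≤ (c * EN n d Γ (g j)) ^ (1 / (2 : ℝ)) *
      volume (ball x0 (3.8 * r)) ^ (1 / (2 : ℝ)) := by
    intro j
    have e1 : ∫⁻ x, ‖g j x‖ₑ = ∫⁻ x, ‖g j x‖ₑ * (ball x0 (3.8 * r)).indicator 1 x := by
      congr 1; ext x
      by_cases hx : x ∈ ball x0 (3.8 * r)
      · simp [hx]
      · simp [hg j x hx]
    rw [e1]
    refine (ENNReal.lintegral_mul_le_Lp_mul_Lq volume (p := 2) (q := 2) Real.HolderConjugate.two_two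
      (hm j).enorm.aemeasurable (measurable_one.indicator measurableSet_ball).aemeasurable).trans ?_
    gcongr
    · simpa using D.l2_le (hg j)
    · rw [show (fun x => (ball x0 (3.8 * r)).indicator (1 : Euc n → ℝ≥0∞) x ^ (2 : ℝ)) =
        (ball x0 (3.8 * r)).indicator 1 by
        ext x; by_cases hx : x ∈ ball x0 (3.8 * r) <;> simp [hx]]
      rw [lintegral_indicator_one measurableSet_ball]
  have h2 : Tendsto (fun j => (c * EN n d Γ (g j)) ^ (1 / (2 : ℝ)) *
      volume (ball x0 (3.8 * r)) ^ (1 / (2 : ℝ))) atTop (𝓝 0) := by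
    have h3 := ((ENNReal.Tendsto.const_mul (a := c) hl (Or.inr ofReal_ne_top)).ennrpow_const (1 / (2 : ℝ)))
    have h4 := ENNReal.Tendsto.mul_const (b := volume (ball x0 (3.8 * r)) ^ (1 / (2 : ℝ))) h3
      (Or.inr (ENNReal.rpow_ne_top_of_nonneg (by norm_num) measure_ball_lt_top.ne))
    simpa using h4
  exact tendsto_of_tendsto_of_tendsto_of_le_of_le tendsto_const_nhds h2 (fun _ => zero_le) h1

lemma Dat.VI (D : Dat n d C₀ Γ x0 r u V) : Integrable V := by
  have h := D.VL
  have h1 : IntegrableOn V (ball x0 (3.8 * r)) := by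
    haveI : IsFiniteMeasure (volume.restrict (ball x0 (3.8 * r))) :=
      ⟨by rw [Measure.restrict_apply_univ]; exact measure_ball_lt_top⟩
    exact (h.restrict _).integrable (by norm_num)
  exact (integrableOn_iff_integrable_of_support_subset (fun x hx => by
    by_contra h; exact hx (D.V0 x h))).1 h1

lemma meas_grad (f : Euc n → ℝ) : Measurable (gradient f) := by
  unfold gradient
  exact (LinearIsometryEquiv.continuous _).measurable.comp (measurable_fderiv ℝ f)

lemma E1a (D : Dat n d C₀ Γ x0 r u V) {Q Q1 : ℝ → ℝ} {M : ℝ} (N : Nice Q Q1 M)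
    {ψ : Euc n → ℝ} (hψ : ContDiff ℝ 1 ψ) (hψc : HasCompactSupport ψ)
    (hψD : tsupport ψ ⊆ ball x0 (3.8 * r) \ Γ) :
    Integrable (fun x => Q (u x) • gradient ψ x + (ψ x * Q1 (u x)) • V x) ∧ 
    ∫ x, (Q (u x) • gradient ψ x + (ψ x * Q1 (u x)) • V x) = 0 := by
  obtain ⟨v, hv0, hv1, hv2, hv3⟩ := step1 D N hψ hψc hψD
  obtain ⟨mQ, mQ1⟩ := N.mQ D.u0 D.um
  have mV := D.Vm
  have mψ := hψ.continuous.measurable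
  set J := fun x => Q (u x) • gradient ψ x + (ψ x * Q1 (u x)) • V x with hJ
  have mJ : Measurable J := by
    have := meas_grad ψ
    exact (mQ.smul this).add ((mψ.mul mQ1).smul mV)
  have hc : ∀ j, HasCompactSupport (fun x => ψ x * Q (v j x)) := fun j => hψc.mul_right
  have key := D.EN_int (g := fun j x => gradient (fun x => ψ x * Q (v j x)) x - J x)
    (fun j => (meas_grad _).sub mJ) (fun j x hx => by
      have hx' : x ∉ tsupport ψ := fun h => hx (hψD h).1
      rw [gz0 (fun h => hx' (tsupport_mul_subset_left h))]
      simp [hJ, gz0 hx', image_eq_zero_of_notMem_tsupport hx']) hv3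
  have hgi : ∀ j, Integrable (gradient (fun x => ψ x * Q (v j x))) := fun j =>
    (continuous_grad (hv1 j)).integrable_of_hasCompactSupport (hcs_grad (hc j))
  have hJi : Integrable J := by
    obtain ⟨j, hj⟩ := (key.eventually (gt_mem_nhds (by norm_num : (0 : ℝ≥0∞) < 1))).exists
    have : Integrable (fun x => gradient (fun x => ψ x * Q (v j x)) x - J x) :=
      ⟨((meas_grad _).sub mJ).aestronglyMeasurable, hj.trans ENNReal.one_lt_top⟩
    have := (hgi j).sub this
    refine this.congr (Eventually.of_forall fun x => by simp)
  refine ⟨hJi, ?_⟩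
  have := tendsto_integral_of_L1 J hJi.aestronglyMeasurable (Eventually.of_forall hgi) key
  have h2 : (fun j => ∫ x, gradient (fun x => ψ x * Q (v j x)) x) = fun _ => 0 := by
    ext1 j; exact int_grad_zero (hv1 j) (hc j)
  rw [h2] at this
  exact (tendsto_nhds_unique this tendsto_const_nhds)

lemma E1b (D : Dat n d C₀ Γ x0 r u V) {Q Q1 : ℝ → ℝ} {M : ℝ} (N : Nice Q Q1 M)
    {ψ : Euc n → ℝ} (hψ : ContDiff ℝ 1 ψ) (hψc : HasCompactSupport ψ)
    (hψD : tsupport ψ ⊆ ball x0 (3.8 * r)) :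
    ∫ x, (Q (u x) • gradient ψ x + (ψ x * Q1 (u x)) • V x) = 0 := by
  have G := D.G
  obtain ⟨κ, C, hκ, hκ1, hC, hη⟩ := eta_ex n d C₀ G.hC0 G.hdn G.hn G.hd0
  obtain ⟨Cs, hCs, hstrip⟩ := vol_strip n d C₀ G.hC0 G.hn
  have hr := D.hr
  have hM : 0 ≤ M := (abs_nonneg _).trans (N.hQ 0 le_rfl)
  have hex : ∀ k : ℕ, ∃ η, Eta n Γ x0 r κ C (1 / ((k : ℝ) + 1)) η := fun k => by
    obtain ⟨η, h1, h2, h3, h4, h5, h6⟩ := hη Γ G x0 D.hx0 r hr (1 / ((k : ℝ) + 1)) (by positivity)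
    exact ⟨η, h1, h2, h3, h4, h5, h6⟩
  choose η H using hex
  have hP := fun k => psi_eta G hr hκ (by positivity) (H k) hψ hψc hψD
  obtain ⟨mQ, mQ1⟩ := N.mQ D.u0 D.um
  have mV := D.Vm
  have mψ := hψ.continuous.measurable
  obtain ⟨B, hB⟩ := hψ.continuous.bounded_above_of_compact_support hψc
  have hBn : 0 ≤ B := (norm_nonneg _).trans (hB x0)
  have hVL : Integrable V := D.VI
  have hJi : Integrable (fun x => Q (u x) • gradient ψ x + (ψ x * Q1 (u x)) • V x) := by
    have hg : Integrable (gradient ψ) :=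
      (continuous_grad hψ).integrable_of_hasCompactSupport (hcs_grad hψc)
    refine Integrable.add (hg.bdd_smul M mQ.aestronglyMeasurable (Eventually.of_forall fun x => N.hQ _ (D.u0 x)))
      (hVL.bdd_smul (B * M) (mψ.mul mQ1).aestronglyMeasurable (Eventually.of_forall fun x => ?_))
    show ‖ψ x * Q1 (u x)‖ ≤ _
    rw [norm_mul]
    have h1 := hB x
    have h2 := N.hQ1 _ (D.u0 x)
    exact mul_le_mul h1 h2 (norm_nonneg _) hBn
  set J := fun x => Q (u x) • gradient ψ x + (ψ x * Q1 (u x)) • V x with hJ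
  set I := fun (k : ℕ) x => Q (u x) • gradient (fun x => ψ x * η k x) x +
    ((ψ x * η k x) * Q1 (u x)) • V x with hI
  set A := fun (k : ℕ) x => (Q (u x) * ψ x) • gradient (η k) x with hA
  have hII : ∀ k, Integrable (I k) ∧ ∫ x, I k x = 0 := fun k =>
    E1a D N (hP k).1 (hP k).2.1 ((hP k).2.2.1.trans (diff_subset_diff_left hψD))
  have hIA : ∀ k x, I k x - A k x = η k x • J x := by
    intro k x
    simp only [hI, hA, hJ, (hP k).2.2.2 x]
    module
  set S := fun k : ℕ => ball x0 (3.8 * r) ∩ {x | infDist x Γ < 2 / ((k : ℝ) + 1)} with hS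
  have hSm : ∀ k, MeasurableSet (S k) := fun k => measurableSet_ball.inter
    (measurableSet_lt (continuous_infDist_pt Γ).measurable measurable_const)
  have hAb : ∀ k x, ‖A k x‖ ≤ (S k).indicator (fun _ => M * B * (C * (k + 1))) x := by
    intro k x
    by_cases hx : x ∈ tsupport ψ
    · have hx' := hψD hx
      have hx4 : x ∈ ball x0 (4 * r) := ball_subset_ball (by linarith) hx'
      by_cases hδ : infDist x Γ < 2 / ((k : ℝ) + 1)
      · rw [indicator_of_mem (show x ∈ S k from ⟨hx', hδ⟩)]
        simp only [hA]
        rw [norm_smul, norm_mul]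
        have h1 := hB x
        have h2 := N.hQ _ (D.u0 x)
        have h3 := (H k).gb x hx4
        rw [div_div_eq_mul_div, div_one] at h3
        gcongr; exact h2
      · have : gradient (η k) x = 0 := (H k).gz x hx4 (Or.inr (by
          push Not at hδ
          refine lt_of_lt_of_le ?_ hδ
          gcongr; norm_num))
        simp only [hA]
        rw [this, smul_zero, norm_zero]
        exact indicator_nonneg (fun _ _ => by positivity) _
    · simp only [hA]
      rw [image_eq_zero_of_notMem_tsupport hx, mul_zero, zero_smul, norm_zero]
      exact indicator_nonneg (fun _ _ => by positivity) _
  have hSfin : ∀ k, volume (S k) ≠ ⊤ := fun k =>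
    ((measure_mono inter_subset_left).trans_lt measure_ball_lt_top).ne
  have hAi : ∀ k, Integrable (A k) := fun k => by
    refine Integrable.mono' (g := (S k).indicator (fun _ => M * B * (C * (k + 1)))) ?_ ?_
      (Eventually.of_forall (hAb k))
    · exact (integrable_indicator_iff (hSm k)).2 (integrableOn_const (hSfin k))
    · exact ((mQ.mul mψ).smul (meas_grad _)).aestronglyMeasurable
  have hA0 : Tendsto (fun k => ∫ x, A k x) atTop (𝓝 0) := by
    have hb : ∀ᶠ k : ℕ in atTop, ‖∫ x, A k x‖ ≤ M * B * C * Cs * (3.8 * r) ^ d * 2 ^ ((n : ℝ) - d) *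
        (1 / ((k : ℝ) + 1)) ^ ((n : ℝ) - d - 1) := by
      have : Tendsto (fun k : ℕ => 2 * (1 / ((k : ℝ) + 1))) atTop (𝓝 (2 * 0)) :=
        tendsto_one_div_add_atTop_nhds_zero_nat.const_mul 2
      rw [mul_zero] at this
      filter_upwards [this.eventually (gt_mem_nhds (by positivity : (0 : ℝ) < 3.8 * r))] with k hk
      have h1 := hstrip Γ G x0 D.hx0 (3.8 * r) (2 / ((k : ℝ) + 1)) (by positivity) (by
        rw [div_eq_mul_one_div]; exact hk.le)
      have h2 : volume.real (S k) ≤ Cs * (3.8 * r) ^ d * (2 / ((k : ℝ) + 1)) ^ ((n : ℝ) - d) :=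
        ENNReal.toReal_le_of_le_ofReal (by positivity) h1
      calc ‖∫ x, A k x‖ ≤ ∫ x, (S k).indicator (fun _ => M * B * (C * (k + 1))) x :=
            norm_integral_le_of_norm_le ((integrable_indicator_iff (hSm k)).2 (integrableOn_const (hSfin k)))
              (Eventually.of_forall (hAb k))
        _ = volume.real (S k) * (M * B * (C * (k + 1))) := by
            rw [integral_indicator (hSm k), setIntegral_const, smul_eq_mul]
        _ ≤ (Cs * (3.8 * r) ^ d * (2 / ((k : ℝ) + 1)) ^ ((n : ℝ) - d)) * (M * B * (C * (k + 1))) := by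
            gcongr
        _ = _ := by
            rw [show (2 : ℝ) / ((k : ℝ) + 1) = 2 * (1 / ((k : ℝ) + 1)) by ring,
              Real.mul_rpow (x := 2) (by norm_num) (by positivity), Real.rpow_sub_one (by positivity)]
            have : ((k : ℝ) + 1) = 1 / (1 / ((k : ℝ) + 1)) := by field_simp
            generalize (1 / ((k : ℝ) + 1)) = a at this ⊢
            rw [this]; ring
    refine squeeze_zero_norm' hb ?_
    have h1 : Tendsto (fun k : ℕ => (1 / ((k : ℝ) + 1)) ^ ((n : ℝ) - d - 1)) atTop (𝓝 0) := by
      have := (tendsto_one_div_add_atTop_nhds_zero_nat (𝕜 := ℝ)).rpow_const (p := (n : ℝ) - d - 1)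
        (Or.inr (by linarith [G.hdn]))
      rwa [Real.zero_rpow (by linarith [G.hdn])] at this
    simpa using h1.const_mul (M * B * C * Cs * (3.8 * r) ^ d * 2 ^ ((n : ℝ) - d))
  have hB0 : Tendsto (fun k => ∫ x, (I k x - A k x)) atTop (𝓝 (∫ x, J x)) := by
    refine tendsto_integral_of_dominated_convergence (fun x => ‖J x‖)
      (fun k => ((hII k).1.sub (hAi k)).aestronglyMeasurable) hJi.norm
      (fun k => Eventually.of_forall fun x => ?_) ?_
    · rw [hIA, norm_smul, Real.norm_of_nonneg ((H k).b x).1]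
      exact mul_le_of_le_one_left (norm_nonneg _) ((H k).b x).2
    · filter_upwards [G.ae_notMem] with x hx
      have hp := G.pos hx
      refine tendsto_const_nhds.congr' ?_
      filter_upwards [(tendsto_one_div_add_atTop_nhds_zero_nat (𝕜 := ℝ)).eventually (gt_mem_nhds hp)] with k hk
      rw [hIA, (H k).one x hk.le, one_smul]
  have h3 : ∀ k, ∫ x, (I k x - A k x) = -∫ x, A k x := fun k => by
    rw [integral_sub (hII k).1 (hAi k), (hII k).2, zero_sub]
  simp_rw [h3] at hB0
  have := tendsto_nhds_unique hB0 hA0.neg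
  simpa using this

lemma niceG (k : ℝ) (hk : 1 ≤ k) : Nice (fun s => s / (1 + s / k)) (fun s => 1 / (1 + s / k) ^ 2) k := by
  have hp : ∀ s : ℝ, 0 ≤ s → 0 < 1 + s / k := fun s hs => by positivity
  refine ⟨fun s hs => ?_, ?_, fun s hs => ?_, fun s hs => ?_⟩
  · have := hp s hs
    have h1 : HasDerivAt (fun s : ℝ => 1 + s / k) (1 / k) s := by
      simpa using ((hasDerivAt_id s).div_const k).const_add 1
    refine ((hasDerivAt_id s).div h1 this.ne').congr_deriv ?_
    simp only [id]
    have hk0 : k ≠ 0 := by positivity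
    field_simp
    ring
  · refine ContinuousOn.div continuousOn_const (by fun_prop) fun s hs => by have := hp s hs; positivity
  · have := hp s hs
    rw [abs_of_nonneg (by positivity), div_le_iff₀ this]
    have : k * (s / k) = s := by field_simp
    nlinarith
  · have := hp s hs
    have h1 : 1 ≤ 1 + s / k := by have : 0 ≤ s / k := by positivity
                                  linarith
    rw [abs_of_nonneg (by positivity), div_le_iff₀ (by positivity)]
    nlinarith [one_le_pow₀ h1 (n := 2)]

lemma E1 (D : Dat n d C₀ Γ x0 r u V) : WG u V (ball x0 (3.8 * r)) ∧ Integrable V := by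
  have hr := D.hr
  have hVL : Integrable V := D.VI
  refine ⟨fun ψ hψ hψc hψD => ?_, hVL⟩
  have hψ1 : ContDiff ℝ 1 ψ := hψ.of_le (by exact_mod_cast le_top)
  obtain ⟨B, hB⟩ := hψ.continuous.bounded_above_of_compact_support hψc
  obtain ⟨B', hB'⟩ := (continuous_grad hψ1).bounded_above_of_compact_support (hcs_grad hψc)
  have mψ := hψ.continuous.measurable
  have hi1 : Integrable (fun x => u x • gradient ψ x) :=
    D.ui.smul_bdd B' (meas_grad ψ).aestronglyMeasurable (Eventually.of_forall hB')
  have hi2 : Integrable (fun x => ψ x • V x) :=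
    hVL.bdd_smul B mψ.aestronglyMeasurable (Eventually.of_forall hB)
  rw [eq_neg_iff_add_eq_zero, ← integral_add hi1 hi2]
  have hN : ∀ k : ℕ, (1 : ℝ) ≤ k + 1 := fun k => by linarith [Nat.cast_nonneg (α := ℝ) k]
  have hz := fun k : ℕ => E1b D (niceG (k + 1) (hN k)) hψ1 hψc hψD
  have hkk : ∀ x, Tendsto (fun k : ℕ => 1 + u x / ((k : ℝ) + 1)) atTop (𝓝 1) := fun x => by
    have := (tendsto_one_div_add_atTop_nhds_zero_nat (𝕜 := ℝ)).const_mul (u x)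
    have := this.const_add 1
    simpa [div_eq_mul_inv] using this
  have hge : ∀ (k : ℕ) x, 1 ≤ 1 + u x / ((k : ℝ) + 1) := fun k x => by
    have : 0 ≤ u x / ((k : ℝ) + 1) := div_nonneg (D.u0 x) (by positivity)
    linarith
  have ht := tendsto_integral_of_dominated_convergence (μ := volume)
    (F := fun (k : ℕ) x => (u x / (1 + u x / ((k : ℝ) + 1))) • gradient ψ x +
      (ψ x * (1 / (1 + u x / ((k : ℝ) + 1)) ^ 2)) • V x)
    (f := fun x => u x • gradient ψ x + ψ x • V x)
    (fun x => ‖u x • gradient ψ x‖ + ‖ψ x • V x‖) (fun k => by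
      obtain ⟨mQ, mQ1⟩ := (niceG (k + 1) (hN k)).mQ D.u0 D.um
      exact ((mQ.smul (meas_grad ψ)).add ((mψ.mul mQ1).smul D.Vm)).aestronglyMeasurable)
    (hi1.norm.add hi2.norm) (fun k => Eventually.of_forall fun x => by
      have h1 := hge k x
      have h0 := D.u0 x
      refine (norm_add_le _ _).trans ?_
      rw [norm_smul, norm_smul, norm_smul, norm_smul, norm_mul]
      have h2 : ‖u x / (1 + u x / ((k : ℝ) + 1))‖ ≤ ‖u x‖ := by
        rw [Real.norm_of_nonneg (by positivity), Real.norm_of_nonneg h0]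
        exact div_le_self h0 h1
      have h3 : ‖1 / (1 + u x / ((k : ℝ) + 1)) ^ 2‖ ≤ 1 := by
        rw [Real.norm_of_nonneg (by positivity)]
        rw [div_le_iff₀ (by positivity), one_mul]
        exact one_le_pow₀ h1
      have h4 : ‖ψ x‖ * ‖1 / (1 + u x / ((k : ℝ) + 1)) ^ 2‖ ≤ ‖ψ x‖ :=
        mul_le_of_le_one_right (norm_nonneg _) h3
      gcongr) (Eventually.of_forall fun x => by
      have h1 := hkk x
      have a1 : Tendsto (fun k : ℕ => u x / (1 + u x / ((k : ℝ) + 1))) atTop (𝓝 (u x)) := by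
        have := (tendsto_const_nhds (x := u x)).div h1 one_ne_zero
        rw [div_one] at this; exact this
      have a2 : Tendsto (fun k : ℕ => ψ x * (1 / (1 + u x / ((k : ℝ) + 1)) ^ 2)) atTop (𝓝 (ψ x)) := by
        have := ((tendsto_const_nhds (x := (1 : ℝ))).div (h1.pow 2) (by simp)).const_mul (ψ x)
        rw [one_pow, div_one, mul_one] at this; exact this
      exact (a1.smul_const _).add (a2.smul_const _))
  rw [show (fun k : ℕ => ∫ x, (u x / (1 + u x / ((k : ℝ) + 1))) • gradient ψ x +
      (ψ x * (1 / (1 + u x / ((k : ℝ) + 1)) ^ 2)) • V x) = fun _ => 0 from funext hz] at ht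
  exact (tendsto_nhds_unique ht tendsto_const_nhds)

lemma aff_map (a : Euc n) {ρ : ℝ} (hρ : 0 < ρ) :
    Measure.map (fun ζ : Euc n => a + ρ • ζ) (volume.restrict (ball 0 1)) =
      ofReal ((ρ ^ n)⁻¹) • volume.restrict (ball a ρ) := by
  have h1 : Measure.map (fun ζ : Euc n => a + ρ • ζ) volume = ofReal ((ρ ^ n)⁻¹) • volume := by
    rw [show (fun ζ : Euc n => a + ρ • ζ) = (fun y => a + y) ∘ (fun ζ => ρ • ζ) from rfl,
      ← Measure.map_map (by fun_prop) (by fun_prop), Measure.map_addHaar_smul _ hρ.ne',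
      Measure.map_smul, map_add_left_eq_self]
    congr 2
    rw [abs_of_nonneg (by positivity)]; simp
  have h2 : (fun ζ : Euc n => a + ρ • ζ) ⁻¹' (ball a ρ) = ball 0 1 := by
    ext ζ
    simp only [mem_preimage, mem_ball, dist_self_add_left, dist_zero_right, norm_smul]
    rw [Real.norm_of_nonneg hρ.le, mul_lt_iff_lt_one_right hρ]
  rw [← h2, ← Measure.restrict_map (by fun_prop) measurableSet_ball, h1, Measure.restrict_smul]

lemma cov_l {F : Euc n → ℝ≥0∞} (hF : Measurable F) (a : Euc n) {ρ : ℝ} (hρ : 0 < ρ) :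
    ∫⁻ ζ in ball 0 1, F (a + ρ • ζ) = ofReal ((ρ ^ n)⁻¹) * ∫⁻ z in ball a ρ, F z := by
  rw [← lintegral_map hF (by fun_prop), aff_map a hρ, lintegral_smul_measure, smul_eq_mul]

lemma cov_i (hF : Measurable f) (a : Euc n) {ρ : ℝ} (hρ : 0 < ρ) :
    ∫ ζ in ball 0 1, f (a + ρ • ζ) = volume.real (ball (0 : Euc n) 1) * ⨍ z in ball a ρ, f z := by
  rw [← integral_map (f := f) (by fun_prop) hF.aestronglyMeasurable, aff_map a hρ, integral_smul_measure,
    setAverage_eq]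
  have h1 : volume.real (ball a ρ) = ρ ^ n * volume.real (ball (0 : Euc n) 1) := by
    rw [Measure.real, Measure.addHaar_ball_of_pos _ _ hρ, ENNReal.toReal_mul,
      ENNReal.toReal_ofReal (by positivity)]; simp [Measure.real]
  have h2 : 0 < volume.real (ball (0 : Euc n) 1) := ENNReal.toReal_pos
    (measure_ball_pos _ _ one_pos).ne' measure_ball_lt_top.ne
  rw [ENNReal.toReal_ofReal (by positivity), h1, smul_eq_mul, smul_eq_mul]
  field_simp

def JJ {n : ℕ} (p q : Euc n) (τ R : ℝ) (g : Euc n → Euc n) : ℝ≥0∞ :=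
  ∫⁻ t in Icc (0 : ℝ) 1, ∫⁻ ζ in ball 0 1, ‖g ((p + t • (q - p)) + (τ + t * (R - τ)) • ζ)‖ₑ

lemma T_smooth (hf : ContDiff ℝ 1 f) (p q : Euc n) {τ R : ℝ}
    (hτ : 0 < τ) (hR : τ ≤ R) :
    ‖(∫ ζ in ball 0 1, f (q + R • ζ)) - ∫ ζ in ball 0 1, f (p + τ • ζ)‖ₑ ≤
      ofReal (dist q p + R) * JJ p q τ R (gradient f) := by
  set c : ℝ → Euc n → Euc n := fun t ζ => (p + t • (q - p)) + (τ + t * (R - τ)) • ζ with hc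
  have hcc : Continuous (fun z : ℝ × Euc n => c z.1 z.2) := by simp only [hc]; fun_prop
  have hint : ∀ (a : Euc n) (ρ : ℝ), IntegrableOn (fun ζ : Euc n => f (a + ρ • ζ)) (ball 0 1) := by
    intro a ρ
    refine IntegrableOn.mono_set ?_ (ball_subset_closedBall (x := (0 : Euc n)) (ε := 1))
    exact ContinuousOn.integrableOn_compact (isCompact_closedBall 0 1)
      (by have := hf.continuous; fun_prop)
  rw [← integral_sub (hint q R) (hint p τ)]
  refine (enorm_integral_le_lintegral_enorm _).trans ?_
  have hgc := continuous_grad hf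
  have hpt : ∀ ζ ∈ ball (0 : Euc n) 1, ‖f (q + R • ζ) - f (p + τ • ζ)‖ₑ ≤
      ∫⁻ t in Icc (0 : ℝ) 1, ofReal (dist q p + R) * ‖gradient f (c t ζ)‖ₑ := by
    intro ζ hζ
    have hcd : ContDiff ℝ 1 (fun t : ℝ => f (c t ζ)) := by
      apply hf.comp; simp only [hc]; fun_prop
    have h1 := enorm_sub_le_lintegral_deriv_of_contDiffOn_Icc (f := fun t : ℝ => f (c t ζ))
      (a := 0) (b := 1) hcd.contDiffOn zero_le_one
    have e0 : c 0 ζ = p + τ • ζ := by simp [hc]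
    have e1 : c 1 ζ = q + R • ζ := by simp [hc]
    simp only [e0, e1] at h1
    refine h1.trans (lintegral_mono fun t => ?_)
    have hcder : HasDerivAt (fun t : ℝ => c t ζ) ((q - p) + (R - τ) • ζ) t := by
      have a1 : HasDerivAt (fun t : ℝ => t • (q - p)) ((1 : ℝ) • (q - p)) t :=
        (hasDerivAt_id t).smul_const _
      have a2 : HasDerivAt (fun t : ℝ => (τ + t * (R - τ))) (1 * (R - τ)) t :=
        ((hasDerivAt_id t).mul_const _).const_add _
      have := (a1.const_add p).add (a2.smul_const ζ)
      rw [one_smul, one_mul] at this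
      exact this
    have hd : HasDerivAt (fun t : ℝ => f (c t ζ)) (fderiv ℝ f (c t ζ) ((q - p) + (R - τ) • ζ)) t :=
      ((hf.differentiable (by norm_num) _).hasFDerivAt).comp_hasDerivAt t hcder
    rw [hd.deriv, ← grad_inner, mul_comm]
    rw [← ofReal_norm_eq_enorm, ← ofReal_norm_eq_enorm, ← ofReal_mul (norm_nonneg _)]
    apply ofReal_le_ofReal
    refine (norm_inner_le_norm _ _).trans ?_
    gcongr
    refine (norm_add_le _ _).trans ?_
    rw [dist_eq_norm, norm_smul, Real.norm_of_nonneg (by linarith)]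
    have : ‖ζ‖ ≤ 1 := by rw [mem_ball_zero_iff] at hζ; exact hζ.le
    nlinarith
  calc _ ≤ ∫⁻ ζ in ball (0 : Euc n) 1, ∫⁻ t in Icc (0 : ℝ) 1, ofReal (dist q p + R) * ‖gradient f (c t ζ)‖ₑ :=
        setLIntegral_mono' measurableSet_ball hpt
    _ = ∫⁻ t in Icc (0 : ℝ) 1, ∫⁻ ζ in ball (0 : Euc n) 1, ofReal (dist q p + R) * ‖gradient f (c t ζ)‖ₑ := by
        apply lintegral_lintegral_swap
        refine Measurable.aemeasurable ?_
        have : Continuous (Function.uncurry fun (ζ : Euc n) (t : ℝ) => gradient f (c t ζ)) :=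
          hgc.comp (hcc.comp continuous_swap)
        exact this.measurable.enorm.const_mul _
    _ = _ := by
        unfold JJ
        rw [← lcR _ _]
        congr 1; ext t
        rw [lcR _ _]

def kk {n : ℕ} (p q : Euc n) (τ R : ℝ) (z : Euc n) : ℝ≥0∞ :=
  ∫⁻ t in Icc (0 : ℝ) 1, ofReal (((τ + t * (R - τ)) ^ n)⁻¹) *
    (ball (p + t • (q - p)) (τ + t * (R - τ))).indicator 1 z

lemma JJ_eq (p q : Euc n) {τ R : ℝ} (hτ : 0 < τ) (hR : τ ≤ R) {g : Euc n → Euc n}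
    (hg : Measurable g) : JJ p q τ R g = ∫⁻ z, ‖g z‖ₑ * kk p q τ R z := by
  have hpos : ∀ t ∈ Icc (0 : ℝ) 1, 0 < τ + t * (R - τ) := fun t ht => by
    nlinarith [ht.1, ht.2, mul_nonneg ht.1 (sub_nonneg.2 hR)]
  have hm : Measurable (Function.uncurry fun (z : Euc n) (t : ℝ) => 
      ofReal (((τ + t * (R - τ)) ^ n)⁻¹) *
      (ball (p + t • (q - p)) (τ + t * (R - τ))).indicator (1 : Euc n → ℝ≥0∞) z) := by
    refine Measurable.mul (by fun_prop) ?_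
    have hS : MeasurableSet {x : Euc n × ℝ | dist x.1 (p + x.2 • (q - p)) < τ + x.2 * (R - τ)} :=
      measurableSet_lt (by fun_prop) (by fun_prop)
    exact ((measurable_one : Measurable (1 : Euc n × ℝ → ℝ≥0∞)).indicator hS)
  have e : ∀ z, ‖g z‖ₑ * kk p q τ R z = ∫⁻ t in Icc (0 : ℝ) 1, ‖g z‖ₑ * (ofReal (((τ + t * (R - τ)) ^ n)⁻¹) *
      (ball (p + t • (q - p)) (τ + t * (R - τ))).indicator 1 z) := fun z => by
    unfold kk
    rw [lintegral_const_mul' _ _ enorm_ne_top]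
  simp_rw [e]
  rw [lintegral_lintegral_swap]
  · unfold JJ
    refine setLIntegral_congr_fun measurableSet_Icc fun t ht => ?_
    rw [cov_l (F := fun z => ‖g z‖ₑ) hg.enorm _ (hpos t ht), ← lcR _ _,
      ← lintegral_indicator measurableSet_ball]
    congr 1; ext z
    by_cases hz : z ∈ ball (p + t • (q - p)) (τ + t * (R - τ))
    · simp only [hz, indicator_of_mem, Pi.one_apply]; ring
    · simp [hz]
  · exact ((hg.comp measurable_fst).enorm.mul hm).aemeasurable

lemma kk_zero {p q : Euc n} (hτ : 0 < τ) (hR : τ ≤ R) (hq : dist q p ≤ 2 * R)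
    {z : Euc n} (hz : z ∉ ball p (3 * R)) : kk p q τ R z = 0 := by
  unfold kk
  rw [setLIntegral_congr_fun (g := fun _ => 0) measurableSet_Icc]
  · simp
  intro t ht
  simp only
  rw [indicator_of_notMem, mul_zero]
  intro h
  apply hz
  rw [mem_ball] at h ⊢
  have h1 : dist (p + t • (q - p)) p = t * dist q p := by
    rw [dist_eq_norm, add_sub_cancel_left, norm_smul, dist_eq_norm, Real.norm_of_nonneg ht.1]
  have := dist_triangle z (p + t • (q - p)) p
  have h2 : t * dist q p ≤ 1 * (2 * R) := mul_le_mul ht.2 hq dist_nonneg zero_le_one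
  nlinarith [ht.1, ht.2, mul_nonneg (sub_nonneg.2 ht.2) (sub_nonneg.2 hR)]

lemma kk_b1 {p q : Euc n} (hτ : 0 < τ) (hR : τ ≤ R) (z : Euc n) :
    kk p q τ R z ≤ ofReal ((τ ^ n)⁻¹) := by
  unfold kk
  calc _ ≤ ∫⁻ t in Icc (0 : ℝ) 1, ofReal ((τ ^ n)⁻¹) := by
        refine setLIntegral_mono' measurableSet_Icc fun t ht => ?_
        calc _ ≤ ofReal ((τ ^ n)⁻¹) * 1 := by
              gcongr
              · nlinarith [ht.1, mul_nonneg ht.1 (sub_nonneg.2 hR)]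
              · exact indicator_le_self' (fun _ _ => zero_le) z
          _ = _ := mul_one _
    _ = _ := by simp

lemma one_d {s R : ℝ} (hs : 0 < s) (hR : 0 < R) :
    ∫⁻ t in Icc (0 : ℝ) 1, ofReal (((s + t * R) ^ 2)⁻¹) ≤ ofReal (1 / (R * s)) := by
  have hpos : ∀ t ∈ Icc (0 : ℝ) 1, 0 < s + t * R := fun t ht => by nlinarith [ht.1, mul_nonneg ht.1 hR.le]
  have hc : ContinuousOn (fun t : ℝ => ((s + t * R) ^ 2)⁻¹) (Icc 0 1) :=
    ContinuousOn.inv₀ (by fun_prop) fun t ht => by have := hpos t ht; positivity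
  rw [← ofReal_integral_eq_lintegral_ofReal (hc.integrableOn_compact isCompact_Icc)
    (Eventually.of_forall fun t => by positivity)]
  apply ofReal_le_ofReal
  rw [integral_Icc_eq_integral_Ioc, ← intervalIntegral.integral_of_le zero_le_one]
  rw [intervalIntegral.integral_eq_sub_of_hasDerivAt (f := fun t => -(1 / R) * (s + t * R)⁻¹)]
  · have : 0 < s + 1 * R := by positivity
    have h2 : 0 ≤ (1 / R) * (s + 1 * R)⁻¹ := by positivity
    have : 1 / (R * s) = (1 / R) * s⁻¹ := by field_simp
    rw [this]
    simp only [zero_mul, add_zero]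
    linarith
  · intro t ht
    rw [uIcc_of_le zero_le_one] at ht
    have hp := hpos t ht
    have h1 : HasDerivAt (fun t : ℝ => s + t * R) R t := by
      simpa using ((hasDerivAt_id t).mul_const R).const_add s
    refine ((h1.inv hp.ne').const_mul (-(1 / R))).congr_deriv ?_
    field_simp
  · apply ContinuousOn.intervalIntegrable
    rwa [uIcc_of_le zero_le_one]

lemma kk_b2 (hn : 2 ≤ n) {p q : Euc n} {τ R : ℝ} (hτ : 0 < τ) (hR : τ ≤ R) (hq : dist q p ≤ 2 * R)
    {z : Euc n} (hz : z ≠ p) :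
    kk p q τ R z ≤ ofReal (6 ^ n / R * dist z p ^ (-((n : ℝ) - 1))) := by
  have hR0 : 0 < R := hτ.trans_le hR
  have hd : 0 < dist z p := dist_pos.2 hz
  set s := dist z p / 3 with hs
  have hs0 : 0 < s := by positivity
  obtain ⟨k, rfl⟩ : ∃ k, n = k + 2 := ⟨n - 2, by omega⟩
  have hmain : ∀ t ∈ Icc (0 : ℝ) 1, ofReal (((τ + t * (R - τ)) ^ (k + 2))⁻¹) *
    (ball (p + t • (q - p)) (τ + t * (R - τ))).indicator 1 z ≤
      ofReal (2 ^ (k + 2) * (s ^ k)⁻¹) * ofReal (((s + t * R) ^ 2)⁻¹) := by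
    intro t ht
    by_cases h : z ∈ ball (p + t • (q - p)) (τ + t * (R - τ))
    · rw [indicator_of_mem h, Pi.one_apply, mul_one, ← ofReal_mul (by positivity)]
      apply ofReal_le_ofReal
      rw [mem_ball] at h
      have h1 : dist (p + t • (q - p)) p = t * dist q p := by
        rw [dist_eq_norm, add_sub_cancel_left, norm_smul, dist_eq_norm, Real.norm_of_nonneg ht.1]
      have h3 := dist_triangle z (p + t • (q - p)) p
      have h2 : t * dist q p ≤ t * (2 * R) := mul_le_mul_of_nonneg_left hq ht.1
      have h4 : t * R ≤ τ + t * (R - τ) := by nlinarith [ht.2]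
      have h5 : s ≤ τ + t * (R - τ) := by rw [hs]; linarith
      have h6 : (s + t * R) / 2 ≤ τ + t * (R - τ) := by linarith
      have h7 : 0 < s + t * R := by nlinarith [ht.1, mul_nonneg ht.1 hR0.le]
      calc ((τ + t * (R - τ)) ^ (k + 2))⁻¹ ≤ (((s + t * R) / 2) ^ (k + 2))⁻¹ := by gcongr
        _ = 2 ^ (k + 2) * ((s + t * R) ^ k)⁻¹ * ((s + t * R) ^ 2)⁻¹ := by
            rw [div_pow, pow_add (s + t * R)]; field_simp
        _ ≤ _ := by gcongr; nlinarith [ht.1, mul_nonneg ht.1 hR0.le]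
    · rw [indicator_of_notMem h, mul_zero]; exact zero_le
  calc kk p q τ R z ≤ ∫⁻ t in Icc (0 : ℝ) 1, ofReal (2 ^ (k + 2) * (s ^ k)⁻¹) * ofReal (((s + t * R) ^ 2)⁻¹) :=
        setLIntegral_mono' measurableSet_Icc hmain
    _ ≤ ofReal (2 ^ (k + 2) * (s ^ k)⁻¹) * ofReal (1 / (R * s)) := by
        rw [lcR _ _]; gcongr; exact one_d hs0 hR0
    _ ≤ _ := by
        rw [← ofReal_mul (by positivity)]
        apply ofReal_le_ofReal
        have e : dist z p ^ (-(((k + 2 : ℕ) : ℝ) - 1)) = (dist z p ^ (k + 1))⁻¹ := by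
          rw [Real.rpow_neg hd.le, ← Real.rpow_natCast]; congr 2; push_cast; ring
        rw [e, hs]
        have e2 : 2 ^ (k + 2) * ((dist z p / 3) ^ k)⁻¹ * (1 / (R * (dist z p / 3))) =
          2 ^ (k + 2) * 3 ^ (k + 1) / R * (dist z p ^ (k + 1))⁻¹ := by
          rw [div_pow]; field_simp; ring
        rw [e2, show (6 : ℝ) = 2 * 3 by norm_num, mul_pow]
        gcongr <;> norm_num

lemma JJ_tri (p q : Euc n) {τ R : ℝ} (hτ : 0 < τ) (hR : τ ≤ R) {g h : Euc n → Euc n}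
    (hg : Measurable g) (hh : Measurable h) :
    JJ p q τ R g ≤ JJ p q τ R h + JJ p q τ R (fun x => g x - h x) := by
  rw [JJ_eq p q hτ hR hg, JJ_eq p q hτ hR hh, JJ_eq p q hτ hR (g := fun x => g x - h x) (hg.sub hh)]
  have hk : Measurable (kk p q τ R) := by
    unfold kk
    refine Measurable.lintegral_prod_right' (f := fun z : Euc n × ℝ => ofReal (((τ + z.2 * (R - τ)) ^ n)⁻¹) *
      (ball (p + z.2 • (q - p)) (τ + z.2 * (R - τ))).indicator (1 : Euc n → ℝ≥0∞) z.1) ?_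
    refine Measurable.mul (by fun_prop) ?_
    have hS : MeasurableSet {x : Euc n × ℝ | dist x.1 (p + x.2 • (q - p)) < τ + x.2 * (R - τ)} :=
      measurableSet_lt (by fun_prop) (by fun_prop)
    exact ((measurable_one : Measurable (1 : Euc n × ℝ → ℝ≥0∞)).indicator hS)
  rw [← lintegral_add_left (f := fun z => ‖h z‖ₑ * kk p q τ R z) (hh.enorm.mul hk)]
  refine lintegral_mono fun z => ?_
  rw [← add_mul]
  gcongr
  calc ‖g z‖ₑ = ‖h z + (g z - h z)‖ₑ := by rw [add_sub_cancel]
    _ ≤ _ := enorm_add_le _ _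

lemma T1 (D : Dat n d C₀ Γ x0 r u V) (p q : Euc n) {τ R : ℝ}
    (hτ : 0 < τ) (hR : τ ≤ R) (hq : dist q p ≤ 2 * R) (hD : closedBall p (3 * R) ⊆ ball x0 (3.8 * r)) :
    ofReal (volume.real (ball (0 : Euc n) 1)) *
      ‖(⨍ z in ball q R, u z) - ⨍ z in ball p τ, u z‖ₑ ≤
      ofReal (3 * 6 ^ n) * ∫⁻ z in ball p (3 * R), ‖V z‖ₑ * ofReal (dist z p ^ (-((n : ℝ) - 1))) := by
  have hR0 : 0 < R := hτ.trans_le hR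
  have hu : LocallyIntegrable u := D.ui.locallyIntegrable
  set c := volume.real (ball (0 : Euc n) 1) with hc
  have hcd : ∀ k, ContDiff ℝ 1 (mol k u) := fun k => (mol_contDiff hu k).of_le (by exact_mod_cast le_top)
  have hK := mol_conv isOpen_ball (isCompact_closedBall p (3 * R)) hD hu D.VL (E1 D).1
  have hav : ∀ (a : Euc n) (ρ : ℝ), 0 < ρ → Tendsto (fun k => ⨍ z in ball a ρ, mol k u z) atTop
      (𝓝 (⨍ z in ball a ρ, u z)) := by
    intro a ρ hρ
    have h1 := mol_Lp (p := 1) le_rfl (by simp) (memLp_one_iff_integrable.2 D.ui) hu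
    have h2 : Tendsto (fun k => ∫ z in ball a ρ, mol k u z) atTop (𝓝 (∫ z in ball a ρ, u z)) := by
      refine tendsto_integral_of_L1 (μ := volume.restrict (ball a ρ)) (F := fun k => mol k u) u
        D.um.aestronglyMeasurable
        (Eventually.of_forall fun k => ?_) ?_
      · exact ((hcd k).continuous.continuousOn.integrableOn_compact
          (isCompact_closedBall a ρ)).mono_set ball_subset_closedBall
      · refine tendsto_of_tendsto_of_tendsto_of_le_of_le tendsto_const_nhds h1 (fun _ => zero_le) fun k => ?_
        rw [eLpNorm_one_eq_lintegral_enorm]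
        exact setLIntegral_le_lintegral _ _
    simp_rw [setAverage_eq]
    exact h2.const_smul _
  have hkey : ∀ k, ofReal c * ‖(⨍ z in ball q R, mol k u z) - ⨍ z in ball p τ, mol k u z‖ₑ ≤
      ofReal (3 * R) * JJ p q τ R V + ofReal (3 * R) *
        JJ p q τ R (fun x => gradient (mol k u) x - V x) := by
    intro k
    have h1 := T_smooth (hcd k) p q hτ hR
    have hm := (hcd k).continuous.measurable
    rw [cov_i hm q hR0, cov_i hm p hτ, ← mul_sub, enorm_mul, Real.enorm_of_nonneg (by positivity)] at h1
    refine h1.trans ?_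
    rw [← mul_add]
    gcongr
    · linarith
    · exact JJ_tri p q hτ hR (meas_grad _) D.Vm
  have hJ0 : Tendsto (fun k => JJ p q τ R (fun x => gradient (mol k u) x - V x)) atTop (𝓝 0) := by
    set K := closedBall p (3 * R) with hKd
    have hb : ∀ k, JJ p q τ R (fun x => gradient (mol k u) x - V x) ≤ ofReal ((τ ^ n)⁻¹) *
        ((∫⁻ x in K, ofReal (‖gradient (mol k u) x - V x‖ ^ 2)) ^ (1 / (2 : ℝ)) * volume K ^ (1 / (2 : ℝ))) := by
      intro k
      have hgm : Measurable (fun x => gradient (mol k u) x - V x) := (meas_grad _).sub D.Vm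
      rw [JJ_eq p q hτ hR hgm]
      calc _ ≤ ∫⁻ z in K, ofReal ((τ ^ n)⁻¹) * ‖gradient (mol k u) z - V z‖ₑ := by
            rw [← lintegral_indicator isClosed_closedBall.measurableSet]
            refine lintegral_mono fun z => ?_
            by_cases hz : z ∈ K
            · rw [indicator_of_mem hz, mul_comm]; gcongr; exact kk_b1 hτ hR z
            · simp only
              rw [kk_zero hτ hR hq (fun h => hz (ball_subset_closedBall h))]; simp
        _ ≤ _ := by
            rw [lcR _ _]
            gcongr
            have := ENNReal.lintegral_mul_le_Lp_mul_Lq (volume.restrict K) (p := 2) (q := 2)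
              Real.HolderConjugate.two_two (f := fun z => ‖gradient (mol k u) z - V z‖ₑ) (g := fun _ => 1)
              hgm.enorm.aemeasurable aemeasurable_const
            simp only [Pi.mul_apply, mul_one, ENNReal.one_rpow, lintegral_const, one_mul,
              Measure.restrict_apply_univ] at this
            refine this.trans (le_of_eq ?_)
            congr 3; ext z
            rw [ofReal_pow (norm_nonneg _), ofReal_norm_eq_enorm]; norm_cast
    have hv : volume K ≠ ⊤ := (isCompact_closedBall p (3 * R)).measure_lt_top.ne
    have h3 := ENNReal.Tendsto.const_mul (a := ofReal ((τ ^ n)⁻¹)) (ENNReal.Tendsto.mul_const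
      (b := volume K ^ (1 / (2 : ℝ))) (hK.ennrpow_const (1 / (2 : ℝ)))
      (Or.inr (ENNReal.rpow_ne_top_of_nonneg (by norm_num) hv))) (Or.inr ofReal_ne_top)
    rw [ENNReal.zero_rpow_of_pos (by norm_num), zero_mul, mul_zero] at h3
    exact tendsto_of_tendsto_of_tendsto_of_le_of_le tendsto_const_nhds h3 (fun _ => zero_le) hb
  have hlim1 : Tendsto (fun k => ofReal c * ‖(⨍ z in ball q R, mol k u z) - ⨍ z in ball p τ, mol k u z‖ₑ)
      atTop (𝓝 (ofReal c * ‖(⨍ z in ball q R, u z) - ⨍ z in ball p τ, u z‖ₑ)) :=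
    ENNReal.Tendsto.const_mul (((hav q R hR0).sub (hav p τ hτ)).enorm) (Or.inr ofReal_ne_top)
  have hlim2 := (tendsto_const_nhds (x := ofReal (3 * R) * JJ p q τ R V)).add
    (ENNReal.Tendsto.const_mul (a := ofReal (3 * R)) hJ0 (Or.inr ofReal_ne_top))
  have hfin := le_of_tendsto_of_tendsto' hlim1 hlim2 hkey
  rw [mul_zero, add_zero] at hfin
  refine hfin.trans ?_
  rw [JJ_eq p q hτ hR D.Vm]
  calc _ ≤ ofReal (3 * R) * ∫⁻ z in ball p (3 * R), ofReal (6 ^ n / R) *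
        (‖V z‖ₑ * ofReal (dist z p ^ (-((n : ℝ) - 1)))) := by
        refine mul_le_mul_right ?_ _
        rw [← lintegral_indicator measurableSet_ball]
        refine lintegral_mono_ae ?_
        have hne : ∀ᵐ z : Euc n, z ≠ p := by
          haveI : Nonempty (Fin n) := ⟨⟨0, by have := D.G.hn; omega⟩⟩
          exact Measure.ae_ne volume p
        filter_upwards [hne] with z hzp
        by_cases hz : z ∈ ball p (3 * R)
        · rw [indicator_of_mem hz]
          have := kk_b2 D.G.hn hτ hR hq hzp
          rw [ofReal_mul (by positivity)] at this
          calc _ ≤ ‖V z‖ₑ * (ofReal (6 ^ n / R) * ofReal (dist z p ^ (-((n : ℝ) - 1)))) := by gcongr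
            _ = _ := by ring
        · rw [kk_zero hτ hR hq hz]; simp
    _ = _ := by
        rw [lcR _ _, ← mul_assoc, ← ofReal_mul (by positivity)]
        congr 2; field_simp

lemma T2 (n : ℕ) (hn : 2 ≤ n) : ∃ C : ℝ, 0 < C ∧ ∀ {d C₀ : ℝ} {Γ : Set (Euc n)} {x0 : Euc n} {r : ℝ} {u : Euc n → ℝ}
    {V : Euc n → Euc n} (D : Dat n d C₀ Γ x0 r u V) (p q : Euc n) (R L : ℝ)
    (hR : 0 < R) (hq : dist q p ≤ 2 * R) (hD : closedBall p (3 * R) ⊆ ball x0 (3.8 * r))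
    (hL : HasTraceAt u p L),
    ‖(⨍ z in ball q R, u z) - L‖ₑ ^ 2 ≤ 
      ofReal (C * R) * ∫⁻ z in ball p (3 * R), ‖V z‖ₑ ^ 2 * ofReal (dist z p ^ (-((n : ℝ) - 1))) := by
  obtain ⟨Ck, hCk, hkv⟩ := kern_vol n hn
  set c := volume.real (ball (0 : Euc n) 1) with hc
  have hc0 : 0 < c := ENNReal.toReal_pos
    (measure_ball_pos _ _ one_pos).ne' measure_ball_lt_top.ne
  refine ⟨(c⁻¹ * (3 * 6 ^ n)) ^ 2 * (Ck * 3), by positivity, ?_⟩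
  intro d C₀ Γ x0 r u V D p q R L hR hq hD hL
  set X := ∫⁻ z in ball p (3 * R), ‖V z‖ₑ * ofReal (dist z p ^ (-((n : ℝ) - 1))) with hX
  have h1 : ‖(⨍ z in ball q R, u z) - L‖ₑ ≤ ofReal (c⁻¹ * (3 * 6 ^ n)) * X := by
    have ht : Tendsto (fun τ : ℝ => ‖(⨍ z in ball q R, u z) - ⨍ z in ball p τ, u z‖ₑ) (𝓝[>] 0)
      (𝓝 ‖(⨍ z in ball q R, u z) - L‖ₑ) := (tendsto_const_nhds.sub hL).enorm
    refine le_of_tendsto ht ?_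
    filter_upwards [Ioo_mem_nhdsGT hR] with τ hτ
    have h2 := T1 D p q hτ.1 hτ.2.le hq hD
    calc _ = ofReal c⁻¹ * (ofReal c * ‖(⨍ z in ball q R, u z) - ⨍ z in ball p τ, u z‖ₑ) := by
          rw [← mul_assoc, ← ofReal_mul (by positivity), inv_mul_cancel₀ hc0.ne']; simp
      _ ≤ ofReal c⁻¹ * (ofReal (3 * 6 ^ n) * X) := by gcongr
      _ = _ := by rw [← mul_assoc, ← ofReal_mul (by positivity)]
  have hkm : Measurable (fun z : Euc n => ofReal (dist z p ^ (-((n : ℝ) - 1)))) := by fun_prop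
  have h3 : X ^ 2 ≤ ofReal (Ck * (3 * R)) *
      ∫⁻ z in ball p (3 * R), ‖V z‖ₑ ^ 2 * ofReal (dist z p ^ (-((n : ℝ) - 1))) := by
    have hcs := ENNReal.lintegral_mul_le_Lp_mul_Lq (volume.restrict (ball p (3 * R))) (p := 2) (q := 2)
      Real.HolderConjugate.two_two
      (f := fun z => ofReal (dist z p ^ (-((n : ℝ) - 1))) ^ (1 / (2 : ℝ)))
      (g := fun z => ‖V z‖ₑ * ofReal (dist z p ^ (-((n : ℝ) - 1))) ^ (1 / (2 : ℝ)))
      (hkm.pow_const _).aemeasurable (D.Vm.enorm.mul (hkm.pow_const _)).aemeasurable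
    have e1 : ∀ a : ℝ≥0∞, a ^ (1 / (2 : ℝ)) * a ^ (1 / (2 : ℝ)) = a := fun a => by
      rw [← ENNReal.rpow_add_of_nonneg _ _ (by norm_num) (by norm_num)]; norm_num
    have e2 : ∀ a : ℝ≥0∞, (a ^ (1 / (2 : ℝ))) ^ (2 : ℝ) = a := fun a => by
      rw [← ENNReal.rpow_mul]; norm_num
    have e3 : X = ∫⁻ z in ball p (3 * R), ((fun z => ofReal (dist z p ^ (-((n : ℝ) - 1))) ^ (1 / (2 : ℝ))) *
        fun z => ‖V z‖ₑ * ofReal (dist z p ^ (-((n : ℝ) - 1))) ^ (1 / (2 : ℝ))) z := by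
      rw [hX]; congr 1; ext z
      simp only [Pi.mul_apply]
      rw [mul_left_comm, e1]
    rw [← e3] at hcs
    simp only [e2, ENNReal.mul_rpow_of_nonneg _ _ (show (0 : ℝ) ≤ 2 by norm_num)] at hcs
    calc X ^ 2 ≤ _ := pow_le_pow_left' hcs 2
      _ = (∫⁻ z in ball p (3 * R), ofReal (dist z p ^ (-((n : ℝ) - 1)))) *
          ∫⁻ z in ball p (3 * R), ‖V z‖ₑ ^ 2 * ofReal (dist z p ^ (-((n : ℝ) - 1))) := by
          rw [mul_pow, ← ENNReal.rpow_natCast, ← ENNReal.rpow_natCast]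
          push_cast
          rw [e2, e2]
          norm_cast
      _ ≤ _ := by gcongr; exact hkv p (3 * R) (by positivity)
  calc _ ≤ (ofReal (c⁻¹ * (3 * 6 ^ n)) * X) ^ 2 := pow_le_pow_left' h1 2
    _ = ofReal ((c⁻¹ * (3 * 6 ^ n)) ^ 2) * X ^ 2 := by
        rw [mul_pow, ofReal_pow (by positivity)]
    _ ≤ _ := by
        refine (mul_le_mul_right h3 _).trans ?_
        rw [← mul_assoc, ← ofReal_mul (by positivity)]
        apply le_of_eq; congr 2; ring

lemma leb_pt (hu : LocallyIntegrable u) : ∀ᵐ x, HasTraceAt u x (u x) := by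
  filter_upwards [IsUnifLocDoublingMeasure.ae_tendsto_average (μ := (volume : Measure (Euc n))) hu 1] with x hx
  have h := hx (l := 𝓝[>] (0 : ℝ)) (fun _ => x) (fun ρ => ρ) tendsto_id (by
    filter_upwards [self_mem_nhdsWithin] with ρ hρ
    exact mem_closedBall_self (by simpa using (le_of_lt hρ)))
  unfold HasTraceAt
  refine h.congr' ?_
  filter_upwards [self_mem_nhdsWithin] with ρ hρ
  refine setAverage_congr ?_
  exact (ae_eq_of_subset_of_measure_ge ball_subset_closedBall (by
    rw [Measure.addHaar_closedBall _ _ (le_of_lt hρ), Measure.addHaar_ball_of_pos _ _ hρ]) measurableSet_ball.nullMeasurableSet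
    measure_closedBall_lt_top.ne).symm

lemma swapS {Γ S : Set (Euc n)} (hS : MeasurableSet S) {ε ρ : ℝ} (hSε : ∀ x ∈ S, infDist x Γ ≤ ε)
    {f : Euc n → ℝ≥0∞} (hf : Measurable f) {k : Euc n → Euc n → ℝ≥0∞}
    (hk : Measurable (Function.uncurry k)) {B : ℝ≥0∞} (hB : ∀ z, ∫⁻ x in ball z ρ, k z x ≤ B) :
    ∫⁻ x in S, (∫⁻ z in ball x ρ, f z * k z x) ≤ B * ∫⁻ z in {z | infDist z Γ < ε + ρ}, f z := by
  have hT : MeasurableSet {z | infDist z Γ < ε + ρ} := measurableSet_lt measurable_infDist measurable_const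
  have hP : MeasurableSet {p : Euc n × Euc n | dist p.2 p.1 < ρ} := measurableSet_lt (by fun_prop) (by fun_prop)
  have hi : Measurable (fun p : Euc n × Euc n => {p : Euc n × Euc n | dist p.2 p.1 < ρ}.indicator
      (fun p => f p.2 * k p.2 p.1) p) := by
    refine Measurable.indicator ?_ hP
    exact (hf.comp measurable_snd).mul (hk.comp (measurable_snd.prodMk measurable_fst))
  have h1 : ∀ x, ∫⁻ z in ball x ρ, f z * k z x = ∫⁻ z, {p : Euc n × Euc n | dist p.2 p.1 < ρ}.indicator
      (fun p => f p.2 * k p.2 p.1) (x, z) := fun x => by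
    rw [← lintegral_indicator measurableSet_ball]; rfl
  simp_rw [h1]
  rw [lintegral_lintegral_swap (μ := volume.restrict S) hi.aemeasurable, ← lintegral_indicator hT]
  rw [← lintegral_const_mul _ (hf.indicator hT)]
  refine lintegral_mono fun z => ?_
  by_cases hz : infDist z Γ < ε + ρ
  · rw [indicator_of_mem (show z ∈ {z | infDist z Γ < ε + ρ} from hz)]
    calc _ ≤ ∫⁻ x, {p : Euc n × Euc n | dist p.2 p.1 < ρ}.indicator
          (fun p => f p.2 * k p.2 p.1) (x, z) := setLIntegral_le_lintegral _ _
      _ = ∫⁻ x in ball z ρ, f z * k z x := by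
          rw [← lintegral_indicator measurableSet_ball]
          refine lintegral_congr fun x => ?_
          simp only [indicator, mem_setOf_eq, mem_ball, dist_comm z x]
      _ = f z * ∫⁻ x in ball z ρ, k z x := by
          rw [lintegral_const_mul]; exact hk.comp (measurable_const.prodMk measurable_id)
      _ ≤ _ := by rw [mul_comm]; gcongr; exact hB z
  · have : ∫⁻ x in S, {p : Euc n × Euc n | dist p.2 p.1 < ρ}.indicator
          (fun p => f p.2 * k p.2 p.1) (x, z) = 0 := by
      rw [setLIntegral_congr_fun hS (g := fun _ => 0)]
      · simp
      · intro x hx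
        apply indicator_of_notMem
        simp only [mem_setOf_eq, not_lt]
        push Not at hz
        have := infDist_le_infDist_add_dist (s := Γ) (x := z) (y := x)
        linarith [hSε x hx]
    rw [this]; exact zero_le

lemma E3b (n : ℕ) (d C₀ : ℝ) (hn : 2 ≤ n) (hC : 1 ≤ C₀) (hdn : d < (n : ℝ) - 1) : ∃ C : ℝ, 0 < C ∧
    ∀ {Γ : Set (Euc n)} {x0 : Euc n} {r : ℝ} {u : Euc n → ℝ} {V : Euc n → Euc n} (D : Dat n d C₀ Γ x0 r u V)
    (ht : ∀ᵐ y ∂(sg n d Γ), y ∈ ball x0 (3.8 * r) → HasTraceAt u y 1) (x : Euc n) (ε : ℝ) (hε : 0 < ε)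
    (hεr : ε ≤ 0.005 * r) (hx : x ∈ ball x0 (3.75 * r)) (hδ : infDist x Γ ≤ ε) (hxΓ : x ∉ Γ),
    ‖(⨍ z in ball x ε, u z) - 1‖ₑ ^ 2 ≤ ofReal (C * ε ^ (1 - d)) *
      ∫⁻ z in ball x (5 * ε), ofReal (‖V z‖ ^ 2 * weightW n d Γ z) := by
  obtain ⟨C2, hC2, T⟩ := T2 n hn
  obtain ⟨C3, hC3, K⟩ := kern_up n d C₀ (n - 1) hdn
  refine ⟨C₀ * C2 * C3, by positivity, ?_⟩
  intro Γ x0 r u V D ht x ε hε hεr hx hδ hxΓ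
  haveI := D.G.lf
  set a := ‖(⨍ z in ball x ε, u z) - 1‖ₑ ^ 2 with ha
  have hr := D.hr
  have hmass : ofReal (C₀⁻¹ * ε ^ d) ≤ sg n d Γ (ball x (2 * ε)) := by
    obtain ⟨y0, hy0, hy1⟩ := D.G.cl.exists_infDist_eq_dist D.G.ne x
    refine ((D.G.ar y0 hy0 ε hε).1).trans ?_
    unfold sg
    rw [Measure.restrict_apply measurableSet_ball, inter_comm]
    refine measure_mono (inter_subset_inter_left _ ?_)
    refine ball_subset_ball' ?_
    rw [dist_comm, ← hy1]; linarith
  have hkm : Measurable (Function.uncurry fun (z y : Euc n) => ofReal (dist z y ^ (-((n : ℝ) - 1)))) := by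
    refine Measurable.ennreal_ofReal ?_
    exact (measurable_dist).pow_const _
  have h1 : ofReal (C₀⁻¹ * ε ^ d) * a ≤ ofReal (C2 * ε) * (ofReal C3 *
      ∫⁻ z in ball x (5 * ε), ofReal (‖V z‖ ^ 2 * weightW n d Γ z)) := by
    calc _ ≤ sg n d Γ (ball x (2 * ε)) * a := by gcongr
      _ = ∫⁻ y in ball x (2 * ε), a ∂(sg n d Γ) := by rw [setLIntegral_const, mul_comm]
      _ ≤ ∫⁻ y in ball x (2 * ε), ofReal (C2 * ε) * (∫⁻ z in ball x (5 * ε),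
          ‖V z‖ₑ ^ 2 * ofReal (dist z y ^ (-((n : ℝ) - 1)))) ∂(sg n d Γ) := by
          refine lintegral_mono_ae ?_
          filter_upwards [ae_restrict_of_ae ht, ae_restrict_mem measurableSet_ball] with y hy hyb
          rw [mem_ball] at hyb hx
          have hyD : y ∈ ball x0 (3.8 * r) := by
            rw [mem_ball]; have := dist_triangle y x x0; linarith
          refine (T D y x ε 1 hε (by rw [dist_comm]; exact hyb.le) ?_ (hy hyD)).trans ?_
          · intro z hz
            rw [mem_closedBall] at hz
            rw [mem_ball]
            have := dist_triangle z y x0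
            have := dist_triangle y x x0
            linarith
          · gcongr ofReal (C2 * ε) * ?_
            refine lintegral_mono_set (ball_subset_ball' ?_)
            linarith
      _ ≤ ofReal (C2 * ε) * ∫⁻ y, (∫⁻ z in ball x (5 * ε),
          ‖V z‖ₑ ^ 2 * ofReal (dist z y ^ (-((n : ℝ) - 1)))) ∂(sg n d Γ) := by
          rw [lcR _ _]
          gcongr ofReal (C2 * ε) * ?_
          exact setLIntegral_le_lintegral _ _
      _ ≤ _ := by
          gcongr ofReal (C2 * ε) * ?_
          rw [lintegral_lintegral_swap]
          · rw [← lcR _ _]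
            refine lintegral_mono_ae ?_
            filter_upwards [ae_restrict_of_ae D.G.ae_notMem] with z hz
            rw [lintegral_const_mul' _ _ (by simp)]
            have hk := K Γ D.G z hz
            simp_rw [dist_comm z]
            calc _ ≤ ‖V z‖ₑ ^ 2 * ofReal (C3 * infDist z Γ ^ (d - (n - 1))) := by gcongr
              _ = _ := by
                  rw [ofReal_mul (by positivity), ofReal_mul (by positivity),
                    ofReal_pow (norm_nonneg _), ofReal_norm_eq_enorm]
                  unfold weightW
                  rw [show d - ((n : ℝ) - 1) = d + 1 - n by ring]; ring
          · refine Measurable.aemeasurable ?_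
            have hV := D.Vm
            have m1 : Measurable (fun p : Euc n × Euc n => ‖V p.2‖ₑ ^ 2) := by fun_prop
            have m2 : Measurable (fun p : Euc n × Euc n => ofReal (dist p.2 p.1 ^ (-((n : ℝ) - 1)))) := by fun_prop
            exact m1.mul m2
  calc a = ofReal (C₀ * ε ^ (-d)) * (ofReal (C₀⁻¹ * ε ^ d) * a) := by
        rw [← mul_assoc, ← ofReal_mul (by positivity)]
        rw [show C₀ * ε ^ (-d) * (C₀⁻¹ * ε ^ d) = 1 by rw [Real.rpow_neg hε.le]; field_simp]
        simp
    _ ≤ _ := mul_le_mul_right h1 _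
    _ = _ := by
        rw [← mul_assoc, ← mul_assoc, ← ofReal_mul (by positivity), ← ofReal_mul (by positivity)]
        congr 2
        rw [show 1 - d = -d + 1 by ring, Real.rpow_add hε, Real.rpow_one]; ring

lemma E3q (n : ℕ) (d C₀ κ : ℝ) (hn : 2 ≤ n) (hC : 1 ≤ C₀) (hdn : d < (n : ℝ) - 1) (hκ : 0 < κ) : ∃ C : ℝ, 0 < C ∧
    ∀ {Γ : Set (Euc n)} {x0 : Euc n} {r : ℝ} {u : Euc n → ℝ} {V : Euc n → Euc n} (D : Dat n d C₀ Γ x0 r u V)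
    (ht : ∀ᵐ y ∂(sg n d Γ), y ∈ ball x0 (3.8 * r) → HasTraceAt u y 1) (ε : ℝ) (hε : 0 < ε)
    (hεr : ε ≤ 0.005 * r),
    ∫⁻ x in ball x0 (3.75 * r) ∩ {x | κ * ε ≤ infDist x Γ ∧ infDist x Γ ≤ ε},
      ofReal ((1 - u x) ^ 2 * weightW n d Γ x) ≤
    ofReal (C * ε ^ 2) * ∫⁻ z in {z | infDist z Γ < 6 * ε}, ofReal (‖V z‖ ^ 2 * weightW n d Γ z) := by
  obtain ⟨C2, hC2, T⟩ := T2 n hn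
  obtain ⟨Ck, hCk, K⟩ := kern_vol n hn
  obtain ⟨Cb, hCb, B⟩ := E3b n d C₀ hn hC hdn
  obtain ⟨Cv, hCv, Hv⟩ := vol_ball_le n
  refine ⟨κ ^ (d + 1 - (n : ℝ)) * (2 * (3 * C2 * Ck * 6 ^ ((n : ℝ) - 1 - d)) + 2 * (Cb * Cv * 5 ^ (n : ℝ))), by positivity, ?_⟩
  intro Γ x0 r u V D ht ε hε hεr
  have hr := D.hr
  set S := ball x0 (3.75 * r) ∩ {x | κ * ε ≤ infDist x Γ ∧ infDist x Γ ≤ ε} with hSd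
  have hSm : MeasurableSet S := measurableSet_ball.inter
    ((measurableSet_le measurable_const measurable_infDist).inter
      (measurableSet_le measurable_infDist measurable_const))
  have hSε : ∀ x ∈ S, infDist x Γ ≤ ε := fun x hx => hx.2.2
  set I := ∫⁻ z in {z | infDist z Γ < 6 * ε}, ofReal (‖V z‖ ^ 2 * weightW n d Γ z) with hI
  have hkm : Measurable (Function.uncurry fun (z y : Euc n) => ofReal (dist z y ^ (-((n : ℝ) - 1)))) := by
    refine Measurable.ennreal_ofReal ?_
    exact (measurable_dist).pow_const _
  have hA := swapS (Γ := Γ) hSm (ρ := 3 * ε) hSε (f := fun z => ‖V z‖ₑ ^ 2) (D.Vm.enorm.pow_const _)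
    hkm (B := ofReal (Ck * (3 * ε))) (fun z => by
      simp_rw [dist_comm z]; exact K z _ (by positivity))
  have hB := swapS (Γ := Γ) hSm (ρ := 5 * ε) hSε (f := fun z => ofReal (‖V z‖ ^ 2 * weightW n d Γ z))
    (meas_EN D.Vm) (k := fun _ _ => 1) measurable_const (B := ofReal (Cv * (5 * ε) ^ (n : ℝ))) (fun z => by
      simp only [lintegral_const, one_mul, Measure.restrict_apply_univ]
      exact (Hv z _ (by positivity)).le)
  simp only [mul_one] at hB
  have hVI : ∫⁻ z in {z | infDist z Γ < ε + 3 * ε}, ‖V z‖ₑ ^ 2 ≤ ofReal ((6 * ε) ^ ((n : ℝ) - 1 - d)) * I := by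
    calc _ ≤ ∫⁻ z in {z | infDist z Γ < 6 * ε}, ‖V z‖ₑ ^ 2 := by
          refine lintegral_mono_set fun z hz => ?_
          simp only [mem_setOf_eq] at *; linarith
      _ ≤ _ := by
          rw [hI, ← lcR _ _]
          refine lintegral_mono_ae ?_
          filter_upwards [ae_restrict_of_ae D.G.ae_notMem,
            ae_restrict_mem (measurableSet_lt measurable_infDist measurable_const)] with z hz hz2
          rw [← ofReal_mul (by positivity), ← ofReal_norm_eq_enorm, ← ofReal_pow (norm_nonneg _)]
          apply ofReal_le_ofReal
          have hp := D.G.pos hz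
          unfold weightW
          have : 1 ≤ (6 * ε) ^ ((n : ℝ) - 1 - d) * infDist z Γ ^ (d + 1 - (n : ℝ)) := by
            rw [show d + 1 - (n : ℝ) = -((n : ℝ) - 1 - d) by ring, Real.rpow_neg hp.le, ← div_eq_mul_inv,
              one_le_div (by positivity)]
            exact Real.rpow_le_rpow hp.le hz2.le (by linarith)
          nlinarith [sq_nonneg ‖V z‖]
  have h5 : ({z | infDist z Γ < ε + 5 * ε} : Set (Euc n)) = {z | infDist z Γ < 6 * ε} := by
    ext z; simp only [mem_setOf_eq]; rw [show ε + 5 * ε = 6 * ε by ring]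
  rw [h5] at hB
  have hpt : ∀ᵐ x ∂(volume.restrict S), ofReal ((1 - u x) ^ 2 * weightW n d Γ x) ≤
      ofReal ((κ * ε) ^ (d + 1 - (n : ℝ))) * 
      (ofReal (2 * (C2 * ε)) * (∫⁻ z in ball x (3 * ε), ‖V z‖ₑ ^ 2 * ofReal (dist z x ^ (-((n : ℝ) - 1)))) +
      ofReal (2 * (Cb * ε ^ (1 - d))) * ∫⁻ z in ball x (5 * ε), ofReal (‖V z‖ ^ 2 * weightW n d Γ z)) := by
    filter_upwards [ae_restrict_of_ae D.G.ae_notMem, ae_restrict_mem hSm,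
      ae_restrict_of_ae (leb_pt D.ui.locallyIntegrable)] with x hx hxS hL
    have hb := B D ht x ε hε hεr hxS.1 hxS.2.2 hx
    have ha := T D x x ε (u x) hε (by rw [dist_self]; positivity) (by
      intro z hz
      rw [mem_closedBall] at hz
      have h2 := hxS.1
      rw [mem_ball] at h2 ⊢
      have := dist_triangle z x x0
      linarith) hL
    set a := ⨍ z in ball x ε, u z
    have hw : weightW n d Γ x ≤ (κ * ε) ^ (d + 1 - (n : ℝ)) :=
      Real.rpow_le_rpow_of_nonpos (by positivity) hxS.2.1 (by linarith)
    calc ofReal ((1 - u x) ^ 2 * weightW n d Γ x) ≤ 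
          ofReal ((κ * ε) ^ (d + 1 - (n : ℝ)) * (2 * ‖a - u x‖ ^ 2 + 2 * ‖a - 1‖ ^ 2)) := by
          apply ofReal_le_ofReal
          rw [mul_comm]
          refine mul_le_mul hw ?_ (by positivity) (by positivity)
          rw [Real.norm_eq_abs, Real.norm_eq_abs, sq_abs, sq_abs]
          nlinarith [sq_nonneg (2 * a - u x - 1)]
      _ = ofReal ((κ * ε) ^ (d + 1 - (n : ℝ))) * (ofReal 2 * ‖a - u x‖ₑ ^ 2 + ofReal 2 * ‖a - 1‖ₑ ^ 2) := by
          rw [ofReal_mul (by positivity), ofReal_add (by positivity) (by positivity),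
            ofReal_mul (by positivity), ofReal_mul (by positivity),
            ofReal_pow (norm_nonneg _), ofReal_pow (norm_nonneg _), ofReal_norm_eq_enorm, ofReal_norm_eq_enorm]
      _ ≤ _ := by
          rw [ofReal_mul (p := 2) (by positivity), ofReal_mul (p := 2) (by positivity), mul_assoc, mul_assoc]
          gcongr ofReal ((κ * ε) ^ (d + 1 - (n : ℝ))) * (ofReal 2 * ?_ + ofReal 2 * ?_)
  have m1 : Measurable (fun x => ∫⁻ z in ball x (3 * ε), ‖V z‖ₑ ^ 2 * ofReal (dist z x ^ (-((n : ℝ) - 1)))) := by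
    have hP : MeasurableSet {p : Euc n × Euc n | dist p.2 p.1 < 3 * ε} := measurableSet_lt (by fun_prop) (by fun_prop)
    have hV := D.Vm
    have hi : Measurable (fun p : Euc n × Euc n => {p : Euc n × Euc n | dist p.2 p.1 < 3 * ε}.indicator
        (fun p => ‖V p.2‖ₑ ^ 2 * ofReal (dist p.2 p.1 ^ (-((n : ℝ) - 1)))) p) := by
      refine Measurable.indicator ?_ hP
      have m1 : Measurable (fun p : Euc n × Euc n => ‖V p.2‖ₑ ^ 2) := by fun_prop
      have m2 : Measurable (fun p : Euc n × Euc n => ofReal (dist p.2 p.1 ^ (-((n : ℝ) - 1)))) := by fun_prop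
      exact m1.mul m2
    have := hi.lintegral_prod_right' (ν := volume)
    convert this using 2 with x
    rw [← lintegral_indicator measurableSet_ball]; rfl
  refine (lintegral_mono_ae hpt).trans ?_
  rw [lcR _ _, lintegral_add_left (m1.const_mul _),
    lcR _ _, lcR _ _]
  calc _ ≤ ofReal ((κ * ε) ^ (d + 1 - (n : ℝ))) * (ofReal (2 * (C2 * ε)) *
        (ofReal (Ck * (3 * ε)) * (ofReal ((6 * ε) ^ ((n : ℝ) - 1 - d)) * I)) +
        ofReal (2 * (Cb * ε ^ (1 - d))) * (ofReal (Cv * (5 * ε) ^ (n : ℝ)) * I)) := by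
        refine mul_le_mul_right (add_le_add (mul_le_mul_right (hA.trans (mul_le_mul_right hVI _)) _)
          (mul_le_mul_right hB _)) _
    _ = _ := by
        simp only [← mul_assoc]
        rw [← ofReal_mul (by positivity), ← ofReal_mul (by positivity), ← ofReal_mul (by positivity),
          ← add_mul, ← ofReal_add (by positivity) (by positivity), ← mul_assoc, ← ofReal_mul (by positivity)]
        congr 2
        rw [Real.mul_rpow hκ.le hε.le, Real.mul_rpow (x := 6) (by norm_num) hε.le, Real.mul_rpow (x := 5) (by norm_num) hε.le]
        have e1 : ε ^ (d + 1 - (n : ℝ)) * ε ^ ((n : ℝ) - 1 - d) = 1 := by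
          rw [← Real.rpow_add hε]; ring_nf; simp
        have e2 : ε ^ (d + 1 - (n : ℝ)) * ε ^ (1 - d) * ε ^ (n : ℝ) = ε ^ 2 := by
          rw [← Real.rpow_add hε, ← Real.rpow_add hε, ← Real.rpow_natCast]; congr 1; push_cast; ring
        linear_combination (6 * κ ^ (d + 1 - (n : ℝ)) * C2 * Ck * 6 ^ ((n : ℝ) - 1 - d) * ε ^ 2) * e1 +
          (2 * κ ^ (d + 1 - (n : ℝ)) * Cb * Cv * 5 ^ (n : ℝ)) * e2

lemma E3 {d C₀ κ : ℝ} (hκ : 0 < κ)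
    {Γ : Set (Euc n)} {x0 : Euc n} {r : ℝ} {u : Euc n → ℝ} {V : Euc n → Euc n} (D : Dat n d C₀ Γ x0 r u V)
    (ht : ∀ᵐ y ∂(sg n d Γ), y ∈ ball x0 (3.8 * r) → HasTraceAt u y 1) {ε : ℕ → ℝ} (hε : ∀ j, 0 < ε j)
    (hεr : ∀ j, ε j ≤ 0.005 * r) (hε0 : Tendsto ε atTop (𝓝 0)) :
    Tendsto (fun j => ofReal ((ε j ^ 2)⁻¹) * ∫⁻ x in ball x0 (3.75 * r) ∩ {x | κ * ε j ≤ infDist x Γ ∧ infDist x Γ ≤ ε j},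
      ofReal ((1 - u x) ^ 2 * weightW n d Γ x)) atTop (𝓝 0) := by
  obtain ⟨C, hC, H⟩ := E3q n d C₀ κ D.G.hn D.G.hC0 D.G.hdn hκ
  have h1 : Tendsto (fun j => EN n d Γ ({z | infDist z Γ < 6 * ε j}.indicator V)) atTop (𝓝 0) := by
    refine EN_dom (h := V) (fun j => D.Vm.indicator (measurableSet_lt measurable_infDist measurable_const)) 
      (fun j x => norm_indicator_le_norm_self _ _) D.VE ?_
    filter_upwards [D.G.ae_notMem] with x hx
    have hp := D.G.pos hx
    refine tendsto_const_nhds.congr' ?_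
    filter_upwards [hε0.eventually (gt_mem_nhds (show 0 < infDist x Γ / 6 by positivity))] with j hj
    rw [indicator_of_notMem]
    simp only [mem_setOf_eq, not_lt]; linarith
  have h2 := ENNReal.Tendsto.const_mul (a := ofReal C) h1 (Or.inr ofReal_ne_top)
  rw [mul_zero] at h2
  refine tendsto_of_tendsto_of_tendsto_of_le_of_le tendsto_const_nhds h2 (fun _ => zero_le) fun j => ?_
  have hj := hε j
  refine (mul_le_mul_right (H D ht (ε j) hj (hεr j)) _).trans ?_
  rw [← mul_assoc, ← ofReal_mul (by positivity), show ((ε j) ^ 2)⁻¹ * (C * ε j ^ 2) = C by field_simp]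
  refine mul_le_mul_right (le_of_eq ?_) _
  unfold EN
  rw [← lintegral_indicator (measurableSet_lt measurable_infDist measurable_const)]
  refine lintegral_congr fun z => ?_
  by_cases hz : z ∈ {z | infDist z Γ < 6 * ε j}
  · rw [indicator_of_mem hz, indicator_of_mem hz]
  · rw [indicator_of_notMem hz, indicator_of_notMem hz]; simp

structure NiceZ (Q Q1 : ℝ → ℝ) (M : ℝ) : Prop extends Nice Q Q1 M where
  Q0 : ∀ s, 0 ≤ s → 0 ≤ Q s
  Qz : ∀ s, 1 ≤ s → Q s = 0

lemma NiceZ.lip (N : NiceZ Q Q1 M) {s : ℝ} (hs : 0 ≤ s) : |Q s| ≤ M * |1 - s| := by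
  by_cases h : 1 ≤ s
  · rw [N.Qz s h, abs_zero]
    exact mul_nonneg ((abs_nonneg _).trans (N.hQ 0 le_rfl)) (abs_nonneg _)
  · have := (convex_Ici (0 : ℝ)).norm_image_sub_le_of_norm_hasDerivWithin_le (f := Q) (f' := Q1) (C := M)
      (fun x hx => (N.hd x hx).hasDerivWithinAt) (fun x hx => N.hQ1 x hx) (x := 1) (y := s) (mem_Ici.2 zero_le_one) (mem_Ici.2 hs)
    rw [N.Qz 1 le_rfl, sub_zero, Real.norm_eq_abs, Real.norm_eq_abs, abs_sub_comm s] at this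
    exact this

def ClosedP {n : ℕ} (d : ℝ) (Γ : Set (Euc n)) (P : (Euc n → ℝ) → (Euc n → Euc n) → Prop) : Prop :=
  ∀ (F : Euc n → ℝ) (g : Euc n → Euc n) (Fj : ℕ → Euc n → ℝ) (gj : ℕ → Euc n → Euc n),
    Measurable F → Measurable g → (∀ j, Measurable (Fj j)) → (∀ j, Measurable (gj j)) →
    (∀ j, P (Fj j) (gj j)) → (∀ᵐ x, Tendsto (fun j => Fj j x) atTop (𝓝 (F x))) →
    Tendsto (fun j => EN n d Γ (fun x => gj j x - g x)) atTop (𝓝 0) → P F g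

lemma m_ball (n : ℕ) (d C₀ : ℝ) (hC : 1 ≤ C₀) (hn : 2 ≤ n) : ∃ C : ℝ, 0 < C ∧
    ∀ Γ, Geo n d C₀ Γ → ∀ x0 ∈ Γ, ∀ ρ : ℝ, 0 < ρ →
      ∫⁻ x in ball x0 ρ, ofReal (weightW n d Γ x) ≤ ofReal (C * ρ ^ (d + 1)) := by
  obtain ⟨C, hC, H⟩ := m_strip n d C₀ hC hn
  refine ⟨C, hC, fun Γ G x0 hx0 ρ hρ => ?_⟩
  have := H Γ G x0 hx0 ρ ρ hρ le_rfl
  rw [inter_eq_left.2, measW, withDensity_apply _ measurableSet_ball] at this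
  · rwa [Real.rpow_add hρ, Real.rpow_one, ← mul_assoc]
  · intro x hx
    exact (infDist_le_dist_of_mem hx0).trans_lt hx

lemma EN_gfin (D : Dat n d C₀ Γ x0 r u V) {Q Q1 : ℝ → ℝ} {M : ℝ} (N : Nice Q Q1 M)
    {φ : Euc n → ℝ} (hφ : ContDiff ℝ 1 φ) (hφc : HasCompactSupport φ)
    (hφD : tsupport φ ⊆ ball x0 (3.75 * r)) :
    Measurable (fun x => Q (u x) • gradient φ x + (φ x * Q1 (u x)) • V x) ∧
    EN n d Γ (fun x => Q (u x) • gradient φ x + (φ x * Q1 (u x)) • V x) < ⊤ := by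
  obtain ⟨mQ, mQ1⟩ := N.mQ D.u0 D.um
  have mφ := hφ.continuous.measurable
  have hr := D.hr
  have hM : 0 ≤ M := (abs_nonneg _).trans (N.hQ 0 le_rfl)
  obtain ⟨B, hB⟩ := hφ.continuous.bounded_above_of_compact_support hφc
  obtain ⟨B', hB'⟩ := (continuous_grad hφ).bounded_above_of_compact_support (hcs_grad hφc)
  have hB0 : 0 ≤ B := (norm_nonneg _).trans (hB x0)
  have m2 : Measurable (fun x => (φ x * Q1 (u x)) • V x) := (mφ.mul mQ1).smul D.Vm
  have m1 : Measurable (fun x => Q (u x) • gradient φ x) := mQ.smul (meas_grad φ)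
  refine ⟨m1.add m2, (EN_add m2).trans_lt ?_⟩
  have h1 : EN n d Γ (fun x => Q (u x) • gradient φ x) < ⊤ := by
    obtain ⟨C, hC, H⟩ := m_ball n d C₀ D.G.hC0 D.G.hn
    have hm := H Γ D.G x0 D.hx0 (3.75 * r) (by positivity)
    calc _ ≤ ∫⁻ x in ball x0 (3.75 * r), ofReal ((M * B') ^ 2) * ofReal (weightW n d Γ x) := by
          unfold EN
          rw [← lintegral_indicator measurableSet_ball]
          refine lintegral_mono fun x => ?_
          by_cases hx : x ∈ ball x0 (3.75 * r)
          · rw [indicator_of_mem hx, ← ofReal_mul (by positivity)]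
            apply ofReal_le_ofReal
            refine mul_le_mul_of_nonneg_right ?_ (w_nonneg x)
            rw [norm_smul]
            gcongr
            · exact N.hQ _ (D.u0 x)
            · exact hB' x
          · simp only
            rw [indicator_of_notMem hx, gz0 (fun h => hx (hφD h))]; simp
      _ < ⊤ := by
          rw [lcR _ _]
          exact mul_lt_top ofReal_lt_top (hm.trans_lt ofReal_lt_top)
  have h2 : EN n d Γ (fun x => (φ x * Q1 (u x)) • V x) < ⊤ := by
    refine (EN_mono (c := B * M) (h := V) (by positivity) fun x => ?_).trans_lt
      (mul_lt_top ofReal_lt_top D.VE)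
    rw [norm_smul, norm_mul]
    gcongr
    · exact hB x
    · exact N.hQ1 _ (D.u0 x)
  exact ENNReal.add_lt_top.2 ⟨mul_lt_top (by simp) h1, mul_lt_top (by simp) h2⟩

set_option maxHeartbeats 800000 in
lemma clos_ind (D : Dat n d C₀ Γ x0 r u V)
    (ht : ∀ᵐ y ∂(sg n d Γ), y ∈ ball x0 (3.8 * r) → HasTraceAt u y 1)
    {Q Q1 : ℝ → ℝ} {M : ℝ} (N : NiceZ Q Q1 M)
    {φ : Euc n → ℝ} (hφ : ContDiff ℝ 1 φ) (hφc : HasCompactSupport φ) (hφ0 : ∀ x, 0 ≤ φ x)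
    (hφD : tsupport φ ⊆ ball x0 (3.75 * r))
    {P : (Euc n → ℝ) → (Euc n → Euc n) → Prop} (hP : ClosedP d Γ P)
    (hb : ∀ F : Euc n → ℝ, ContDiff ℝ 1 F → HasCompactSupport F → (∀ x, 0 ≤ F x) →
      tsupport F ⊆ tsupport φ \ Γ → P F (gradient F)) :
    P (fun x => φ x * Q (u x)) (fun x => Q (u x) • gradient φ x + (φ x * Q1 (u x)) • V x) := by
  have G := D.G
  have hr := D.hr
  have hD1 : tsupport φ ⊆ ball x0 (3.8 * r) := hφD.trans (ball_subset_ball (by linarith))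
  obtain ⟨mQ, mQ1⟩ := N.toNice.mQ D.u0 D.um
  have s1 : ∀ ψ : Euc n → ℝ, ContDiff ℝ 1 ψ → HasCompactSupport ψ → (∀ x, 0 ≤ ψ x) →
      tsupport ψ ⊆ tsupport φ \ Γ →
      P (fun x => ψ x * Q (u x)) (fun x => Q (u x) • gradient ψ x + (ψ x * Q1 (u x)) • V x) := by
    intro ψ hψ hψc hψ0 hψD
    obtain ⟨v, hv0, hv1, hv2, hv3⟩ := step1 D N.toNice hψ hψc (hψD.trans (diff_subset_diff_left hD1))
    refine hP _ _ (fun j x => ψ x * Q (v j x)) (fun j => gradient (fun x => ψ x * Q (v j x)))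
      (hψ.continuous.measurable.mul mQ) ?_ (fun j => (hv1 j).continuous.measurable) (fun j => meas_grad _)
      (fun j => hb _ (hv1 j) hψc.mul_right (fun x => mul_nonneg (hψ0 x) (N.Q0 _ (hv0 j x)))
        (tsupport_mul_subset_left.trans hψD)) hv2 hv3
    exact (mQ.smul (meas_grad ψ)).add ((hψ.continuous.measurable.mul mQ1).smul D.Vm)
  obtain ⟨κ, C, hκ, hκ1, hC, hη⟩ := eta_ex n d C₀ G.hC0 G.hdn G.hn G.hd0
  have hM : 0 ≤ M := (abs_nonneg _).trans (N.hQ 0 le_rfl)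
  set ε : ℕ → ℝ := fun k => 0.005 * r * (1 / ((k : ℝ) + 1)) with hεd
  have hε : ∀ k, 0 < ε k := fun k => by positivity
  have hε1 : ∀ k, ε k ≤ 0.005 * r := fun k => by
    have : 1 / ((k : ℝ) + 1) ≤ 1 := by rw [div_le_one (by positivity)]; linarith [Nat.cast_nonneg (α := ℝ) k]
    simp only [hεd]; nlinarith
  have hε0 : Tendsto ε atTop (𝓝 0) := by
    have := (tendsto_one_div_add_atTop_nhds_zero_nat (𝕜 := ℝ)).const_mul (0.005 * r)
    rwa [mul_zero] at this
  have hex : ∀ k : ℕ, ∃ η, Eta n Γ x0 r κ C (ε k) η := fun k => by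
    obtain ⟨η, h1, h2, h3, h4, h5, h6⟩ := hη Γ G x0 D.hx0 r hr (ε k) (hε k)
    exact ⟨η, h1, h2, h3, h4, h5, h6⟩
  choose η H using hex
  have hE := fun k => psi_eta G hr hκ (hε k) (H k) hφ hφc hD1
  obtain ⟨mg, hgf⟩ := EN_gfin D N.toNice hφ hφc hφD
  obtain ⟨B, hB⟩ := hφ.continuous.bounded_above_of_compact_support hφc
  have hB0 : 0 ≤ B := (norm_nonneg _).trans (hB x0)
  have hη1 : ∀ᵐ x, ∀ᶠ k in atTop, η k x = 1 := by
    filter_upwards [G.ae_notMem] with x hx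
    filter_upwards [hε0.eventually (gt_mem_nhds (G.pos hx))] with k hk
    exact (H k).one x hk.le
  have m1 : ∀ k, Measurable (fun x => φ x * η k x * Q (u x)) := fun k => (hE k).1.continuous.measurable.mul mQ
  have m2 : ∀ k, Measurable (fun x => Q (u x) • gradient (fun x => φ x * η k x) x + (φ x * η k x * Q1 (u x)) • V x) :=
    fun k => (mQ.smul (meas_grad _)).add (((hE k).1.continuous.measurable.mul mQ1).smul D.Vm)
  refine hP _ _ (fun k x => φ x * η k x * Q (u x)) (fun k x => Q (u x) • gradient (fun x => φ x * η k x) x + (φ x * η k x * Q1 (u x)) • V x)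
    (hφ.continuous.measurable.mul mQ) mg m1 m2
    (fun k => s1 _ (hE k).1 (hE k).2.1 (fun x => mul_nonneg (hφ0 x) ((H k).b x).1) (hE k).2.2.1) ?_ ?_
  · filter_upwards [hη1] with x hx
    refine tendsto_const_nhds.congr' ?_
    filter_upwards [hx] with k hk
    rw [hk, mul_one]
  · set g := fun x => Q (u x) • gradient φ x + (φ x * Q1 (u x)) • V x with hg
    have hsplit : ∀ k x, (Q (u x) • gradient (fun x => φ x * η k x) x + (φ x * η k x * Q1 (u x)) • V x) - g x =
        (Q (u x) * φ x) • gradient (η k) x + (η k x - 1) • g x := by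
      intro k x
      rw [(hE k).2.2.2 x, hg]
      module
    suffices hs : Tendsto (fun k => EN n d Γ (fun x => (Q (u x) * φ x) • gradient (η k) x + (η k x - 1) • g x)) atTop (𝓝 0) by
      refine hs.congr fun k => ?_
      congr 1; funext x; exact (hsplit k x).symm
    have hA : Tendsto (fun k => EN n d Γ (fun x => (Q (u x) * φ x) • gradient (η k) x)) atTop (𝓝 0) := by
      have h3 := E3 hκ D ht hε hε1 hε0
      have h4 := ENNReal.Tendsto.const_mul (a := ofReal ((M * B * C) ^ 2)) h3 (Or.inr ofReal_ne_top)
      rw [mul_zero] at h4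
      refine tendsto_of_tendsto_of_tendsto_of_le_of_le tendsto_const_nhds h4 (fun _ => zero_le) fun k => ?_
      have hεk := hε k
      rw [← mul_assoc, ← ofReal_mul (by positivity), ← lcR _ _]
      have hSm : MeasurableSet (ball x0 (3.75 * r) ∩ {x | κ * ε k ≤ infDist x Γ ∧ infDist x Γ ≤ ε k}) := measurableSet_ball.inter
        ((measurableSet_le measurable_const measurable_infDist).inter
          (measurableSet_le measurable_infDist measurable_const))
      rw [← lintegral_indicator hSm]
      unfold EN
      refine lintegral_mono fun x => ?_
      by_cases hx : x ∈ ball x0 (3.75 * r) ∩ {x | κ * ε k ≤ infDist x Γ ∧ infDist x Γ ≤ ε k}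
      · rw [indicator_of_mem hx, ← ofReal_mul (by positivity)]
        apply ofReal_le_ofReal
        rw [← mul_assoc]
        refine mul_le_mul_of_nonneg_right ?_ (w_nonneg x)
        rw [norm_smul, norm_mul, ← sq_abs (1 - u x)]
        have h5 := (H k).gb x (ball_subset_ball (by linarith) hx.1)
        have h6 := N.lip (D.u0 x)
        calc _ ≤ (M * |1 - u x| * B * (C / ε k)) ^ 2 := by
              gcongr
              · exact h6
              · exact hB x
          _ = _ := by field_simp
      · rw [indicator_of_notMem hx]
        simp only [nonpos_iff_eq_zero, ofReal_eq_zero]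
        apply le_of_eq
        by_cases hxb : x ∈ ball x0 (3.75 * r)
        · have : gradient (η k) x = 0 := by
            apply (H k).gz x (ball_subset_ball (by linarith) hxb)
            by_contra hcon
            push Not at hcon
            exact hx ⟨hxb, hcon⟩
          rw [this]; simp
        · have : φ x = 0 := image_eq_zero_of_notMem_tsupport (fun h => hxb (hφD h))
          rw [this]; simp
    have hBt : Tendsto (fun k => EN n d Γ (fun x => (η k x - 1) • g x)) atTop (𝓝 0) := by
      refine EN_dom (h := g) (fun k => ?_) (fun k x => ?_) hgf ?_
      · have : (fun x => (η k x - 1) • g x) = fun x => ((Q (u x) • gradient (fun x => φ x * η k x) x + (φ x * η k x * Q1 (u x)) • V x) - g x) -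
          (Q (u x) * φ x) • gradient (η k) x := by
          ext1 x; rw [hsplit]; module
        rw [this]
        exact ((m2 k).sub mg).sub ((mQ.mul hφ.continuous.measurable).smul (meas_grad _))
      · rw [norm_smul]
        have := (H k).b x
        refine mul_le_of_le_one_left (norm_nonneg _) ?_
        rw [Real.norm_eq_abs, abs_le]; constructor <;> linarith
      · filter_upwards [hη1] with x hx
        refine tendsto_const_nhds.congr' ?_
        filter_upwards [hx] with k hk
        rw [hk]; simp
    have hsum := (ENNReal.Tendsto.const_mul (a := 2) hA (Or.inr (by simp))).add
      (ENNReal.Tendsto.const_mul (a := 2) hBt (Or.inr (by simp)))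
    rw [mul_zero, add_zero] at hsum
    refine tendsto_of_tendsto_of_tendsto_of_le_of_le tendsto_const_nhds hsum (fun _ => zero_le) fun k => ?_
    refine EN_add ?_
    have : (fun x => (η k x - 1) • g x) = fun x => ((Q (u x) • gradient (fun x => φ x * η k x) x + (φ x * η k x * Q1 (u x)) • V x) - g x) -
          (Q (u x) * φ x) • gradient (η k) x := by
      ext1 x; rw [hsplit]; module
    rw [this]
    exact ((m2 k).sub mg).sub ((mQ.mul hφ.continuous.measurable).smul (meas_grad _))

lemma closed_ineq (S K : Set (Euc n)) {ω : Euc n → ℝ} (hω : Measurable ω)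
    {c : ℝ≥0∞} (hc : c ≠ ⊤) : ClosedP d Γ (fun F g => ∫⁻ x in S, ofReal (F x ^ 2 * ω x) ≤
      c * ∫⁻ x in K, ofReal (‖g x‖ ^ 2 * weightW n d Γ x)) := by
  intro F g Fj gj mF mg mFj mgj hP hF hg
  simp only at hP ⊢
  set N := ∫⁻ x in K, ofReal (‖g x‖ ^ 2 * weightW n d Γ x) with hN
  have h1 : ∫⁻ x in S, ofReal (F x ^ 2 * ω x) ≤
      liminf (fun j => ∫⁻ x in S, ofReal (Fj j x ^ 2 * ω x)) atTop := by
    refine le_trans (le_of_eq ?_) (lintegral_liminf_le fun j => (((mFj j).pow_const 2).mul hω).ennreal_ofReal)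
    refine lintegral_congr_ae (ae_restrict_of_ae ?_)
    filter_upwards [hF] with x hx
    exact (((ENNReal.continuous_ofReal.tendsto _).comp ((hx.pow 2).mul_const (ω x))).liminf_eq).symm
  have h2 : ∀ θ : ℝ, 0 < θ → ∫⁻ x in S, ofReal (F x ^ 2 * ω x) ≤ c * (ofReal (1 + θ) * N) := by
    intro θ hθ
    have h3 : ∀ j, ∫⁻ x in S, ofReal (Fj j x ^ 2 * ω x) ≤ c * (ofReal (1 + θ) * N +
        ofReal (1 + 1 / θ) * EN n d Γ (fun x => gj j x - g x)) := by
      intro j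
      refine (hP j).trans (mul_le_mul_right ?_ _)
      have m1 : Measurable (fun x => ofReal (‖g x‖ ^ 2 * weightW n d Γ x)) := meas_EN mg
      calc _ ≤ ∫⁻ x in K, (ofReal (1 + θ) * ofReal (‖g x‖ ^ 2 * weightW n d Γ x) +
            ofReal (1 + 1 / θ) * ofReal (‖gj j x - g x‖ ^ 2 * weightW n d Γ x)) := by
            refine lintegral_mono fun x => ?_
            simp only
            have hw : 0 ≤ weightW n d Γ x := w_nonneg x
            rw [← ofReal_mul (by positivity), ← ofReal_mul (by positivity),
              ← ofReal_add (by positivity) (by positivity)]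
            apply ofReal_le_ofReal
            rw [← mul_assoc, ← mul_assoc, ← add_mul]
            refine mul_le_mul_of_nonneg_right ?_ hw
            have h4 : ‖gj j x‖ ≤ ‖g x‖ + ‖gj j x - g x‖ := by
              calc ‖gj j x‖ = ‖g x + (gj j x - g x)‖ := by rw [add_sub_cancel]
                _ ≤ _ := norm_add_le _ _
            set a := ‖g x‖
            set b := ‖gj j x - g x‖
            have h5 : 2 * a * b ≤ θ * a ^ 2 + 1 / θ * b ^ 2 := by
              have : 0 ≤ (θ * a - b) ^ 2 / θ := by positivity
              have e : (θ * a - b) ^ 2 / θ = θ * a ^ 2 + 1 / θ * b ^ 2 - 2 * a * b := by field_simp; ring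
              linarith
            calc ‖gj j x‖ ^ 2 ≤ (a + b) ^ 2 := by gcongr
              _ ≤ _ := by nlinarith
        _ = ofReal (1 + θ) * N + ofReal (1 + 1 / θ) *
            ∫⁻ x in K, ofReal (‖gj j x - g x‖ ^ 2 * weightW n d Γ x) := by
            rw [lintegral_add_left (m1.const_mul _), lcR _ _,
              lcR _ _]
        _ ≤ _ := add_le_add le_rfl (mul_le_mul_right (setLIntegral_le_lintegral _ _) _)
    have h6 := ENNReal.Tendsto.const_mul (a := c) ((tendsto_const_nhds (x := ofReal (1 + θ) * N)).add
      (ENNReal.Tendsto.const_mul (a := ofReal (1 + 1 / θ)) hg (Or.inr ofReal_ne_top))) (Or.inr hc)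
    rw [mul_zero, add_zero] at h6
    rw [← h6.liminf_eq]
    exact h1.trans (liminf_le_liminf (Eventually.of_forall h3))
  have h7 : Tendsto (fun k : ℕ => c * (ofReal (1 + 1 / ((k : ℝ) + 1)) * N)) atTop (𝓝 (c * (ofReal (1 + 0) * N))) := by
    refine ENNReal.Tendsto.const_mul (ENNReal.Tendsto.mul_const ?_ (Or.inl (by simp))) (Or.inr hc)
    exact (ENNReal.continuous_ofReal.tendsto _).comp
      ((tendsto_one_div_add_atTop_nhds_zero_nat (𝕜 := ℝ)).const_add 1)
  have h8 := ge_of_tendsto' h7 (fun k => h2 (1 / ((k : ℝ) + 1)) (by positivity))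
  simpa using h8

structure Sup (n : ℕ) (d C₁ : ℝ) (Γ : Set (Euc n)) (x0 : Euc n) (r : ℝ) (V B : Euc n → Euc n) : Prop where
  hC : 1 ≤ C₁
  m : AEStronglyMeasurable B
  b : ∀ x, x ∉ Γ → ‖B x‖ ≤ C₁ * weightW n d Γ x * ‖V x‖
  e : ∀ x, x ∉ Γ → C₁⁻¹ * weightW n d Γ x * ‖V x‖ ^ 2 ≤ inner ℝ (B x) (V x)
  s : ∀ ψ : Euc n → ℝ, ContDiff ℝ (⊤ : ℕ∞) ψ → HasCompactSupport ψ → tsupport ψ ⊆ ball x0 (3.8 * r) \ Γ →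
    (∀ x, 0 ≤ ψ x) → 0 ≤ ∫ x, inner ℝ (B x) (gradient ψ x)

lemma Sup.int (D : Dat n d C₀ Γ x0 r u V) (H : Sup n d C₁ Γ x0 r V B) {g : Euc n → Euc n}
    (mg : Measurable g) (hg : EN n d Γ g < ⊤) :
    Integrable (fun x => inner ℝ (B x) (g x)) ∧ ∫⁻ x, ‖inner ℝ (B x) (g x)‖ₑ ≤
      ofReal C₁ * (EN n d Γ V ^ (1 / (2 : ℝ)) * EN n d Γ g ^ (1 / (2 : ℝ))) := by
  have hC := H.hC
  have h1 : ∫⁻ x, ‖inner ℝ (B x) (g x)‖ₑ ≤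
      ofReal C₁ * (EN n d Γ V ^ (1 / (2 : ℝ)) * EN n d Γ g ^ (1 / (2 : ℝ))) := by
    have mw : Measurable (fun x => weightW n d Γ x) := meas_w
    have mV := D.Vm
    have hcs := ENNReal.lintegral_mul_le_Lp_mul_Lq volume (p := 2) (q := 2) Real.HolderConjugate.two_two
      (f := fun x => ofReal (‖V x‖ * √(weightW n d Γ x))) (g := fun x => ofReal (‖g x‖ * √(weightW n d Γ x)))
      (mV.norm.mul mw.sqrt).ennreal_ofReal.aemeasurable (mg.norm.mul mw.sqrt).ennreal_ofReal.aemeasurable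
    have e : ∀ h : Euc n → Euc n, ∫⁻ x, ofReal (‖h x‖ * √(weightW n d Γ x)) ^ (2 : ℝ) = EN n d Γ h := by
      intro h
      refine lintegral_congr fun x => ?_
      rw [ofReal_rpow_of_nonneg (by positivity) (by norm_num)]
      congr 1
      norm_cast
      rw [mul_pow, Real.sq_sqrt (w_nonneg x)]
    rw [e, e] at hcs
    calc _ ≤ ∫⁻ x, ofReal C₁ * (ofReal (‖V x‖ * √(weightW n d Γ x)) * ofReal (‖g x‖ * √(weightW n d Γ x))) := by
          refine lintegral_mono_ae ?_
          filter_upwards [D.G.ae_notMem] with x hx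
          rw [← ofReal_norm_eq_enorm, ← ofReal_mul (by positivity), ← ofReal_mul (by positivity)]
          apply ofReal_le_ofReal
          refine (norm_inner_le_norm _ _).trans ?_
          calc _ ≤ C₁ * weightW n d Γ x * ‖V x‖ * ‖g x‖ := by gcongr; exact H.b x hx
            _ = C₁ * (√(weightW n d Γ x) ^ 2) * ‖V x‖ * ‖g x‖ := by rw [Real.sq_sqrt (w_nonneg x)]
            _ = _ := by ring
      _ ≤ _ := by
          rw [lcR _ _]
          exact mul_le_mul_right hcs _
  refine ⟨⟨H.m.inner mg.aestronglyMeasurable, h1.trans_lt ?_⟩, h1⟩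
  exact mul_lt_top ofReal_lt_top (mul_lt_top
    (ENNReal.rpow_lt_top_of_nonneg (by norm_num) D.VE.ne) (ENNReal.rpow_lt_top_of_nonneg (by norm_num) hg.ne))

lemma closed_sup (D : Dat n d C₀ Γ x0 r u V) (H : Sup n d C₁ Γ x0 r V B) :
    ClosedP d Γ (fun _ g => EN n d Γ g < ⊤ ∧ 0 ≤ ∫ x, inner ℝ (B x) (g x)) := by
  intro F g Fj gj mF mg mFj mgj hP hF hg
  have hev : ∀ᶠ j in atTop, EN n d Γ (fun x => gj j x - g x) < ⊤ := hg.eventually (gt_mem_nhds (by simp))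
  have hgf : EN n d Γ g < ⊤ := by
    obtain ⟨j, hj⟩ := hev.exists
    have h1 : EN n d Γ g ≤ 2 * EN n d Γ (gj j) + 2 * EN n d Γ (fun x => g x - gj j x) := by
      refine le_trans (le_of_eq ?_) (EN_add (mg.sub (mgj j)))
      congr 1; funext x; rw [add_sub_cancel]
    have h2 : EN n d Γ (fun x => g x - gj j x) = EN n d Γ (fun x => gj j x - g x) := by
      unfold EN; simp_rw [norm_sub_rev]
    rw [h2] at h1
    exact h1.trans_lt (ENNReal.add_lt_top.2 ⟨mul_lt_top (by simp) (hP j).1, mul_lt_top (by simp) hj⟩)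
  refine ⟨hgf, ?_⟩
  have hL := (H.int D mg hgf)
  have ht : Tendsto (fun j => ∫ x, inner ℝ (B x) (gj j x)) atTop (𝓝 (∫ x, inner ℝ (B x) (g x))) := by
    refine tendsto_integral_of_L1 _ hL.1.aestronglyMeasurable (Eventually.of_forall fun j => (H.int D (mgj j) (hP j).1).1) ?_
    have h3 := ENNReal.Tendsto.const_mul (a := ofReal C₁) (ENNReal.Tendsto.const_mul
      (a := EN n d Γ V ^ (1 / (2 : ℝ))) (hg.ennrpow_const (1 / (2 : ℝ)))
      (Or.inr (ENNReal.rpow_lt_top_of_nonneg (by norm_num) D.VE.ne).ne)) (Or.inr ofReal_ne_top)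
    rw [ENNReal.zero_rpow_of_pos (by norm_num), mul_zero, mul_zero] at h3
    refine sqz h3 (Eventually.of_forall fun _ => zero_le) ?_
    filter_upwards [hev] with j hj
    refine le_trans (le_of_eq ?_) (H.int D ((mgj j).sub mg) hj).2
    refine lintegral_congr fun x => ?_
    rw [← inner_sub_right]; rfl
  exact ge_of_tendsto' ht fun j => (hP j).2

lemma base_sup (D : Dat n d C₀ Γ x0 r u V) (H : Sup n d C₁ Γ x0 r V B) {F : Euc n → ℝ}
    (hF : ContDiff ℝ 1 F) (hFc : HasCompactSupport F) (hF0 : ∀ x, 0 ≤ F x)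
    (hFD : tsupport F ⊆ ball x0 (3.8 * r) \ Γ) :
    EN n d Γ (gradient F) < ⊤ ∧ 0 ≤ ∫ x, inner ℝ (B x) (gradient F x) := by
  have hU : IsOpen (ball x0 (3.8 * r) \ Γ) := isOpen_ball.sdiff D.G.cl
  obtain ⟨δ, hδ, hδU⟩ := hFc.isCompact.exists_cthickening_subset_open hU hFD
  set K := cthickening δ (tsupport F) with hK
  have hKc : IsCompact K := hFc.isCompact.cthickening
  obtain ⟨W, hW0, hW⟩ := D.wK hKc (fun y hy hyK => (hδU hyK).2 hy)
  have hgc := continuous_grad hF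
  have hgm : MemLp (gradient F) 2 := hgc.memLp_of_hasCompactSupport (hcs_grad hFc)
  have hFl : LocallyIntegrable F := hF.continuous.locallyIntegrable
  have hWG : WG F (gradient F) univ := by
    intro φ hφ hφc _
    have hφ1 : ContDiff ℝ 1 φ := hφ.of_le (by exact_mod_cast le_top)
    have h0 := int_grad_zero (hF.mul hφ1) hFc.mul_right
    have h1 : ∀ x, gradient (fun x => F x * φ x) x = F x • gradient φ x + φ x • gradient F x := fun x =>
      grad_mul (f := F) (g := φ) (hF.differentiable (by norm_num) x) (hφ1.differentiable (by norm_num) x)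
    simp_rw [h1] at h0
    rw [integral_add] at h0
    · exact eq_neg_of_add_eq_zero_left h0
    · exact (hF.continuous.smul (continuous_grad hφ1)).integrable_of_hasCompactSupport hFc.smul_right
    · exact (hφ1.continuous.smul hgc).integrable_of_hasCompactSupport hφc.smul_right
  have hKs : tsupport F ⊆ K := self_subset_cthickening _
  have hconv := mol_conv isOpen_univ hKc (subset_univ _) hFl hgm hWG
  have hsup : ∀ᶠ k in atTop, tsupport (mol k F) ⊆ K := by
    filter_upwards [(bmp_tendsto n).eventually (gt_mem_nhds hδ)] with k hk
    refine closure_minimal ?_ isClosed_cthickening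
    intro x hx
    have h2 := support_convolution_subset (ContinuousLinearMap.lsmul ℝ ℝ) hx
    obtain ⟨a, ha, b, hb, rfl⟩ := Set.mem_add.1 h2
    rw [ContDiffBump.support_normed_eq] at ha
    refine mem_cthickening_of_dist_le _ b δ _ (subset_tsupport _ hb) ?_
    rw [mem_ball, dist_zero_right] at ha
    rw [dist_eq_norm, add_sub_cancel_right]; linarith
  have hKm := hKc.isClosed.measurableSet
  have hen : Tendsto (fun k => EN n d Γ (fun x => gradient (mol k F) x - gradient F x)) atTop (𝓝 0) := by
    have h3 := ENNReal.Tendsto.const_mul (a := ofReal W) hconv (Or.inr ofReal_ne_top)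
    rw [mul_zero] at h3
    refine sqz h3 (Eventually.of_forall fun _ => zero_le) ?_
    filter_upwards [hsup] with k hk
    refine Dat.EN_K hKm hW0 hW fun x hx => ?_
    rw [gz0 (fun h => hx (hk h)), gz0 (fun h => hx (hKs h)), sub_zero]
  have hfin : ∀ G : Euc n → ℝ, ContDiff ℝ 1 G → tsupport G ⊆ K → EN n d Γ (gradient G) < ⊤ := by
    intro G hG hGK
    refine (Dat.EN_K hKm hW0 hW fun x hx => gz0 (fun h => hx (hGK h))).trans_lt ?_
    refine mul_lt_top ofReal_lt_top ?_
    have hc : ContinuousOn (fun x => ‖gradient G x‖ ^ 2) K := ((continuous_grad hG).norm.pow 2).continuousOn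
    have := (hc.integrableOn_compact (μ := volume) hKc).lintegral_lt_top
    exact this
  obtain ⟨k0, hk0⟩ := eventually_atTop.1 hsup
  have hm : ∀ k, ContDiff ℝ (⊤ : ℕ∞) (mol k F) := fun k => mol_contDiff hFl k
  refine closed_sup D H (fun _ => 0) (gradient F) (fun _ _ => 0) (fun k => gradient (mol (k + k0) F)) measurable_const (meas_grad _)
    (fun _ => measurable_const) (fun _ => meas_grad _) (fun k => ⟨hfin _ ((hm _).of_le (by exact_mod_cast le_top)) (hk0 _ (by omega)), ?_⟩)
    (Eventually.of_forall fun x => tendsto_const_nhds) (hen.comp (tendsto_add_atTop_nat k0))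
  have hs := hk0 (k + k0) (by omega)
  exact H.s _ (hm _) (hKc.of_isClosed_subset (isClosed_tsupport _) hs) (hs.trans hδU) (mol_nonneg hF0 _)

lemma energy (D : Dat n d C₀ Γ x0 r u V) (H : Sup n d C₁ Γ x0 r V B)
    (ht : ∀ᵐ y ∂(sg n d Γ), y ∈ ball x0 (3.8 * r) → HasTraceAt u y 1)
    {Q Q1 : ℝ → ℝ} {M : ℝ} (N : NiceZ Q Q1 M) {E P : ℝ → ℝ} (hE : ∀ s, 0 ≤ s → 0 ≤ E s)
    (hP : ∀ s, 0 ≤ s → 0 ≤ P s) (hPE : ∀ s, 0 ≤ s → Q s ^ 2 ≤ P s * E s) (hQE : ∀ s, 0 ≤ s → Q1 s ≤ - E s)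
    (mP : Measurable (fun x => P (u x)))
    {φ : Euc n → ℝ} (hφ : ContDiff ℝ 1 φ) (hφc : HasCompactSupport φ) (hφ0 : ∀ x, 0 ≤ φ x)
    (hφD : tsupport φ ⊆ ball x0 (3.75 * r)) :
    ∫⁻ x, ofReal (φ x ^ 2 * E (u x) * ‖V x‖ ^ 2 * weightW n d Γ x) ≤
      ofReal (4 * C₁ ^ 4) * ∫⁻ x, ofReal (‖gradient φ x‖ ^ 2 * P (u x) * weightW n d Γ x) := by
  have hC := H.hC
  have hC0 : 0 < C₁ := by linarith
  by_cases hfin : ∫⁻ x, ofReal (‖gradient φ x‖ ^ 2 * P (u x) * weightW n d Γ x) = ⊤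
  · rw [hfin, ENNReal.mul_top (by simp; positivity)]; exact le_top
  have hψ : ContDiff ℝ 1 (fun x => φ x * φ x) := hφ.mul hφ
  have hts : tsupport (fun x => φ x * φ x) ⊆ tsupport φ := tsupport_mul_subset_left
  have key := clos_ind D ht N hψ hφc.mul_right (fun x => mul_self_nonneg _) (hts.trans hφD) (closed_sup D H) (by
    intro F hF hFc hF0 hFD
    refine base_sup D H hF hFc hF0 fun x hx => ⟨?_, (hFD hx).2⟩
    exact ball_subset_ball (by linarith [D.hr]) (hφD (hts (hFD hx).1)))
  set g : Euc n → Euc n := fun x => Q (u x) • gradient (fun x => φ x * φ x) x + ((φ x * φ x) * Q1 (u x)) • V x with hg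
  have mg : Measurable g := (EN_gfin D N.toNice hψ hφc.mul_right (hts.trans hφD)).1
  have hI := (H.int D mg key.1).1
  have h0 := key.2
  set Y : Euc n → ℝ := fun x => ‖gradient φ x‖ ^ 2 * P (u x) * weightW n d Γ x with hY
  have hY0 : ∀ x, 0 ≤ Y x := fun x => mul_nonneg (mul_nonneg (by positivity) (hP _ (D.u0 x))) (w_nonneg x)
  have mY : Measurable Y := (((meas_grad φ).norm.pow_const 2).mul mP).mul meas_w
  have iY : Integrable Y := by
    refine ⟨mY.aestronglyMeasurable, ?_⟩
    rw [hasFiniteIntegral_iff_ofReal (Eventually.of_forall hY0)]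
    exact lt_top_iff_ne_top.2 hfin
  have hpt : ∀ᵐ x, φ x ^ 2 * E (u x) * ‖V x‖ ^ 2 * weightW n d Γ x ≤ 4 * C₁ ^ 4 * Y x - 2 * C₁ * inner ℝ (B x) (g x) := by
    filter_upwards [D.G.ae_notMem] with x hx
    have hw : 0 ≤ weightW n d Γ x := w_nonneg x
    have hdφ := hφ.differentiable (by norm_num) x
    have e1 : gradient (fun x => φ x * φ x) x = φ x • gradient φ x + φ x • gradient φ x :=
      grad_mul (f := φ) (g := φ) hdφ hdφ
    have e2 : inner ℝ (B x) (g x) = 2 * φ x * Q (u x) * inner ℝ (B x) (gradient φ x) + φ x ^ 2 * Q1 (u x) * inner ℝ (B x) (V x) := by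
      simp only [hg]
      rw [e1, inner_add_right, inner_smul_right, inner_add_right, inner_smul_right, inner_smul_right]; ring
    have hu := D.u0 x
    have hQ0 := N.Q0 _ hu
    have hE0 := hE _ hu
    have hP0 := hP _ hu
    have h3 : inner ℝ (B x) (gradient φ x) ≤ C₁ * weightW n d Γ x * ‖V x‖ * ‖gradient φ x‖ :=
      (real_inner_le_norm _ _).trans (mul_le_mul_of_nonneg_right (H.b x hx) (norm_nonneg _))
    have h4 := H.e x hx
    have h5 : Q1 (u x) * inner ℝ (B x) (V x) ≤ - E (u x) * (C₁⁻¹ * weightW n d Γ x * ‖V x‖ ^ 2) := by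
      have h6 : 0 ≤ C₁⁻¹ * weightW n d Γ x * ‖V x‖ ^ 2 := by positivity
      nlinarith [hQE _ hu]
    have h7 : Q (u x) ≤ √(P (u x)) * √(E (u x)) := by
      rw [← Real.sqrt_mul hP0]; exact Real.le_sqrt_of_sq_le (hPE _ hu)
    have h8 : 2 * φ x * Q (u x) * inner ℝ (B x) (gradient φ x) ≤
        2 * φ x * (√(P (u x)) * √(E (u x))) * (C₁ * weightW n d Γ x * ‖V x‖ * ‖gradient φ x‖) := by
      have hf := hφ0 x
      refine (mul_le_mul_of_nonneg_left h3 (by positivity)).trans ?_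
      refine mul_le_mul_of_nonneg_right ?_ (by positivity)
      exact mul_le_mul_of_nonneg_left h7 (by positivity)
    have h9 : φ x ^ 2 * Q1 (u x) * inner ℝ (B x) (V x) ≤ φ x ^ 2 * (- E (u x) * (C₁⁻¹ * weightW n d Γ x * ‖V x‖ ^ 2)) := by
      rw [mul_assoc]; exact mul_le_mul_of_nonneg_left h5 (by positivity)
    have h10 : 2 * C₁ * inner ℝ (B x) (g x) ≤ 2 * C₁ * (2 * φ x * (√(P (u x)) * √(E (u x))) * (C₁ * weightW n d Γ x * ‖V x‖ * ‖gradient φ x‖)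
        + φ x ^ 2 * (- E (u x) * (C₁⁻¹ * weightW n d Γ x * ‖V x‖ ^ 2))) := by
      rw [e2]; exact mul_le_mul_of_nonneg_left (add_le_add h8 h9) (by positivity)
    have e3 : C₁ * C₁⁻¹ = 1 := mul_inv_cancel₀ hC0.ne'
    simp only [hY]
    set p := √(P (u x)) with hp
    set q := √(E (u x)) with hq
    have ep : P (u x) = p ^ 2 := (Real.sq_sqrt hP0).symm
    have eq : E (u x) = q ^ 2 := (Real.sq_sqrt hE0).symm
    rw [ep, eq]
    rw [eq] at h10
    have h11 : 0 ≤ weightW n d Γ x * (φ x * q * ‖V x‖ - 2 * C₁ ^ 2 * p * ‖gradient φ x‖) ^ 2 := by positivity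
    have e4 : 2 * C₁ * (φ x ^ 2 * (-q ^ 2 * (C₁⁻¹ * weightW n d Γ x * ‖V x‖ ^ 2))) = - (2 * φ x ^ 2 * q ^ 2 * weightW n d Γ x * ‖V x‖ ^ 2) := by
      linear_combination (-2 * φ x ^ 2 * q ^ 2 * weightW n d Γ x * ‖V x‖ ^ 2) * e3
    rw [mul_add, e4] at h10
    nlinarith
  have iS : Integrable (fun x => 4 * C₁ ^ 4 * Y x - 2 * C₁ * inner ℝ (B x) (g x)) := (iY.const_mul _).sub (hI.const_mul _)
  calc _ ≤ ∫⁻ x, ofReal (4 * C₁ ^ 4 * Y x - 2 * C₁ * inner ℝ (B x) (g x)) :=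
        lintegral_mono_ae (hpt.mono fun x hx => ofReal_le_ofReal hx)
    _ = ofReal (∫ x, (4 * C₁ ^ 4 * Y x - 2 * C₁ * inner ℝ (B x) (g x))) := by
        rw [ofReal_integral_eq_lintegral_ofReal iS]
        filter_upwards [hpt] with x hx
        refine le_trans ?_ hx
        exact mul_nonneg (mul_nonneg (mul_nonneg (by positivity) (hE _ (D.u0 x))) (by positivity)) (w_nonneg x)
    _ ≤ ofReal (4 * C₁ ^ 4 * ∫ x, Y x) := by
        apply ofReal_le_ofReal
        rw [integral_sub (iY.const_mul _) (hI.const_mul _), integral_const_mul, integral_const_mul]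
        have : 0 ≤ 2 * C₁ * ∫ x, inner ℝ (B x) (g x) := by positivity
        linarith
    _ = _ := by
        rw [ofReal_mul (by positivity), ofReal_integral_eq_lintegral_ofReal iY (Eventually.of_forall hY0)]

lemma hd_pp (k : ℕ) (s : ℝ) : HasDerivAt (fun s : ℝ => max s 0 ^ (k + 2)) ((k + 2) * max s 0 ^ (k + 1)) s := by
  rcases lt_trichotomy s 0 with h | h | h
  · have : (fun s : ℝ => max s 0 ^ (k + 2)) =ᶠ[𝓝 s] fun _ => 0 := by
      filter_upwards [gt_mem_nhds h] with t ht
      rw [max_eq_right ht.le]; simp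
    rw [max_eq_right h.le, zero_pow (by simp), mul_zero]
    exact (hasDerivAt_const s 0).congr_of_eventuallyEq this
  · subst h
    simp only [max_self, ne_eq, Nat.add_eq_zero_iff, one_ne_zero, and_false, not_false_eq_true, zero_pow, mul_zero]
    rw [hasDerivAt_iff_isLittleO]
    simp only [max_self, smul_zero, sub_zero]
    have h1 : (fun x : ℝ => max x 0 ^ (k + 2)) =O[𝓝 0] fun x : ℝ => x ^ (k + 2) := by
      refine Asymptotics.isBigO_of_le _ fun x => ?_
      rw [norm_pow, norm_pow]
      refine pow_le_pow_left₀ (norm_nonneg _) ?_ _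
      rcases le_total x 0 with h | h
      · rw [max_eq_right h]; simp
      · rw [max_eq_left h]
    have h2 := h1.trans_isLittleO (Asymptotics.isLittleO_pow_id (𝕜 := ℝ) (n := k + 2) (by omega))
    simpa using h2
  · have : (fun s : ℝ => max s 0 ^ (k + 2)) =ᶠ[𝓝 s] fun s => s ^ (k + 2) := by
      filter_upwards [lt_mem_nhds h] with t ht
      rw [max_eq_left ht.le]
    rw [max_eq_left h.le]
    have h3 := (hasDerivAt_pow (k + 2) s).congr_of_eventuallyEq this
    refine h3.congr_deriv ?_
    push_cast; rfl

def zt (ε s : ℝ) : ℝ := 1 + ε - max (1 - s) 0 ^ 3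
def Ph (ε s : ℝ) : ℝ := Real.log (1 + ε) - Real.log (zt ε s)
def Ph1 (ε s : ℝ) : ℝ := - (3 * max (1 - s) 0 ^ 2 / zt ε s)
def Ph2 (ε s : ℝ) : ℝ := 6 * max (1 - s) 0 / zt ε s + Ph1 ε s ^ 2

lemma zt_pos (hε : 0 < ε) (hs : 0 ≤ s) : 0 < zt ε s := by
  unfold zt
  have h1 : max (1 - s) 0 ≤ 1 := max_le (by linarith) zero_le_one
  have := pow_le_one₀ (n := 3) (le_max_right (1 - s) 0) h1
  linarith

lemma zt_hd (ε s : ℝ) : HasDerivAt (zt ε) (3 * max (1 - s) 0 ^ 2) s := by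
  have h := (hd_pp 1 (1 - s)).comp s ((hasDerivAt_id s).const_sub 1)
  refine (h.const_sub (1 + ε)).congr_deriv ?_
  norm_num

lemma zt_cont (ε : ℝ) : Continuous (zt ε) := by unfold zt; fun_prop

lemma Ph_hd (hε : 0 < ε) (hs : 0 ≤ s) : HasDerivAt (Ph ε) (Ph1 ε s) s := by
  have h := ((zt_hd ε s).log (zt_pos hε hs).ne').const_sub (Real.log (1 + ε))
  exact h

lemma Ph1_hd (hε : 0 < ε) (hs : 0 ≤ s) : HasDerivAt (Ph1 ε) (Ph2 ε s) s := by
  have h0 := (hd_pp 0 (1 - s)).comp s ((hasDerivAt_id s).const_sub 1)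
  have hz := (zt_pos hε hs).ne'
  have h := (((h0.const_mul 3).div (zt_hd ε s) hz)).neg
  refine h.congr_deriv ?_
  unfold Ph2 Ph1
  simp
  field_simp
  ring

lemma Ph1_cont (hε : 0 < ε) : ContinuousOn (Ph1 ε) (Ici 0) :=
  fun s hs => (Ph1_hd hε hs).continuousAt.continuousWithinAt
lemma Ph_cont (hε : 0 < ε) : ContinuousOn (Ph ε) (Ici 0) :=
  fun s hs => (Ph_hd hε hs).continuousAt.continuousWithinAt
lemma Ph2_cont (hε : 0 < ε) : ContinuousOn (Ph2 ε) (Ici 0) := by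
  unfold Ph2
  refine ContinuousOn.add (ContinuousOn.div (by fun_prop) (zt_cont ε).continuousOn fun s hs => (zt_pos hε hs).ne') ((Ph1_cont hε).pow 2)

lemma Ph_one (hs : 1 ≤ s) : Ph ε s = 0 ∧ Ph1 ε s = 0 ∧ Ph2 ε s = 0 := by
  have h : max (1 - s) 0 = 0 := max_eq_right (by linarith)
  unfold Ph2 Ph Ph1 zt; rw [h]; simp

lemma Ph_nonneg (hε : 0 < ε) (hs : 0 ≤ s) : 0 ≤ Ph ε s := by
  unfold Ph
  rw [sub_nonneg]
  refine Real.log_le_log (zt_pos hε hs) ?_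
  unfold zt
  have : 0 ≤ max (1 - s) 0 := le_max_right _ _
  have := pow_nonneg this 3
  linarith

lemma niceZ_mk (hd : ∀ s, 0 ≤ s → HasDerivAt Q (Q1 s) s) (hc : ContinuousOn Q1 (Ici 0))
    (Q0 : ∀ s, 0 ≤ s → 0 ≤ Q s) (Qz : ∀ s, 1 ≤ s → Q s = 0) (Q1z : ∀ s, 1 ≤ s → Q1 s = 0) : ∃ M, NiceZ Q Q1 M := by
  have hcQ : ContinuousOn Q (Icc 0 1) := fun s hs => (hd s hs.1).continuousAt.continuousWithinAt
  obtain ⟨M1, h1⟩ := isCompact_Icc.exists_bound_of_continuousOn hcQ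
  obtain ⟨M2, h2⟩ := isCompact_Icc.exists_bound_of_continuousOn (hc.mono (show Icc (0 : ℝ) 1 ⊆ Ici 0 from Icc_subset_Ici_self))
  have p1 : 0 ≤ M1 := (norm_nonneg _).trans (h1 0 (by simp))
  refine ⟨max M1 M2, ⟨⟨hd, hc, fun s hs => ?_, fun s hs => ?_⟩, Q0, Qz⟩⟩
  · by_cases h : 1 ≤ s
    · rw [Qz s h, abs_zero]; exact le_max_of_le_left p1
    · exact (h1 s ⟨hs, by linarith⟩).trans (le_max_left _ _)
  · by_cases h : 1 ≤ s
    · rw [Q1z s h, abs_zero]; exact le_max_of_le_left p1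
    · exact (h2 s ⟨hs, by linarith⟩).trans (le_max_right _ _)

structure PQ (Q Qd P Pd : ℝ → ℝ) : Prop where
  hQ : ∀ t, HasDerivAt Q (Qd t) t
  cQ : Continuous Qd
  hP : ∀ t, HasDerivAt P (Pd t) t
  cP : Continuous Pd
  z : Q 0 = 0
  Q0 : ∀ t, 0 ≤ t → 0 ≤ Q t
  Pd0 : ∀ t, 0 ≤ t → 0 ≤ Pd t
  e : ∀ t, P t = Qd t ^ 2

lemma PQ.nice {Q Qd P Pd : ℝ → ℝ} (h : PQ Q Qd P Pd) {ε : ℝ} (hε : 0 < ε) :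
    ∃ M, NiceZ (fun s => Q (Ph ε s)) (fun s => Qd (Ph ε s) * Ph1 ε s) M := by
  refine niceZ_mk (fun s hs => (h.hQ _).comp s (Ph_hd hε hs)) ?_ (fun s hs => h.Q0 _ (Ph_nonneg hε hs))
    (fun s hs => ?_) (fun s hs => ?_)
  · exact (h.cQ.comp_continuousOn (Ph_cont hε)).mul (Ph1_cont hε)
  · rw [(Ph_one hs).1, h.z]
  · rw [(Ph_one hs).2.1, mul_zero]

lemma cacc (D : Dat n d C₀ Γ x0 r u V) (H : Sup n d C₁ Γ x0 r V B)
    (ht : ∀ᵐ y ∂(sg n d Γ), y ∈ ball x0 (3.8 * r) → HasTraceAt u y 1)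
    {Q Qd P Pd : ℝ → ℝ} (h : PQ Q Qd P Pd) {ε : ℝ} (hε : 0 < ε)
    {φ : Euc n → ℝ} (hφ : ContDiff ℝ 1 φ) (hφc : HasCompactSupport φ) (hφ0 : ∀ x, 0 ≤ φ x)
    (hφD : tsupport φ ⊆ ball x0 (3.75 * r)) :
    EN n d Γ (fun x => (φ x * (Qd (Ph ε (u x)) * Ph1 ε (u x))) • V x) ≤
      ofReal (4 * C₁ ^ 4) * ∫⁻ x, ofReal (‖gradient φ x‖ ^ 2 * P (Ph ε (u x)) * weightW n d Γ x) := by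
  have hP0 : ∀ t, 0 ≤ P t := fun t => by rw [h.e]; positivity
  have cP : Continuous P := continuous_iff_continuousAt.2 fun t => (h.hP t).continuousAt
  obtain ⟨M, N⟩ : ∃ M, NiceZ (fun s => P (Ph ε s) * (- Ph1 ε s))
      (fun s => Pd (Ph ε s) * Ph1 ε s * (- Ph1 ε s) + P (Ph ε s) * (- Ph2 ε s)) M := by
    refine niceZ_mk (fun s hs => ((h.hP _).comp s (Ph_hd hε hs)).mul (Ph1_hd hε hs).neg) ?_ ?_ ?_ ?_
    · refine ContinuousOn.add (((h.cP.comp_continuousOn (Ph_cont hε)).mul (Ph1_cont hε)).mul (Ph1_cont hε).neg)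
        ((cP.comp_continuousOn (Ph_cont hε)).mul (Ph2_cont hε).neg)
    · intro s hs
      refine mul_nonneg (hP0 _) ?_
      unfold Ph1
      have := zt_pos hε hs
      rw [neg_neg]; positivity
    · intro s hs; rw [(Ph_one hs).2.1]; simp
    · intro s hs; rw [(Ph_one hs).2.1, (Ph_one hs).2.2]; simp
  obtain ⟨M', N'⟩ := h.nice hε
  have mP : Measurable (fun x => P (Ph ε (u x))) := by
    have h1 : Continuous (fun s => P (Ph ε (max s 0))) :=
      cP.comp ((Ph_cont hε).comp_continuous (by fun_prop) fun s => mem_Ici.2 (le_max_right _ _))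
    have h2 := h1.measurable.comp D.um
    have e : (fun x => P (Ph ε (u x))) = (fun s => P (Ph ε (max s 0))) ∘ u := by
      funext x; simp only [Function.comp]; rw [max_eq_left (D.u0 x)]
    rw [e]; exact h2
  have key := energy D H ht N (E := fun s => P (Ph ε s) * Ph1 ε s ^ 2) (P := fun s => P (Ph ε s))
    (fun s hs => mul_nonneg (hP0 _) (by positivity)) (fun s hs => hP0 _) (fun s hs => le_of_eq (by ring)) (by
      intro s hs
      have h1 := mul_nonneg (h.Pd0 _ (Ph_nonneg hε hs)) (sq_nonneg (Ph1 ε s))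
      have h2 : Ph1 ε s ^ 2 ≤ Ph2 ε s := by
        unfold Ph2
        have := zt_pos hε hs
        have : 0 ≤ 6 * max (1 - s) 0 / zt ε s := by positivity
        linarith
      have h3 := mul_le_mul_of_nonneg_left h2 (hP0 (Ph ε s))
      nlinarith) mP hφ hφc hφ0 hφD
  refine le_trans (le_of_eq ?_) key
  unfold EN
  refine lintegral_congr fun x => ?_
  simp only
  rw [norm_smul, mul_pow, Real.norm_eq_abs, sq_abs, h.e]
  congr 1; ring

lemma pq_id : PQ (fun t => t) (fun _ => 1) (fun _ => 1) (fun _ => 0) :=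
  ⟨fun t => hasDerivAt_id t, continuous_const, fun t => hasDerivAt_const t 1, continuous_const, rfl, fun t h => h,
    fun t _ => le_rfl, fun t => by norm_num⟩

def Qk (k t : ℝ) : ℝ := √(1 + max (t - k) 0 ^ 2) - 1
def Pk (k t : ℝ) : ℝ := 1 - 1 / (1 + max (t - k) 0 ^ 2)

lemma pq_k {k : ℝ} (hk : 0 ≤ k) : PQ (Qk k) (fun t => max (t - k) 0 / √(1 + max (t - k) 0 ^ 2)) (Pk k)
    (fun t => 2 * max (t - k) 0 / (1 + max (t - k) 0 ^ 2) ^ 2) := by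
  have hp : ∀ t, 0 < 1 + max (t - k) 0 ^ 2 := fun t => by positivity
  have hs : ∀ t, 0 < √(1 + max (t - k) 0 ^ 2) := fun t => Real.sqrt_pos.2 (hp t)
  have h0 : ∀ t, HasDerivAt (fun t => 1 + max (t - k) 0 ^ 2) (2 * max (t - k) 0) t := by
    intro t
    have h := ((hd_pp 0 (t - k)).comp t ((hasDerivAt_id t).sub_const k)).const_add 1
    exact h.congr_deriv (by norm_num)
  refine ⟨fun t => ?_, ?_, fun t => ?_, ?_, ?_, fun t _ => ?_, fun t _ => ?_, fun t => ?_⟩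
  · refine (((h0 t).sqrt (hp t).ne').sub_const 1).congr_deriv ?_
    have := (hs t).ne'
    field_simp
  · exact Continuous.div (by fun_prop) (by fun_prop) fun t => (hs t).ne'
  · refine (((h0 t).inv (hp t).ne').const_sub 1).congr_deriv ?_ |>.congr_of_eventuallyEq ?_
    · ring
    · exact Eventually.of_forall fun s => by simp [Pk]
  · exact Continuous.div (by fun_prop) (by fun_prop) fun t => by have := hp t; positivity
  · unfold Qk; rw [max_eq_right (by linarith)]; simp
  · unfold Qk
    rw [sub_nonneg, Real.one_le_sqrt]
    have : 0 ≤ max (t - k) 0 ^ 2 := by positivity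
    linarith
  · positivity
  · unfold Pk
    have := (hp t).ne'
    rw [div_pow, Real.sq_sqrt (hp t).le]
    field_simp; ring

lemma Qk_nonneg (k t : ℝ) : 0 ≤ Qk k t := by
  unfold Qk
  rw [sub_nonneg, Real.one_le_sqrt]
  have : 0 ≤ max (t - k) 0 ^ 2 := by positivity
  linarith

lemma Qk_zero {k t : ℝ} (h : t ≤ k) : Qk k t = 0 := by
  unfold Qk; rw [max_eq_right (by linarith)]; simp

lemma Qk_pos {k t : ℝ} (h : k < t) : 0 < Qk k t := by
  unfold Qk
  rw [max_eq_left (by linarith), sub_pos, Real.lt_sqrt (by norm_num)]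
  have : 0 < t - k := by linarith
  nlinarith [pow_pos this 2]

lemma Qk_anti {k k' : ℝ} (h : k ≤ k') (t : ℝ) : Qk k' t ≤ Qk k t := by
  unfold Qk
  have : max (t - k') 0 ≤ max (t - k) 0 := max_le_max (by linarith) le_rfl
  gcongr

lemma Qk_le {t : ℝ} (h : 0 ≤ t) : Qk 0 t ≤ t := by
  unfold Qk
  rw [sub_zero, max_eq_left h, sub_le_iff_le_add, Real.sqrt_le_left (by linarith)]
  nlinarith

lemma Pk_le (k t : ℝ) : 0 ≤ Pk k t ∧ Pk k t ≤ 1 := by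
  unfold Pk
  have h : 1 ≤ 1 + max (t - k) 0 ^ 2 := by
    have : 0 ≤ max (t - k) 0 ^ 2 := by positivity
    linarith
  have h2 : 1 / (1 + max (t - k) 0 ^ 2) ≤ 1 := by rw [div_le_one (by linarith)]; exact h
  have h3 : 0 ≤ 1 / (1 + max (t - k) 0 ^ 2) := by positivity
  constructor <;> linarith

lemma Pk_zero {k t : ℝ} (h : t ≤ k) : Pk k t = 0 := by
  unfold Pk; rw [max_eq_right (by linarith)]; simp

lemma Qk_low {K θ t : ℝ} (hK : 1 ≤ K) (hθ : 0 < θ) (hθ1 : θ ≤ 1) (h : K * (1 - θ / 2) < t) :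
    K * θ ^ 2 / 12 ≤ Qk (K * (1 - θ)) t := by
  unfold Qk
  have h1 : K * θ / 2 ≤ max (t - K * (1 - θ)) 0 := le_max_of_le_left (by nlinarith)
  have h2 : √(1 + (K * θ / 2) ^ 2) ≤ √(1 + max (t - K * (1 - θ)) 0 ^ 2) := by gcongr
  have h3 : 1 + K * θ ^ 2 / 12 ≤ √(1 + (K * θ / 2) ^ 2) := by
    apply Real.le_sqrt_of_sq_le
    have a1 : K * θ ^ 2 ≤ K ^ 2 * θ ^ 2 := by
      have : K ≤ K ^ 2 := by nlinarith
      gcongr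
    have a2 : (K * θ ^ 2) ^ 2 ≤ K ^ 2 * θ ^ 2 := by
      rw [mul_pow]
      have : (θ ^ 2) ^ 2 ≤ θ ^ 2 := by
        have h9 : θ ^ 2 ≤ 1 := pow_le_one₀ hθ.le hθ1
        nlinarith [sq_nonneg θ]
      gcongr
    nlinarith
  linarith

lemma hstep (n : ℕ) (d C₀ C₁ : ℝ) (hC : 1 ≤ C₀) (hC1 : 1 ≤ C₁) (hd : d < (n : ℝ) - 1) (hn : 2 ≤ n) :
    ∃ C : ℝ, 0 < C ∧ ∀ (Γ : Set (Euc n)) (x0 : Euc n) (r : ℝ) (u : Euc n → ℝ) (V B : Euc n → Euc n),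
      Dat n d C₀ Γ x0 r u V → Sup n d C₁ Γ x0 r V B →
      (∀ᵐ y ∂(sg n d Γ), y ∈ ball x0 (3.8 * r) → HasTraceAt u y 1) → ∀ ε : ℝ, 0 < ε →
      ∫⁻ x in closedBall x0 (1.2 * r), ofReal (Ph ε (u x) ^ 2 * weightW n d Γ x) ≤
        ofReal (C * r ^ (d + 1)) := by
  obtain ⟨CH, hCH, hH⟩ := hardy_loc n d C₀ hC hd
  obtain ⟨CM, hCM, hM⟩ := m_ball n d C₀ hC hn
  obtain ⟨L, hL, hLb⟩ := grad_cut_bound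
  refine ⟨1.21 ^ 2 * (CH * (4 * C₁ ^ 4 * ((L / 0.04) ^ 2 * (CM * 3.75 ^ (d + 1))))), by positivity, ?_⟩
  intro Γ x0 r u V B D H ht ε hε
  have hr := D.hr
  have G := D.G
  have hab : 3.7 * r < 3.74 * r := by linarith
  have ha : 0 < 3.7 * r := by linarith
  set φ := cut x0 (3.7 * r) (3.74 * r) with hφdef
  have hφ : ContDiff ℝ 1 φ := (cut_contDiff x0 _ _).of_le (by exact_mod_cast le_top)
  have hts : tsupport φ ⊆ closedBall x0 (3.74 * r) := cut_tsupport ha hab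
  have hφD : tsupport φ ⊆ ball x0 (3.75 * r) := hts.trans (closedBall_subset_ball (by linarith))
  have hφc : HasCompactSupport φ := cut_hcs ha hab
  obtain ⟨M, N⟩ := pq_id.nice hε
  have mω : Measurable (fun x : Euc n => infDist x Γ ^ (d - 1 - n)) := measurable_infDist.pow_const _
  have key := clos_ind D ht N hφ hφc (cut_nonneg x0 _ _) hφD
    (closed_ineq (d := d) (Γ := Γ) (ball x0 (3.63 * r / 3)) (closedBall x0 (3.65 * r)) mω (c := ofReal CH) ofReal_ne_top) (by
    intro F hF hFc hF0 hFD
    exact hH Γ G x0 D.hx0 (3.63 * r) (3.65 * r) (by linarith) (by linarith) F hF fun y hy hyF => (hFD hyF).2 hy)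
  have hcc := cacc D H ht pq_id hε hφ hφc (cut_nonneg x0 _ _) hφD
  simp only at key hcc
  have e1 : ∫⁻ x in closedBall x0 (3.65 * r), ofReal (‖Ph ε (u x) • gradient φ x + (φ x * (1 * Ph1 ε (u x))) • V x‖ ^ 2 * weightW n d Γ x)
      ≤ EN n d Γ (fun x => (φ x * (1 * Ph1 ε (u x))) • V x) := by
    refine le_trans (le_of_eq ?_) (setLIntegral_le_lintegral (closedBall x0 (3.65 * r)) _)
    refine setLIntegral_congr_fun measurableSet_closedBall fun x hx => ?_
    have : gradient φ x = 0 := grad_cut_zero ha hab (lt_of_le_of_lt hx (by linarith))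
    simp only
    rw [this, smul_zero, zero_add]
  have e2 : ∫⁻ x, ofReal (‖gradient φ x‖ ^ 2 * 1 * weightW n d Γ x) ≤
      ofReal ((L / (0.04 * r)) ^ 2) * ofReal (CM * (3.75 * r) ^ (d + 1)) := by
    refine le_trans ?_ (mul_le_mul_right (hM Γ G x0 D.hx0 (3.75 * r) (by linarith)) _)
    rw [← lcR _ _, ← lintegral_indicator measurableSet_ball]
    refine lintegral_mono fun x => ?_
    by_cases hx : x ∈ ball x0 (3.75 * r)
    · rw [indicator_of_mem hx, ← ofReal_mul (by positivity)]
      apply ofReal_le_ofReal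
      rw [mul_one]
      refine mul_le_mul_of_nonneg_right ?_ (w_nonneg x)
      have := hLb n x0 (3.7 * r) (3.74 * r) ha hab x
      rw [show 3.74 * r - 3.7 * r = 0.04 * r by ring] at this
      gcongr
    · rw [gz0 (fun h => hx (hφD h))]; simp
  calc _ ≤ ∫⁻ x in ball x0 (3.63 * r / 3), ofReal ((1.21 * r) ^ 2) * ofReal ((φ x * Ph ε (u x)) ^ 2 * infDist x Γ ^ (d - 1 - n)) := by
        have hsub : closedBall x0 (1.2 * r) ⊆ ball x0 (3.63 * r / 3) := closedBall_subset_ball (by linarith)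
        refine (lintegral_mono_set hsub).trans ?_
        refine lintegral_mono_ae ?_
        filter_upwards [ae_restrict_mem measurableSet_ball, ae_restrict_of_ae G.ae_notMem] with x hx hxΓ
        rw [← ofReal_mul (by positivity)]
        apply ofReal_le_ofReal
        have hx' : dist x x0 < 3.63 * r / 3 := hx
        have h1 : φ x = 1 := cut_eq_one ha hab (by linarith)
        have hδ : 0 < infDist x Γ := (G.cl.notMem_iff_infDist_pos G.ne).1 hxΓ
        have h2 : infDist x Γ ≤ 1.21 * r := (infDist_le_dist_of_mem D.hx0).trans (by linarith)
        have h3 : weightW n d Γ x = infDist x Γ ^ 2 * infDist x Γ ^ (d - 1 - n) := by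
          unfold weightW
          rw [← Real.rpow_natCast, ← Real.rpow_add hδ]
          congr 1; push_cast; ring
        rw [h1, one_mul, h3]
        have h4 : 0 ≤ infDist x Γ ^ (d - 1 - n) := by positivity
        calc _ = infDist x Γ ^ 2 * (Ph ε (u x) ^ 2 * infDist x Γ ^ (d - 1 - n)) := by ring
          _ ≤ _ := by gcongr
    _ = ofReal ((1.21 * r) ^ 2) * ∫⁻ x in ball x0 (3.63 * r / 3), ofReal ((φ x * Ph ε (u x)) ^ 2 * infDist x Γ ^ (d - 1 - n)) :=
        lcR _ _
    _ ≤ ofReal ((1.21 * r) ^ 2) * (ofReal CH * (ofReal (4 * C₁ ^ 4) * (ofReal ((L / (0.04 * r)) ^ 2) * ofReal (CM * (3.75 * r) ^ (d + 1))))) := by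
        refine mul_le_mul_right (key.trans (mul_le_mul_right (e1.trans (hcc.trans (mul_le_mul_right e2 _))) _)) _
    _ = _ := by
        rw [← ofReal_mul (by positivity), ← ofReal_mul (by positivity), ← ofReal_mul (by positivity),
          ← ofReal_mul (by positivity)]
        congr 1
        rw [Real.mul_rpow (by norm_num) hr.le]
        field_simp

lemma fkstep (n : ℕ) (d C₀ C₁ : ℝ) (hC : 1 ≤ C₀) (hC1 : 1 ≤ C₁) (hd : d < (n : ℝ) - 1) (hn : 2 ≤ n) :
    ∃ C : ℝ, 0 < C ∧ ∀ (Γ : Set (Euc n)) (x0 : Euc n) (r : ℝ) (u : Euc n → ℝ) (V B : Euc n → Euc n),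
      Dat n d C₀ Γ x0 r u V → Sup n d C₁ Γ x0 r V B →
      (∀ᵐ y ∂(sg n d Γ), y ∈ ball x0 (3.8 * r) → HasTraceAt u y 1) → ∀ ε : ℝ, 0 < ε →
      ∀ k a b : ℝ, 0 ≤ k → 0 < a → a < b → b < 2 * r → ∀ S, MeasurableSet S → S ⊆ closedBall x0 a →
      ∫⁻ x in S, ofReal (Qk k (Ph ε (u x)) ^ 2 * weightW n d Γ x) ≤
        ofReal (C * r) * (volume S) ^ (1 / (n : ℝ)) * (ofReal ((1 / (b - a)) ^ 2) *
        ∫⁻ x in closedBall x0 b, ofReal ((2 * Qk k (Ph ε (u x)) ^ 2 + 8 * C₁ ^ 4 * Pk k (Ph ε (u x))) * weightW n d Γ x)) := by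
  obtain ⟨CF, hCF, hF⟩ := fk n d C₀ hC hd hn
  obtain ⟨L, hL, hLb⟩ := grad_cut_bound
  refine ⟨CF * L ^ 2, by positivity, ?_⟩
  intro Γ x0 r u V B D H ht ε hε k a b hk ha hab hb S mS hS
  have hr := D.hr
  have G := D.G
  set φ := cut x0 a b with hφdef
  have hφ : ContDiff ℝ 1 φ := (cut_contDiff x0 _ _).of_le (by exact_mod_cast le_top)
  have hts : tsupport φ ⊆ closedBall x0 b := cut_tsupport ha hab
  have hφD2 : tsupport φ ⊆ ball x0 (2 * r) := hts.trans (closedBall_subset_ball (by linarith))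
  have hφD : tsupport φ ⊆ ball x0 (3.75 * r) := hφD2.trans (ball_subset_ball (by linarith))
  have hφc : HasCompactSupport φ := cut_hcs ha hab
  obtain ⟨M, N⟩ := (pq_k hk).nice hε
  have hvS : volume S ≠ ⊤ := ((measure_mono hS).trans_lt measure_closedBall_lt_top).ne
  have hc : ofReal (CF * r) * (volume S) ^ (1 / (n : ℝ)) ≠ ⊤ :=
    ENNReal.mul_ne_top ofReal_ne_top (ENNReal.rpow_ne_top_of_nonneg (by positivity) hvS)
  have key := clos_ind D ht N hφ hφc (cut_nonneg x0 _ _) hφD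
    (closed_ineq (d := d) (Γ := Γ) S univ (meas_w (n := n) (d := d) (Γ := Γ)) hc) (by
    intro F hF1 hFc hF0 hFD
    rw [Measure.restrict_univ]
    exact hF Γ G x0 D.hx0 r hr F hF1 hFc (fun x hx => hφD2 (hFD hx).1) (fun y hy hyF => (hFD hyF).2 hy) S mS)
  have hcc := cacc D H ht (pq_k hk) hε hφ hφc (cut_nonneg x0 _ _) hφD
  rw [Measure.restrict_univ] at key
  obtain ⟨mQ, mQ1⟩ := N.toNice.mQ D.u0 D.um
  have m2 := (((hφ.continuous.measurable).mul mQ1)).smul D.Vm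
  have e1 := EN_add (n := n) (d := d) (Γ := Γ) (g := fun x => Qk k (Ph ε (u x)) • gradient φ x) m2
  have hLx : ∀ x, ‖gradient φ x‖ ^ 2 ≤ L ^ 2 * (1 / (b - a)) ^ 2 := by
    intro x
    have := hLb n x0 a b ha hab x
    rw [← mul_pow, mul_one_div]
    gcongr
  have e3 : EN n d Γ (fun x => Qk k (Ph ε (u x)) • gradient φ x) = ∫⁻ x, ofReal (Qk k (Ph ε (u x)) ^ 2 * ‖gradient φ x‖ ^ 2 * weightW n d Γ x) := by
    unfold EN
    refine lintegral_congr fun x => ?_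
    rw [norm_smul, mul_pow, Real.norm_eq_abs, sq_abs]
  have e4 : 2 * EN n d Γ (fun x => Qk k (Ph ε (u x)) • gradient φ x) + 2 * (ofReal (4 * C₁ ^ 4) *
      ∫⁻ x, ofReal (‖gradient φ x‖ ^ 2 * Pk k (Ph ε (u x)) * weightW n d Γ x)) ≤
      ofReal (L ^ 2) * (ofReal ((1 / (b - a)) ^ 2) *
        ∫⁻ x in closedBall x0 b, ofReal ((2 * Qk k (Ph ε (u x)) ^ 2 + 8 * C₁ ^ 4 * Pk k (Ph ε (u x))) * weightW n d Γ x)) := by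
    have m3 : Measurable (fun x => 2 * ofReal (Qk k (Ph ε (u x)) ^ 2 * ‖gradient φ x‖ ^ 2 * weightW n d Γ x)) :=
      (((mQ.pow_const 2).mul ((meas_grad φ).norm.pow_const 2)).mul meas_w).ennreal_ofReal.const_mul 2
    rw [e3, ← lintegral_const_mul' _ _ (by simp), ← lcR _ _, ← lintegral_const_mul' _ _ (by simp),
      ← lcR _ _, ← lcR _ _, ← lintegral_add_left m3,
      ← lintegral_indicator measurableSet_closedBall]
    refine lintegral_mono fun x => ?_
    by_cases hx : x ∈ closedBall x0 b
    · rw [indicator_of_mem hx]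
      have hP := (Pk_le k (Ph ε (u x))).1
      have hw : 0 ≤ weightW n d Γ x := w_nonneg x
      have h2 : ∀ z : ℝ, 2 * ofReal z = ofReal (2 * z) := fun z => by
        rw [ofReal_mul (by norm_num)]; simp
      simp only [h2]
      rw [← ofReal_mul (by positivity), ← ofReal_mul (by positivity), ← ofReal_mul (by positivity), h2, ← ofReal_add (by positivity) (by positivity)]
      apply ofReal_le_ofReal
      calc _ = ‖gradient φ x‖ ^ 2 * ((2 * Qk k (Ph ε (u x)) ^ 2 + 8 * C₁ ^ 4 * Pk k (Ph ε (u x))) * weightW n d Γ x) := by ring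
        _ ≤ L ^ 2 * (1 / (b - a)) ^ 2 * ((2 * Qk k (Ph ε (u x)) ^ 2 + 8 * C₁ ^ 4 * Pk k (Ph ε (u x))) * weightW n d Γ x) :=
            mul_le_mul_of_nonneg_right (hLx x) (by positivity)
        _ = _ := by ring
    · rw [gz0 (fun h => hx (hts h))]; simp
  calc _ = ∫⁻ x in S, ofReal ((φ x * Qk k (Ph ε (u x))) ^ 2 * weightW n d Γ x) := by
        refine setLIntegral_congr_fun mS fun x hx => ?_
        have : φ x = 1 := cut_eq_one ha hab (hS hx)
        rw [this, one_mul]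
    _ ≤ _ := key
    _ ≤ ofReal (CF * r) * (volume S) ^ (1 / (n : ℝ)) * (ofReal (L ^ 2) * (ofReal ((1 / (b - a)) ^ 2) *
        ∫⁻ x in closedBall x0 b, ofReal ((2 * Qk k (Ph ε (u x)) ^ 2 + 8 * C₁ ^ 4 * Pk k (Ph ε (u x))) * weightW n d Γ x))) := by
        refine mul_le_mul_right (e1.trans (le_trans ?_ e4)) _
        exact add_le_add le_rfl (mul_le_mul_right hcc 2)
    _ = _ := by
        rw [show CF * L ^ 2 * r = CF * r * L ^ 2 by ring, ofReal_mul (p := CF * r) (by positivity)]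
        ring

def Yf (n : ℕ) (d : ℝ) (Γ : Set (Euc n)) (x0 : Euc n) (r : ℝ) (u : Euc n → ℝ) (ε K θ : ℝ) : ℝ≥0∞ :=
  ∫⁻ x in closedBall x0 (r * (1 + 0.2 * θ)), ofReal (Qk (K * (1 - θ)) (Ph ε (u x)) ^ 2 * weightW n d Γ x)

lemma dgstep (n : ℕ) (d C₀ C₁ : ℝ) (hC : 1 ≤ C₀) (hC1 : 1 ≤ C₁) (hd : d < (n : ℝ) - 1) (hn : 2 ≤ n) :
    ∃ C : ℝ, 0 < C ∧ ∀ (Γ : Set (Euc n)) (x0 : Euc n) (r : ℝ) (u : Euc n → ℝ) (V B : Euc n → Euc n),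
      Dat n d C₀ Γ x0 r u V → Sup n d C₁ Γ x0 r V B →
      (∀ᵐ y ∂(sg n d Γ), y ∈ ball x0 (3.8 * r) → HasTraceAt u y 1) → ∀ ε : ℝ, 0 < ε →
      ∀ K θ y : ℝ, 1 ≤ K → 0 < θ → θ ≤ 1 → 0 < y → Yf n d Γ x0 r u ε K θ ≤ ofReal (y * r ^ (d + 1)) →
        Yf n d Γ x0 r u ε K (θ / 2) ≤ ofReal (C * (1 / θ) ^ 10 * (y / K ^ 2) ^ (1 / (n : ℝ)) * y * r ^ (d + 1)) := by
  obtain ⟨CF, hCF, hF⟩ := fkstep n d C₀ C₁ hC hC1 hd hn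
  refine ⟨CF * (144 * 2 ^ ((n : ℝ) - 1 - d)) * (100 * (2 + 1152 * C₁ ^ 4)), by positivity, ?_⟩
  intro Γ x0 r u V B D H ht ε hε K θ y hK hθ hθ1 hy hY
  have hr := D.hr
  have G := D.G
  have hn0 : (0 : ℝ) < n := by positivity
  set ν := K * θ ^ 2 / 12 with hν
  have hν0 : 0 < ν := by positivity
  obtain ⟨M, N⟩ := pq_id.nice hε
  have mh : Measurable (fun x => Ph ε (u x)) := (N.toNice.mQ D.u0 D.um).1
  set h := fun x => Ph ε (u x) with hh
  set T : Set (Euc n) := {x | K * (1 - θ / 2) < h x} with hT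
  have mT : MeasurableSet T := measurableSet_lt measurable_const mh
  set a := r * (1 + 0.2 * (θ / 2)) with ha
  set b := r * (1 + 0.2 * θ) with hb
  have ha0 : 0 < a := by positivity
  have hba : b - a = 0.1 * θ * r := by rw [ha, hb]; ring
  have hab : a < b := by
    have : 0 < 0.1 * θ * r := by positivity
    linarith
  have hb2 : b < 2 * r := by rw [hb]; nlinarith
  set S := closedBall x0 a ∩ T with hS
  have mS : MeasurableSet S := measurableSet_closedBall.inter mT
  have hk : 0 ≤ K * (1 - θ / 2) := mul_nonneg (by linarith) (by linarith)
  have hvol : volume S ≤ ofReal (ν⁻¹ ^ 2 * (2 * r) ^ ((n : ℝ) - 1 - d) * (y * r ^ (d + 1))) := by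
    calc volume S = ∫⁻ x in S, 1 := by simp
      _ ≤ ∫⁻ x in S, ofReal (ν⁻¹ ^ 2 * (2 * r) ^ ((n : ℝ) - 1 - d)) * ofReal (Qk (K * (1 - θ)) (h x) ^ 2 * weightW n d Γ x) := by
          refine lintegral_mono_ae ?_
          filter_upwards [ae_restrict_mem mS, ae_restrict_of_ae G.ae_notMem] with x hx hxΓ
          rw [← ofReal_mul (by positivity), ENNReal.one_le_ofReal]
          have h1 : ν ≤ Qk (K * (1 - θ)) (h x) := Qk_low hK hθ hθ1 hx.2
          have hδ : 0 < infDist x Γ := (G.cl.notMem_iff_infDist_pos G.ne).1 hxΓ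
          have h2 : infDist x Γ ≤ 2 * r := (infDist_le_dist_of_mem D.hx0).trans ((mem_closedBall.1 hx.1).trans (by linarith))
          have h3 : (2 * r) ^ (d + 1 - (n : ℝ)) ≤ weightW n d Γ x :=
            Real.rpow_le_rpow_of_nonpos hδ h2 (by linarith)
          have h4 : (2 * r) ^ ((n : ℝ) - 1 - d) * (2 * r) ^ (d + 1 - (n : ℝ)) = 1 := by
            rw [← Real.rpow_add (by linarith)]; ring_nf; simp
          calc (1 : ℝ) = (ν⁻¹ ^ 2 * (2 * r) ^ ((n : ℝ) - 1 - d)) * (ν ^ 2 * (2 * r) ^ (d + 1 - (n : ℝ))) := by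
                have : ν⁻¹ * ν = 1 := inv_mul_cancel₀ hν0.ne'
                linear_combination (-1 : ℝ) * h4 - (2 * r) ^ ((n : ℝ) - 1 - d) * (2 * r) ^ (d + 1 - (n : ℝ)) * (ν⁻¹ * ν + 1) * this
            _ ≤ _ := by gcongr
      _ = ofReal (ν⁻¹ ^ 2 * (2 * r) ^ ((n : ℝ) - 1 - d)) * ∫⁻ x in S, ofReal (Qk (K * (1 - θ)) (h x) ^ 2 * weightW n d Γ x) :=
          lcR _ _
      _ ≤ ofReal (ν⁻¹ ^ 2 * (2 * r) ^ ((n : ℝ) - 1 - d)) * ofReal (y * r ^ (d + 1)) := by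
          refine mul_le_mul_right (le_trans ?_ hY) _
          exact lintegral_mono_set (inter_subset_left.trans (closedBall_subset_closedBall hab.le))
      _ = _ := by rw [← ofReal_mul (by positivity)]
  have hvol2 : (volume S) ^ (1 / (n : ℝ)) ≤ ofReal (144 * 2 ^ ((n : ℝ) - 1 - d) * (1 / θ) ^ 4 * (y / K ^ 2) ^ (1 / (n : ℝ)) * r) := by
    refine (ENNReal.rpow_le_rpow hvol (by positivity)).trans ?_
    rw [ofReal_rpow_of_nonneg (by positivity) (by positivity)]
    apply ofReal_le_ofReal
    have e1 : ν⁻¹ ^ 2 * (2 * r) ^ ((n : ℝ) - 1 - d) * (y * r ^ (d + 1)) =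
        (144 * 2 ^ ((n : ℝ) - 1 - d) * (1 / θ) ^ 4) * (y / K ^ 2) * r ^ (n : ℝ) := by
      have e0 : r ^ ((n : ℝ) - 1 - d) * r ^ (d + 1) = r ^ (n : ℝ) := by
        rw [← Real.rpow_add hr]; congr 1; ring
      rw [Real.mul_rpow (by norm_num) hr.le, ← e0, hν]
      generalize r ^ ((n : ℝ) - 1 - d) = A
      generalize r ^ (d + 1) = B'
      field_simp; norm_num; ring
    rw [e1, Real.mul_rpow (by positivity) (by positivity), Real.mul_rpow (by positivity) (by positivity), ← Real.rpow_mul hr.le,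
      mul_one_div_cancel hn0.ne', Real.rpow_one]
    refine mul_le_mul_of_nonneg_right (mul_le_mul_of_nonneg_right ?_ (by positivity)) hr.le
    have h1 : 1 ≤ 144 * 2 ^ ((n : ℝ) - 1 - d) * (1 / θ) ^ 4 := by
      have b1 : (1 : ℝ) ≤ 2 ^ ((n : ℝ) - 1 - d) := Real.one_le_rpow (by norm_num) (by linarith)
      have b2 : 1 ≤ (1 / θ) ^ 4 := one_le_pow₀ (by rw [le_div_iff₀ hθ]; linarith)
      nlinarith
    have h2 : 1 / (n : ℝ) ≤ 1 := by
      rw [div_le_one hn0]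
      have : (2 : ℝ) ≤ n := by exact_mod_cast hn
      linarith
    calc _ ≤ (144 * 2 ^ ((n : ℝ) - 1 - d) * (1 / θ) ^ 4) ^ (1 : ℝ) := Real.rpow_le_rpow_of_exponent_le h1 h2
      _ = _ := Real.rpow_one _
  have e2 : ∫⁻ x in closedBall x0 b, ofReal ((2 * Qk (K * (1 - θ / 2)) (h x) ^ 2 + 8 * C₁ ^ 4 * Pk (K * (1 - θ / 2)) (h x)) * weightW n d Γ x)
      ≤ ofReal ((2 + 1152 * C₁ ^ 4) * (1 / θ) ^ 4) * ofReal (y * r ^ (d + 1)) := by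
    refine le_trans ?_ (mul_le_mul_right hY _)
    unfold Yf
    rw [← lcR _ _]
    refine lintegral_mono fun x => ?_
    rw [← ofReal_mul (by positivity)]
    apply ofReal_le_ofReal
    rw [← mul_assoc]
    refine mul_le_mul_of_nonneg_right ?_ (w_nonneg x)
    have q0 := Qk_nonneg (K * (1 - θ / 2)) (h x)
    have q1 : Qk (K * (1 - θ / 2)) (h x) ≤ Qk (K * (1 - θ)) (h x) := Qk_anti (by nlinarith) _
    have q2 : Qk (K * (1 - θ / 2)) (h x) ^ 2 ≤ Qk (K * (1 - θ)) (h x) ^ 2 := by gcongr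
    have b2 : 1 ≤ (1 / θ) ^ 4 := one_le_pow₀ (by rw [le_div_iff₀ hθ]; linarith)
    have b3 : 0 ≤ Qk (K * (1 - θ)) (h x) ^ 2 := sq_nonneg _
    have q3 : Pk (K * (1 - θ / 2)) (h x) ≤ 144 * (1 / θ) ^ 4 * Qk (K * (1 - θ)) (h x) ^ 2 := by
      by_cases hx : h x ≤ K * (1 - θ / 2)
      · rw [Pk_zero hx]; positivity
      · push Not at hx
        have h1 : ν ≤ Qk (K * (1 - θ)) (h x) := Qk_low hK hθ hθ1 hx
        refine (Pk_le _ _).2.trans ?_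
        calc (1 : ℝ) ≤ K ^ 2 := one_le_pow₀ hK
          _ = 144 * (1 / θ) ^ 4 * ν ^ 2 := by rw [hν]; field_simp; norm_num
          _ ≤ _ := by gcongr
    have c4 : 0 ≤ C₁ ^ 4 := by positivity
    calc _ ≤ 2 * Qk (K * (1 - θ)) (h x) ^ 2 * (1 / θ) ^ 4 + 8 * C₁ ^ 4 * (144 * (1 / θ) ^ 4 * Qk (K * (1 - θ)) (h x) ^ 2) := by
          refine add_le_add ?_ (mul_le_mul_of_nonneg_left q3 (by positivity))
          nlinarith
      _ = _ := by simp only [hh]; ring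
  have e3 : Yf n d Γ x0 r u ε K (θ / 2) ≤ ∫⁻ x in S, ofReal (Qk (K * (1 - θ / 2)) (h x) ^ 2 * weightW n d Γ x) := by
    unfold Yf
    rw [← lintegral_indicator measurableSet_closedBall, ← lintegral_indicator mS]
    refine lintegral_mono fun x => ?_
    by_cases hx : x ∈ closedBall x0 a
    · rw [indicator_of_mem hx]
      by_cases hxT : x ∈ T
      · rw [indicator_of_mem (show x ∈ S from ⟨hx, hxT⟩)]
      · have : Ph ε (u x) ≤ K * (1 - θ / 2) := not_lt.1 hxT
        rw [Qk_zero this]; simp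
    · rw [indicator_of_notMem hx]; exact zero_le
  refine e3.trans ((hF Γ x0 r u V B D H ht ε hε (K * (1 - θ / 2)) a b hk ha0 hab hb2 S mS inter_subset_left).trans ?_)
  calc _ ≤ ofReal (CF * r) * ofReal (144 * 2 ^ ((n : ℝ) - 1 - d) * (1 / θ) ^ 4 * (y / K ^ 2) ^ (1 / (n : ℝ)) * r) *
        (ofReal ((1 / (b - a)) ^ 2) * (ofReal ((2 + 1152 * C₁ ^ 4) * (1 / θ) ^ 4) * ofReal (y * r ^ (d + 1)))) := by
        exact mul_le_mul' (mul_le_mul' le_rfl hvol2) (mul_le_mul' le_rfl e2)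
    _ = _ := by
        rw [← ofReal_mul (by positivity), ← ofReal_mul (by positivity), ← ofReal_mul (by positivity),
          ← ofReal_mul (by positivity), hba]
        congr 1
        field_simp
        norm_num

lemma dgfin (n : ℕ) (d C₀ C₁ : ℝ) (hC : 1 ≤ C₀) (hC1 : 1 ≤ C₁) (hd : d < (n : ℝ) - 1) (hn : 2 ≤ n) :
    ∃ c : ℝ, 0 < c ∧ ∀ (Γ : Set (Euc n)) (x0 : Euc n) (r : ℝ) (u : Euc n → ℝ) (V B : Euc n → Euc n),
      Dat n d C₀ Γ x0 r u V → Sup n d C₁ Γ x0 r V B →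
      (∀ᵐ y ∂(sg n d Γ), y ∈ ball x0 (3.8 * r) → HasTraceAt u y 1) →
      ∀ᵐ x, x ∈ ball x0 r → c ≤ u x := by
  obtain ⟨C0, hC0, hH⟩ := hstep n d C₀ C₁ hC hC1 hd hn
  obtain ⟨Cd, hCd, hD⟩ := dgstep n d C₀ C₁ hC hC1 hd hn
  have hn0 : (0 : ℝ) < n := by positivity
  set K := 1 + C0 * (Cd * 1024 ^ n) ^ n with hKdef
  have hK : 1 ≤ K := by
    have : 0 < C0 * (Cd * 1024 ^ n) ^ n := by positivity
    linarith
  have hKn : Cd * (C0 / K ^ 2) ^ (1 / (n : ℝ)) ≤ (1 / 1024) ^ n := by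
    have h1 : C0 / K ^ 2 ≤ ((Cd * 1024 ^ n)⁻¹) ^ n := by
      rw [inv_pow, div_le_iff₀ (by positivity), inv_mul_eq_div, le_div_iff₀ (by positivity)]
      nlinarith
    have h2 : (C0 / K ^ 2) ^ (1 / (n : ℝ)) ≤ (Cd * 1024 ^ n)⁻¹ := by
      refine (Real.rpow_le_rpow (by positivity) h1 (by positivity)).trans (le_of_eq ?_)
      rw [one_div, Real.pow_rpow_inv_natCast (by positivity) (by omega)]
    refine (mul_le_mul_of_nonneg_left h2 hCd.le).trans (le_of_eq ?_)
    rw [one_div, inv_pow]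
    field_simp
  set κ := Real.exp (-K) ^ 2 with hκ
  have hE1 : Real.exp (-K) < 1 := by rw [Real.exp_lt_one_iff]; linarith
  have hE0 : 0 < Real.exp (-K) := Real.exp_pos _
  refine ⟨κ / 3, by positivity, ?_⟩
  intro Γ x0 r u V B D H ht
  have hr := D.hr
  have G := D.G
  set ε := Real.exp (-K) with hε
  have hY : ∀ j : ℕ, Yf n d Γ x0 r u ε K ((1 / 2) ^ j) ≤ ofReal (C0 * ((1 / 1024) ^ n) ^ j * r ^ (d + 1)) := by
    intro j
    induction j with
    | zero =>
      simp only [pow_zero, mul_one]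
      refine le_trans ?_ (hH Γ x0 r u V B D H ht ε hE0)
      unfold Yf
      rw [show r * (1 + 0.2 * 1) = 1.2 * r by ring, sub_self, mul_zero]
      refine lintegral_mono fun x => ofReal_le_ofReal ?_
      refine mul_le_mul_of_nonneg_right ?_ (w_nonneg x)
      have := Qk_nonneg 0 (Ph ε (u x))
      have := Qk_le (Ph_nonneg hE0 (D.u0 x))
      gcongr
    | succ j ih =>
      have h1 := hD Γ x0 r u V B D H ht ε hE0 K ((1 / 2) ^ j) (C0 * ((1 / 1024) ^ n) ^ j) hK (by positivity)
        (pow_le_one₀ (by norm_num) (by norm_num)) (by positivity) ih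
      rw [show ((1 : ℝ) / 2) ^ j / 2 = (1 / 2) ^ (j + 1) by rw [pow_succ]; ring] at h1
      refine h1.trans (ofReal_le_ofReal ?_)
      refine mul_le_mul_of_nonneg_right ?_ (by positivity)
      have e1 : ((1 : ℝ) / (1 / 2) ^ j) ^ 10 = 1024 ^ j := by
        rw [one_div_pow (2 : ℝ) j, one_div_one_div, ← pow_mul, mul_comm, pow_mul]; norm_num
      have e2 : (C0 * ((1 / 1024) ^ n) ^ j / K ^ 2) ^ (1 / (n : ℝ)) = (C0 / K ^ 2) ^ (1 / (n : ℝ)) * (1 / 1024) ^ j := by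
        rw [show C0 * ((1 / 1024) ^ n) ^ j / K ^ 2 = C0 / K ^ 2 * (((1 / 1024) ^ j) ^ n) by rw [← pow_mul, ← pow_mul, mul_comm n j]; ring,
          Real.mul_rpow (by positivity) (by positivity), one_div (n : ℝ), Real.pow_rpow_inv_natCast (by positivity) (by omega)]
      have e3 : (1024 : ℝ) ^ j * (1 / 1024) ^ j = 1 := by rw [← mul_pow]; norm_num
      rw [e1, e2]
      calc _ = (Cd * (C0 / K ^ 2) ^ (1 / (n : ℝ))) * (1024 ^ j * (1 / 1024) ^ j) * (C0 * ((1 / 1024) ^ n) ^ j) := by ring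
        _ ≤ (1 / 1024) ^ n * 1 * (C0 * ((1 / 1024) ^ n) ^ j) := by rw [e3]; gcongr
        _ = _ := by rw [pow_succ]; ring
  obtain ⟨M, N⟩ := pq_id.nice (ε := ε) hE0
  have mh : Measurable (fun x => Ph ε (u x)) := (N.toNice.mQ D.u0 D.um).1
  have mI : Measurable (fun x => ofReal (Qk K (Ph ε (u x)) ^ 2 * weightW n d Γ x)) := by
    have c1 : Continuous (Qk K) := by unfold Qk; fun_prop
    exact (((c1.measurable.comp mh).pow_const 2).mul meas_w).ennreal_ofReal
  have hzero : ∫⁻ x in ball x0 r, ofReal (Qk K (Ph ε (u x)) ^ 2 * weightW n d Γ x) = 0 := by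
    have hle : ∀ j : ℕ, ∫⁻ x in ball x0 r, ofReal (Qk K (Ph ε (u x)) ^ 2 * weightW n d Γ x) ≤
        ofReal (C0 * ((1 / 1024) ^ n) ^ j * r ^ (d + 1)) := by
      intro j
      refine le_trans ?_ (hY j)
      unfold Yf
      have hp : (0 : ℝ) < (1 / 2) ^ j := by positivity
      have hsub : ball x0 r ⊆ closedBall x0 (r * (1 + 0.2 * (1 / 2) ^ j)) :=
        ball_subset_closedBall.trans (closedBall_subset_closedBall (by nlinarith))
      refine (lintegral_mono_set hsub).trans (lintegral_mono fun x => ofReal_le_ofReal ?_)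
      refine mul_le_mul_of_nonneg_right ?_ (w_nonneg x)
      have := Qk_nonneg K (Ph ε (u x))
      have : Qk K (Ph ε (u x)) ≤ Qk (K * (1 - (1 / 2) ^ j)) (Ph ε (u x)) := Qk_anti (by nlinarith) _
      gcongr
    have ht : Tendsto (fun j : ℕ => ofReal (C0 * ((1 / 1024) ^ n) ^ j * r ^ (d + 1))) atTop (𝓝 (ofReal (C0 * 0 * r ^ (d + 1)))) := by
      refine (ENNReal.continuous_ofReal.tendsto _).comp ?_
      refine (Tendsto.const_mul _ (tendsto_pow_atTop_nhds_zero_of_lt_one (by positivity) ?_)).mul_const _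
      exact pow_lt_one₀ (by norm_num) (by norm_num) (by omega)
    have := ge_of_tendsto' ht hle
    simpa using this
  rw [lintegral_eq_zero_iff mI] at hzero
  have h2 := (ae_restrict_iff' measurableSet_ball).1 hzero
  filter_upwards [h2, G.ae_notMem] with x hx hxΓ hxb
  have hx1 := hx hxb
  simp only [Pi.zero_apply, ofReal_eq_zero] at hx1
  have hδ : 0 < infDist x Γ := (G.cl.notMem_iff_infDist_pos G.ne).1 hxΓ
  have hw : 0 < weightW n d Γ x := Real.rpow_pos_of_pos hδ _
  have hhK : Ph ε (u x) ≤ K := by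
    by_contra hcon
    push Not at hcon
    have := Qk_pos hcon
    have : 0 < Qk K (Ph ε (u x)) ^ 2 * weightW n d Γ x := by positivity
    linarith
  have hu := D.u0 x
  have hz := zt_pos hE0 hu
  unfold Ph at hhK
  have h3 : (1 + ε) * ε ≤ zt ε (u x) := by
    rw [← Real.log_le_log_iff (by positivity) hz, Real.log_mul (by positivity) (by positivity)]
    rw [show Real.log ε = -K by rw [hε, Real.log_exp]]
    linarith
  unfold zt at h3
  by_contra hcon
  push Not at hcon
  have h4 : 1 - κ / 3 < max (1 - u x) 0 := lt_max_of_lt_left (by linarith)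
  have hκ1 : κ < 1 := pow_lt_one₀ hE0.le hE1 (by norm_num)
  have hκ0 : 0 < κ := by positivity
  have h5 : (1 - κ / 3) ^ 3 < max (1 - u x) 0 ^ 3 := pow_lt_pow_left₀ h4 (by linarith) (by norm_num)
  have h6 : 1 - κ ≤ (1 - κ / 3) ^ 3 := by nlinarith [sq_nonneg κ, mul_pos hκ0 hκ0]
  nlinarith

lemma WG.of_distrib {E : Set (Euc n)} (h : IsDistribGradOn u v E) :
    WG u v E := by
  intro φ h1 h2 h3
  have := h φ h1 h2 h3
  rwa [setIntegral_eq_integral_of_forall_compl_eq_zero, setIntegral_eq_integral_of_forall_compl_eq_zero] at this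
  · intro x hx
    rw [image_eq_zero_of_notMem_tsupport fun h => hx (h3 h), zero_smul]
  · intro x hx
    rw [gz0 fun h => hx (h3 h), smul_zero]

lemma WG.mono {E U : Set (Euc n)} (h : WG u v E) (hU : U ⊆ E) :
    WG u v U := fun φ h1 h2 h3 => h φ h1 h2 (h3.trans hU)

lemma WG.congr {u u' : Euc n → ℝ} {v v' : Euc n → Euc n} (h : WG u v U)
    (hu : ∀ᵐ x, x ∈ U → u' x = u x) (hv : ∀ᵐ x, x ∈ U → v' x = v x) : WG u' v' U := by
  intro φ h1 h2 h3
  have e1 : ∫ x, u' x • gradient φ x = ∫ x, u x • gradient φ x := by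
    refine integral_congr_ae ?_
    filter_upwards [hu] with x hx
    by_cases h : x ∈ tsupport φ
    · rw [hx (h3 h)]
    · rw [gz0 h, smul_zero, smul_zero]
  have e2 : ∫ x, φ x • v' x = ∫ x, φ x • v x := by
    refine integral_congr_ae ?_
    filter_upwards [hv] with x hx
    by_cases h : x ∈ tsupport φ
    · rw [hx (h3 h)]
    · rw [image_eq_zero_of_notMem_tsupport h, zero_smul, zero_smul]
  rw [e1, e2]; exact h φ h1 h2 h3

lemma li_smul_grad {E : Set (Euc n)} (hu : LocallyIntegrableOn u E) {φ : Euc n → ℝ}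
    (h1 : ContDiff ℝ (⊤ : ℕ∞) φ) (h2 : HasCompactSupport φ) (h3 : tsupport φ ⊆ E) :
    Integrable fun x => u x • gradient φ x := by
  have hk := hu.integrableOn_compact_subset h3 h2
  have := hk.smul_continuousOn (continuous_grad (h1.of_le (by exact_mod_cast le_top))).continuousOn h2
  refine (integrableOn_iff_integrable_of_support_subset ?_).1 this
  intro x hx
  by_contra h
  exact hx (by simp only [gz0 h, smul_zero])

lemma li_smul {E : Set (Euc n)} (hu : LocallyIntegrableOn v E) {φ : Euc n → ℝ}
    (h1 : ContDiff ℝ (⊤ : ℕ∞) φ) (h2 : HasCompactSupport φ) (h3 : tsupport φ ⊆ E) :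
    Integrable fun x => φ x • v x := by
  have hk := hu.integrableOn_compact_subset h3 h2
  have := hk.continuousOn_smul h1.continuous.continuousOn h2
  refine (integrableOn_iff_integrable_of_support_subset ?_).1 this
  intro x hx
  by_contra h
  exact hx (by simp only [image_eq_zero_of_notMem_tsupport h, zero_smul])

lemma WG.bad {E : Set (Euc n)} (h : WG u v E)
    (hu : LocallyIntegrableOn u E) {χ : Euc n → ℝ} (h1 : ContDiff ℝ (⊤ : ℕ∞) χ) (h2 : HasCompactSupport χ)
    (h3 : tsupport χ ⊆ E) (hb : ¬ Integrable fun x => χ x • v x) : WG u (fun _ => 0) E := by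
  intro ψ g1 g2 g3
  simp only [smul_zero, integral_zero, neg_zero]
  by_cases hi : Integrable fun x => ψ x • v x
  · have a1 : ∫ x, u x • gradient χ x = 0 := by rw [h χ h1 h2 h3, integral_undef hb, neg_zero]
    have s3 : tsupport (ψ + χ) ⊆ E := (tsupport_add ψ χ).trans (union_subset g3 h3)
    have hb2 : ¬ Integrable fun x => (ψ + χ) x • v x := by
      intro hh
      refine hb ((hh.sub hi).congr (Eventually.of_forall fun x => ?_))
      simp [add_smul]
    have a2 : ∫ x, u x • gradient (ψ + χ) x = 0 := by
      rw [h (ψ + χ) (g1.add h1) (g2.add h2) s3, integral_undef hb2, neg_zero]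
    have e : ∀ x, u x • gradient (ψ + χ) x = u x • gradient ψ x + u x • gradient χ x := fun x => by
      rw [← smul_add]; congr 1
      have d1 : DifferentiableAt ℝ ψ x := g1.differentiable (by simp) x
      have d2 : DifferentiableAt ℝ χ x := h1.differentiable (by simp) x
      unfold gradient
      rw [fderiv_add d1 d2, map_add]
    simp only [e] at a2
    rw [integral_add (li_smul_grad hu g1 g2 g3) (li_smul_grad hu h1 h2 h3), a1, add_zero] at a2
    exact a2
  · rw [h ψ g1 g2 g3, integral_undef hi, neg_zero]

lemma good_li {E : Set (Euc n)} (hE : IsOpen E)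
    (h : ∀ χ : Euc n → ℝ, ContDiff ℝ (⊤ : ℕ∞) χ → HasCompactSupport χ → tsupport χ ⊆ E →
      Integrable fun x => χ x • v x) : LocallyIntegrableOn v E := by
  intro x hx
  obtain ⟨ε, hε, hb⟩ := Metric.isOpen_iff.1 hE x hx
  have i := h (cut x (ε / 4) (ε / 2)) (cut_contDiff _ _ _) (cut_hcs (by linarith) (by linarith))
    ((cut_tsupport (by linarith) (by linarith)).trans ((closedBall_subset_ball (by linarith)).trans hb))
  refine ⟨ball x (ε / 4), mem_nhdsWithin_of_mem_nhds (ball_mem_nhds x (by linarith)), ?_⟩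
  refine i.integrableOn.congr_fun (fun y hy => ?_) measurableSet_ball
  show cut x (ε / 4) (ε / 2) y • v y = v y
  rw [cut_eq_one (by linarith) (by linarith) (le_of_lt hy), one_smul]

lemma WG.uniq {v v' : Euc n → Euc n} (hU : IsOpen U)
    (h : WG u v U) (h' : WG u v' U) (hv : LocallyIntegrableOn v U) (hv' : LocallyIntegrableOn v' U) :
    ∀ᵐ x, x ∈ U → v x = v' x := by
  have := IsOpen.ae_eq_zero_of_integral_contDiff_smul_eq_zero (μ := volume) hU (f := fun x => v x - v' x)
    (hv.sub hv') (fun g g1 g2 g3 => ?_)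
  · filter_upwards [this] with x hx hxU using sub_eq_zero.1 (hx hxU)
  · simp only [smul_sub]
    have g1' : ContDiff ℝ (⊤ : ℕ∞) g := g1
    rw [integral_sub (li_smul hv g1' g2 g3) (li_smul hv' g1' g2 g3)]
    have e1 := h g g1' g2 g3
    have e2 := h' g g1' g2 g3
    rw [e1] at e2
    rw [neg_inj.1 e2, sub_self]

lemma trace_congr {u u' : Euc n → ℝ} {D : Set (Euc n)} (hD : IsOpen D) (h : ∀ᵐ x, x ∈ D → u' x = u x)
    {y : Euc n} (hy : y ∈ D) {t : ℝ} (ht : HasTraceAt u y t) : HasTraceAt u' y t := by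
  obtain ⟨ε, hε, hb⟩ := Metric.isOpen_iff.1 hD y hy
  refine Tendsto.congr' ?_ ht
  filter_upwards [Ioo_mem_nhdsGT hε] with ρ hρ
  rw [setAverage_eq, setAverage_eq]
  congr 1
  refine setIntegral_congr_ae measurableSet_ball ?_
  filter_upwards [h] with x hx hx2
  exact (hx (hb (ball_subset_ball hρ.2.le hx2))).symm

lemma mk_data (G : Geo n d C₀ Γ) (hC₁ : 1 ≤ C₁)
    {A : Euc n → Euc n →L[ℝ] Euc n} (hA : AEStronglyMeasurable A volume) (hE : EllipticOn n d Γ A C₁)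
    {x : Euc n} (hx : x ∈ Γ) {r : ℝ} (hr : 0 < r) {u : Euc n → ℝ} {v : Euc n → Euc n}
    (hW : MemWrOn n d Γ (ball x (4 * r)) u) (hg : IsDistribGradOn u v (ball x (4 * r) \ Γ))
    (hs : SupersolOn Γ A v (ball x (4 * r) \ Γ)) {u' : Euc n → ℝ} (u0 : ∀ y, 0 ≤ u' y) (um : Measurable u')
    (ui : Integrable u') (hu : ∀ᵐ y, y ∈ ball x (3.8 * r) → u' y = u y) :
    ∃ V B, Dat n d C₀ Γ x r u' V ∧ Sup n d C₁ Γ x r V B := by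
  have hsub : ball x (3.8 * r) \ Γ ⊆ ball x (4 * r) \ Γ :=
    diff_subset_diff_left (ball_subset_ball (by linarith))
  have hUo : IsOpen (ball x (3.8 * r) \ Γ) := isOpen_ball.sdiff G.cl
  have hEo : IsOpen (ball x (4 * r) \ Γ) := isOpen_ball.sdiff G.cl
  have hWG := WG.of_distrib hg
  have huU : ∀ᵐ y, y ∈ ball x (3.8 * r) \ Γ → u' y = u y := by
    filter_upwards [hu] with y hy h using hy h.1
  by_cases hgood : ∀ χ : Euc n → ℝ, ContDiff ℝ (⊤ : ℕ∞) χ → HasCompactSupport χ → tsupport χ ⊆ ball x (4 * r) \ Γ →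
      Integrable fun x => χ x • v x
  swap
  · push Not at hgood
    obtain ⟨χ, h1, h2, h3, hb⟩ := hgood
    have hz := (hWG.bad (hW.1.mono_set diff_subset) h1 h2 h3 hb).mono hsub
    refine ⟨fun _ => 0, fun _ => 0, ⟨G, hx, hr, u0, um, ui, measurable_const, fun _ _ => rfl, ?_, ?_⟩,
      ⟨hC₁, aestronglyMeasurable_const, ?_, ?_, ?_⟩⟩
    · simp [EN]
    · exact hz.congr huU (Eventually.of_forall fun _ _ => rfl)
    · intro y hy; simp
    · intro y hy; simp
    · intro ψ _ _ _ _; simp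
  have hvl := (good_li hEo hgood).mono_set hsub
  have t3 : tsupport (cut x (3.85 * r) (3.95 * r)) ⊆ ball x (4 * r) :=
    (cut_tsupport (by linarith) (by linarith)).trans (closedBall_subset_ball (by linarith))
  obtain ⟨w, hw⟩ := hW.2 (cut x (3.85 * r) (3.95 * r)) (cut_contDiff _ _ _)
    (cut_hcs (by linarith) (by linarith)) t3
  have hwl : LocallyIntegrableOn w (ball x (3.8 * r) \ Γ) := hw.gradLocInt.mono_set fun y hy => hy.2
  have hwG : WG u w (ball x (3.8 * r) \ Γ) := by
    refine ((WG.of_distrib hw.isGrad).mono (fun y hy => hy.2)).congr (Eventually.of_forall fun y hy => ?_)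
      (Eventually.of_forall fun _ _ => rfl)
    rw [cut_eq_one (by linarith) (by linarith), one_mul]
    have := mem_ball.1 hy.1
    linarith
  have hvw := WG.uniq hUo (hWG.mono hsub) hwG hvl hwl
  have hm := hwl.aestronglyMeasurable
  set U := ball x (3.8 * r) \ Γ with hU
  set V : Euc n → Euc n := U.indicator (hm.mk w) with hV
  have hmw : ∀ᵐ y, y ∈ U → V y = w y := by
    filter_upwards [(ae_restrict_iff' hUo.measurableSet).1 hm.ae_eq_mk] with y hy h
    rw [hV, indicator_of_mem h, hy h]
  have hVm : Measurable V := hm.stronglyMeasurable_mk.measurable.indicator hUo.measurableSet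
  have hVv : ∀ᵐ y, y ∈ U → V y = v y := by
    filter_upwards [hmw, hvw] with y h1 h2 h using (h1 h).trans (h2 h).symm
  refine ⟨V, fun y => A y (V y), ⟨G, hx, hr, u0, um, ui, hVm, fun y hy => ?_, ?_, ?_⟩,
      ⟨hC₁, ?_, ?_, ?_, ?_⟩⟩
  · rw [hV, indicator_of_notMem (fun h => hy h.1)]
  · have h2 := hw.l2
    have mw := meas_w (n := n) (d := d) (Γ := Γ)
    rw [measW, setLIntegral_withDensity_eq_setLIntegral_mul_non_measurable _ mw.ennreal_ofReal _ G.cl.isOpen_compl.measurableSet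
      (Eventually.of_forall fun _ => ofReal_lt_top)] at h2
    refine lt_of_le_of_lt ?_ h2
    rw [← lintegral_indicator G.cl.isOpen_compl.measurableSet]
    unfold EN
    refine lintegral_mono_ae ?_
    filter_upwards [hmw] with y hy
    by_cases h : y ∈ U
    · rw [indicator_of_mem (show y ∈ Γᶜ from h.2), hy h, mul_comm, ofReal_mul (w_nonneg _)]
      exact le_rfl
    · rw [hV, indicator_of_notMem h]
      simp
  · exact hwG.congr huU hmw
  · exact isBoundedBilinearMap_apply.continuous.comp_aestronglyMeasurable (hA.prodMk hVm.aestronglyMeasurable)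
  · intro y hy
    have := (hE y hy).1 (V y) (A y (V y))
    rw [sum_mul_inner, real_inner_self_eq_norm_sq, abs_of_nonneg (sq_nonneg _), sq] at this
    rcases (norm_nonneg (A y (V y))).eq_or_lt with h0 | h0
    · show ‖A y (V y)‖ ≤ _
      rw [← h0]
      exact mul_nonneg (mul_nonneg (by linarith) (w_nonneg _)) (norm_nonneg _)
    · exact le_of_mul_le_mul_right this h0
  · intro y hy
    have := (hE y hy).2 (V y)
    rwa [sum_mul_inner] at this
  · intro ψ h1 h2 h3 h4
    have := hs ψ h1 h2 (h3.trans hsub) h4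
    rw [setIntegral_eq_integral_of_forall_compl_eq_zero] at this
    · refine this.trans_eq (integral_congr_ae ?_)
      filter_upwards [hVv] with y hy
      rw [sum_mul_inner]
      by_cases h : y ∈ tsupport ψ
      · rw [hy (h3 h)]
      · rw [gz0 h, inner_zero_right, inner_zero_right]
    · intro y hy
      rw [sum_mul_inner, gz0 (fun h => hy (h3 h).2), inner_zero_right]

theorem statement16 (n : ℕ) (hn : 2 ≤ n) (d : ℝ) (hd0 : 0 < d) (hdn : d < (n : ℝ) - 1)
    (C₀ C₁ : ℝ) (hC₀ : 1 ≤ C₀) (hC₁ : 1 ≤ C₁) :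
    ∃ C : ℝ, 0 < C ∧
      ∀ Γ : Set (Euc n), Γ.Nonempty → IsClosed Γ → AhlforsRegular n d C₀ Γ →
      ∀ A : Euc n → Euc n →L[ℝ] Euc n, AEStronglyMeasurable A volume →
        EllipticOn n d Γ A C₁ →
      ∀ x ∈ Γ, ∀ r : ℝ, 0 < r →
      ∀ u : Euc n → ℝ, ∀ v : Euc n → Euc n,
        MemWrOn n d Γ (ball x (4 * r)) u →
        IsDistribGradOn u v (ball x (4 * r) \ Γ) →
        (∀ᵐ y ∂(volume.restrict (ball x (4 * r) \ Γ)), 0 ≤ u y) →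
        SupersolOn Γ A v (ball x (4 * r) \ Γ) →
        (∀ᵐ z ∂(μH[d].restrict (Γ ∩ ball x (4 * r))), HasTraceAt u z 1) →
        ∀ᵐ y ∂(volume.restrict (ball x r \ Γ)), C⁻¹ ≤ u y := by
  obtain ⟨c, hc, H⟩ := dgfin n d C₀ C₁ hC₀ hC₁ hdn hn
  refine ⟨c⁻¹, inv_pos.2 hc, ?_⟩
  intro Γ hne hcl har A hA hE x hx r hr u v hW hg hpos hs ht
  have G : Geo n d C₀ Γ := ⟨hn, hd0, hdn, hC₀, hne, hcl, har⟩
  have hi : IntegrableOn u (ball x (3.8 * r)) :=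
    (hW.1.integrableOn_compact_subset (closedBall_subset_ball (by linarith : 3.8 * r < 4 * r))
      (isCompact_closedBall x (3.8 * r))).mono_set ball_subset_closedBall
  have hf : Integrable ((ball x (3.8 * r)).indicator u) := hi.integrable_indicator measurableSet_ball
  set u' : Euc n → ℝ := fun y => max (hf.1.mk _ y) 0 with hu'
  have hpos' := (ae_restrict_iff' (isOpen_ball.sdiff hcl).measurableSet).1 hpos
  have key : u' =ᵐ[volume] (ball x (3.8 * r)).indicator u := by
    filter_upwards [hf.1.ae_eq_mk, hpos', G.ae_notMem] with y h1 h2 h3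
    rw [hu']; dsimp only; rw [← h1]
    by_cases h : y ∈ ball x (3.8 * r)
    · rw [indicator_of_mem h]
      exact max_eq_left (h2 ⟨ball_subset_ball (by linarith) h, h3⟩)
    · rw [indicator_of_notMem h]; exact max_self _
  have hu : ∀ᵐ y, y ∈ ball x (3.8 * r) → u' y = u y := by
    filter_upwards [key] with y hy h
    rw [hy, indicator_of_mem h]
  have um : Measurable u' := hf.1.stronglyMeasurable_mk.measurable.max measurable_const
  obtain ⟨V, B, h1, h2⟩ := mk_data G hC₁ hA hE hx hr hW hg hs (u' := u') (fun y => le_max_right _ _) um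
    (hf.congr key.symm) hu
  have tr : ∀ᵐ y ∂(sg n d Γ), y ∈ ball x (3.8 * r) → HasTraceAt u' y 1 := by
    rw [ae_restrict_iff' (hcl.measurableSet.inter measurableSet_ball)] at ht
    unfold sg
    rw [ae_restrict_iff' hcl.measurableSet]
    filter_upwards [ht] with y hy hyG hyb
    exact trace_congr isOpen_ball hu hyb (hy ⟨hyG, ball_subset_ball (by linarith) hyb⟩)
  have fin := H Γ x r u' V B h1 h2 tr
  rw [inv_inv]
  rw [ae_restrict_iff' (isOpen_ball.sdiff hcl).measurableSet]
  filter_upwards [fin, hu] with y ha hb hy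
  rw [← hb (ball_subset_ball (by linarith) hy.1)]
  exact ha hy.1
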